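/- arXiv:2404.17921 — 4 statements merged into one kernel-verified Lean document; each statement's English description precedes it below -/
import Mathlib

section
/- Let p ≥ 5 be a prime such that the integer p² − 12 is squarefree. Then the polynomial F(x) = x⁸ + p·x⁴ + 3 is monogenic and its Galois group Gal(F) is isomorphic to the holomorph of the dihedral group of order 8, that is, to the semidirect product D₄ ⋊ Aut(D₄) in which Aut(D₄) acts on D₄ in the natural way. -/
open Polynomial

/-- A monic polynomial `f ∈ ℤ[x]` is *monogenic* if it is irreducible over `ℚ` and,
for any number field `K` generated over `ℚ` by a root `θ` of `f`, the ring `ℤ[θ]`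
is the full ring of integers (the integral closure of `ℤ`) of `K`. -/
def IsMonogenic (f : Polynomial ℤ) : Prop :=
  f.Monic ∧ Irreducible (f.map (Int.castRingHom ℚ)) ∧
    ∀ (K : Type) [Field K] [NumberField K] (θ : K),
      Polynomial.aeval θ f = 0 →
      Algebra.adjoin ℚ {θ} = (⊤ : Subalgebra ℚ K) →
      Algebra.adjoin ℤ {θ} = integralClosure ℤ K

/-- The holomorph of a group: the semidirect product of `G` with `Aut(G)` acting naturally. -/
abbrev Holomorph (G : Type) [Group G] : Type :=
  G ⋊[MonoidHom.id (MulAut G)] MulAut G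

/-- The automorphism `r i ↦ r (u i)`, `sr i ↦ sr (c + u i)` of a dihedral group. -/
def DihedralGroup.affineAut {n : ℕ} (u : (ZMod n)ˣ) (c : ZMod n) : MulAut (DihedralGroup n) where
  toFun
    | .r i => .r (u * i)
    | .sr i => .sr (c + u * i)
  invFun
    | .r i => .r (u⁻¹ * i)
    | .sr i => .sr (u⁻¹ * (i - c))
  left_inv x := by rcases x with i | i <;> simp
  right_inv x := by rcases x with i | i <;> simp
  map_mul' x y := by rcases x with i | i <;> rcases y with j | j <;> simp <;> ring

namespace DihedralGroup

@[simp] theorem affineAut_r {n : ℕ} (u : (ZMod n)ˣ) (c i : ZMod n) :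
    affineAut u c (r i) = r ((u : ZMod n) * i) := rfl

@[simp] theorem affineAut_sr {n : ℕ} (u : (ZMod n)ˣ) (c i : ZMod n) :
    affineAut u c (sr i) = sr (c + (u : ZMod n) * i) := rfl

theorem exists_eq_affineAut (f : MulAut (DihedralGroup 4)) :
    ∃ u c, f = affineAut u c := by
  have key : ∀ a : DihedralGroup 4, a ^ 2 ≠ 1 → ∃ u : (ZMod 4)ˣ, a = r (u : ZMod 4) := by decide
  obtain ⟨u, hu⟩ := key (f (r 1)) (by
    rw [← map_pow, ← map_one f, f.injective.ne_iff]; decide)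
  have hr : ∀ i : ZMod 4, f (r i) = r ((u : ZMod 4) * i) := by
    intro i
    have : (r i : DihedralGroup 4) = r 1 ^ i.val := by
      simp
    rw [this, map_pow, hu]
    simp
  rcases hs : f (sr 0) with j | c
  · have : f (r ((u⁻¹ : (ZMod 4)ˣ) * j)) = f (sr 0) := by rw [hr, hs]; simp
    simpa using f.injective this
  · refine ⟨u, c, MulEquiv.ext ?_⟩
    rintro (i | i)
    · exact hr i
    · have : (sr i : DihedralGroup 4) = sr 0 * r i := by simp
      rw [this, map_mul, hs, hr]; simp

theorem card_holomorph : Nat.card (Holomorph (DihedralGroup 4)) = 2 ^ 6 := by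
  have hb : Function.Bijective
      (fun x : (ZMod 4)ˣ × ZMod 4 => affineAut x.1 x.2) := by
    refine ⟨?_, fun f => ?_⟩
    · rintro ⟨u, c⟩ ⟨v, d⟩ h
      have h1 := DFunLike.congr_fun h (r 1)
      have h2 := DFunLike.congr_fun h (sr 0)
      simp at h1 h2
      simp [Units.ext_iff, h1, h2]
    · obtain ⟨u, c, h⟩ := exists_eq_affineAut f
      exact ⟨(u, c), h.symm⟩
  have h4 : Nat.card (ZMod 4)ˣ = 2 := by rw [Nat.card_eq_fintype_card]; decide
  rw [SemidirectProduct.card, ← Nat.card_eq_of_bijective _ hb, Nat.card_prod,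
    DihedralGroup.nat_card, h4, Nat.card_zmod]
  norm_num

/-- The sign of the swap of rotations and reflections. -/
def swapSign (h : Holomorph (DihedralGroup 4)) : ℤ :=
  match h.left with
  | .r _ => 1
  | .sr _ => -1

/-- The parity of the translation part of the automorphism component. -/
def shiftSign (h : Holomorph (DihedralGroup 4)) : ℤ :=
  match h.right (sr 0) with
  | .r _ => 1
  | .sr c => (-1) ^ c.val

/-- The sign describing whether the automorphism component inverts rotations. -/
def inversionSign (h : Holomorph (DihedralGroup 4)) : ℤ :=
  if h.right (r 1) = r 1 then 1 else -1

open SemidirectProduct in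
/-- A subgroup of index two of the holomorph of `D₄` is contained in the kernel of a nontrivial
product of the three basic sign characters. -/
theorem exists_sign_eq_one_of_index_two {M : Subgroup (Holomorph (DihedralGroup 4))}
    (hM : M.index = 2) :
    ∃ a b e : Fin 2, ¬ (a = 0 ∧ b = 0 ∧ e = 0) ∧ ∀ h ∈ M,
      swapSign h ^ (a : ℕ) * shiftSign h ^ (b : ℕ) * inversionSign h ^ (e : ℕ) = 1 := by
  classical
  have mul {x y : Holomorph (DihedralGroup 4)} : x * y ∈ M ↔ (x ∈ M ↔ y ∈ M) :=
    Subgroup.mul_mem_iff_of_index_two hM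
  let A : Holomorph (DihedralGroup 4) := inl (sr 0)
  let B : Holomorph (DihedralGroup 4) := inr (affineAut 1 1)
  let C : Holomorph (DihedralGroup 4) := inr (affineAut (-1) 0)
  have hr1 : (inl (r 1) : Holomorph (DihedralGroup 4)) ∈ M := by
    have h : A * inl (r 1) * B = B * A := by
      ext1 <;> simp [A, B]
    have := congrArg (· ∈ M) h
    simp only [mul, eq_iff_iff] at this
    tauto
  have hr (m : ZMod 4) : (inl (r m) : Holomorph (DihedralGroup 4)) ∈ M := by
    have : (r m : DihedralGroup 4) = r 1 ^ m.val := by simp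
    rw [this, map_pow]
    exact pow_mem hr1 _
  have hsr (m : ZMod 4) : inl (sr m) ∈ M ↔ A ∈ M := by
    have : (sr m : DihedralGroup 4) = sr 0 * r m := by simp
    rw [this, map_mul, mul]
    simp [hr m, A]
  have hB (c : ZMod 4) : inr (affineAut 1 c) = B ^ c.val := by
    rw [← map_pow]
    congr 1
    ext x
    revert c x
    decide
  have hu (u : (ZMod 4)ˣ) : u = 1 ∨ u = -1 := by revert u; decide
  have hC (c : ZMod 4) : inr (affineAut (-1) c) = B ^ c.val * C := by
    rw [← hB, ← map_mul]
    congr 1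
    ext x
    revert c x
    decide
  have hpow (c : ZMod 4) : B ^ c.val ∈ M ↔ (Even c.val ∨ B ∈ M) := by
    by_cases h : B ∈ M
    · simp [h, pow_mem h]
    · rcases Nat.even_or_odd' c.val with ⟨k, hk | hk⟩ <;>
      simp [hk, pow_succ, pow_mul, mul, h, pow_mem, parity_simps]
  have hform (h : Holomorph (DihedralGroup 4)) : ∃ g u c, h = inl g * inr (affineAut u c) := by
    obtain ⟨u, c, hc⟩ := exists_eq_affineAut h.right
    exact ⟨h.left, u, c, by rw [← hc, inl_left_mul_inr_right]⟩
  refine ⟨if A ∈ M then 0 else 1, if B ∈ M then 0 else 1, if C ∈ M then 0 else 1, ?_, ?_⟩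
  · intro h
    have hA' : A ∈ M := by by_contra h'; simp [h'] at h
    have hB' : B ∈ M := by by_contra h'; simp [h'] at h
    have hC' : C ∈ M := by by_contra h'; simp [h'] at h
    have : M = ⊤ := by
      rw [eq_top_iff]
      rintro h -
      obtain ⟨g, u, c, rfl⟩ := hform h
      refine mul_mem ?_ ?_
      · rcases g with m | m
        · exact hr m
        · exact (hsr m).2 hA'
      · rcases hu u with rfl | rfl
        · rw [hB]; exact pow_mem hB' _
        · rw [hC]; exact mul_mem (pow_mem hB' _) hC'
    rw [this] at hM
    simp at hM
  · intro h
    obtain ⟨g, u, c, rfl⟩ := hform h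
    have hne : (r (-1) : DihedralGroup 4) ≠ r 1 := by decide
    rcases g with m | m <;> rcases hu u with rfl | rfl <;> rw [mul] <;>
      simp only [hr, hsr] <;>
      simp only [swapSign, shiftSign, inversionSign, mul_left, mul_right, left_inl, left_inr,
        right_inl, right_inr, map_one, mul_one, one_mul, affineAut_r, affineAut_sr, mul_zero, add_zero,
        Units.val_neg, Units.val_one, hne, if_true, if_false] <;>
      simp only [hB, hC, mul, hpow] <;>
      rcases Nat.even_or_odd c.val with hc | hc <;>
      by_cases hA' : A ∈ M <;> by_cases hB' : B ∈ M <;> by_cases hC' : C ∈ M <;>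
      simp [hA', hB', hC', hc]

theorem eq_top_of_sign {H : Subgroup (Holomorph (DihedralGroup 4))}
    (hH : ∀ a b e : Fin 2, ¬ (a = 0 ∧ b = 0 ∧ e = 0) → ∃ h ∈ H,
      swapSign h ^ (a : ℕ) * shiftSign h ^ (b : ℕ) * inversionSign h ^ (e : ℕ) ≠ 1) :
    H = ⊤ := by
  by_contra hne
  have : Finite (Holomorph (DihedralGroup 4)) :=
    Nat.finite_of_card_ne_zero (by rw [card_holomorph]; norm_num)
  obtain ⟨n, hn, hcard⟩ := (Nat.dvd_prime_pow Nat.prime_two).1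
    (card_holomorph ▸ H.card_subgroup_dvd_card)
  have hn5 : n ≤ 5 := by
    by_contra hlt
    have : n = 6 := by omega
    exact hne (Subgroup.eq_top_of_card_eq H (by rw [hcard, card_holomorph, this]))
  have : Fact (Nat.Prime 2) := ⟨Nat.prime_two⟩
  obtain ⟨K, hK, hHK⟩ := Sylow.exists_subgroup_card_pow_prime_le (m := 5) 2
    (by rw [card_holomorph]; norm_num) H hcard hn5
  have hindex : K.index = 2 := by
    have := K.card_mul_index
    rw [hK, card_holomorph] at this
    omega
  obtain ⟨a, b, e, h0, h1⟩ := exists_sign_eq_one_of_index_two hindex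
  obtain ⟨h, hh, h2⟩ := hH a b e h0
  exact h2 (h1 h (hHK hh))

end DihedralGroup

section GaloisAction

open DihedralGroup

variable {L : Type*} [Field L]

/-- Labelling of the roots `I ^ k * θ`, `I ^ k * φ` by the elements of `D₄`. -/
def rootLabel (I θ φ : L) : DihedralGroup 4 → L
  | .r k => I ^ k.val * θ
  | .sr k => I ^ k.val * φ

theorem rootLabel_one (I θ φ : L) : rootLabel I θ φ 1 = θ := by
  change I ^ 0 * θ = θ
  rw [pow_zero, one_mul]

theorem pow_val_add {I : L} (hI : I ^ 2 = -1) (a b : ZMod 4) :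
    I ^ (a + b).val = I ^ a.val * I ^ b.val := by
  have h4 : I ^ 4 = 1 := by linear_combination (I ^ 2 - 1) * hI
  simpa [AddChar.zmodChar_apply] using (AddChar.zmodChar 4 h4).map_add_eq_mul a b

theorem pow_val_injective [CharZero L] {I : L} (hI : I ^ 2 = -1) :
    Function.Injective fun a : ZMod 4 => I ^ a.val := by
  have h4 : I ^ 4 = 1 := by linear_combination (I ^ 2 - 1) * hI
  have ho : orderOf I = 4 := orderOf_eq_prime_pow (p := 2) (n := 1)
    (by rw [pow_one, hI]; norm_num) h4
  intro a b h
  exact ZMod.val_injective 4 (pow_injOn_Iio_orderOf (by simpa [ho] using a.val_lt)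
    (by simpa [ho] using b.val_lt) h)

theorem pow_val_pow_four {I : L} (hI : I ^ 2 = -1) (a : ZMod 4) : (I ^ a.val) ^ 4 = 1 := by
  have h4 : I ^ 4 = 1 := by linear_combination (I ^ 2 - 1) * hI
  rw [← pow_mul, mul_comm, pow_mul, h4, one_pow]

theorem exists_eq_pow_val_mul {I θ y : L} (hI : I ^ 2 = -1) (hy : y ^ 4 = θ ^ 4) :
    ∃ k : ZMod 4, y = I ^ k.val * θ := by
  have h : (y - θ) * (y + θ) * ((y - I * θ) * (y + I * θ)) = 0 := by
    linear_combination hy - θ ^ 2 * (y ^ 2 - θ ^ 2) * hI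
  rcases mul_eq_zero.1 h with h | h <;> rcases mul_eq_zero.1 h with h | h
  · exact ⟨0, by simpa using sub_eq_zero.1 h⟩
  · refine ⟨2, ?_⟩
    change y = I ^ 2 * θ
    linear_combination h - θ * hI
  · refine ⟨1, ?_⟩
    change y = I ^ 1 * θ
    linear_combination h
  · refine ⟨3, ?_⟩
    change y = I ^ 3 * θ
    linear_combination h - I * θ * hI

theorem rootLabel_injective [CharZero L] {I θ φ : L} (hI : I ^ 2 = -1) (hθ : θ ≠ 0) (hφ : φ ≠ 0)
    (hne : θ ^ 4 ≠ φ ^ 4) : Function.Injective (rootLabel I θ φ) := by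
  rintro (a | a) (b | b) h <;> simp only [rootLabel] at h
  · rw [pow_val_injective hI (mul_right_cancel₀ hθ h)]
  · have := congrArg (· ^ 4) h
    simp only [mul_pow, pow_val_pow_four hI, one_mul] at this
    exact (hne this).elim
  · have := congrArg (· ^ 4) h
    simp only [mul_pow, pow_val_pow_four hI, one_mul] at this
    exact (hne this.symm).elim
  · rw [pow_val_injective hI (mul_right_cancel₀ hφ h)]

theorem exists_unit_map_pow_val [Algebra ℚ L] {I : L} (hI : I ^ 2 = -1) (σ : L ≃ₐ[ℚ] L) :
    ∃ u : (ZMod 4)ˣ, ∀ k : ZMod 4, σ (I ^ k.val) = I ^ ((u : ZMod 4) * k).val := by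
  have h : σ I = I ∨ σ I = -I := by
    rw [← sq_eq_sq_iff_eq_or_eq_neg, ← map_pow, hI, map_neg, map_one]
  rcases h with h | h
  · exact ⟨1, fun k => by simp [h]⟩
  · refine ⟨-1, fun k => ?_⟩
    have h3 : -I = I ^ 3 := by linear_combination -I * hI
    have h4 : I ^ 4 = 1 := by linear_combination (I ^ 2 - 1) * hI
    rw [map_pow, h, h3, ← pow_mul]
    have : ((-1 : (ZMod 4)ˣ) : ZMod 4) * k = ((3 * k.val : ℕ) : ZMod 4) := by
      revert k; decide
    rw [this, ZMod.val_natCast]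
    exact pow_eq_pow_mod _ h4

/-- Every automorphism permutes the roots through the holomorph of `D₄`. -/
theorem exists_holomorph_of_algEquiv [Algebra ℚ L] {I θ φ : L} (hI : I ^ 2 = -1)
    (hne : θ ^ 4 ≠ φ ^ 4) (σ : L ≃ₐ[ℚ] L)
    (hσθ : (σ θ) ^ 4 = θ ^ 4 ∨ (σ θ) ^ 4 = φ ^ 4) (hσφ : (σ φ) ^ 4 = θ ^ 4 ∨ (σ φ) ^ 4 = φ ^ 4) :
    ∃ h : Holomorph (DihedralGroup 4), ∀ x,
      σ (rootLabel I θ φ x) = rootLabel I θ φ (h.left * h.right x) := by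
  obtain ⟨u, hu⟩ := exists_unit_map_pow_val hI σ
  have hσne : (σ θ) ^ 4 ≠ (σ φ) ^ 4 := by
    rw [← map_pow, ← map_pow]
    exact σ.injective.ne hne
  rcases hσθ with h1 | h1
  · have h2 : (σ φ) ^ 4 = φ ^ 4 := hσφ.resolve_left fun h => hσne (h1.trans h.symm)
    obtain ⟨m, hm⟩ := exists_eq_pow_val_mul hI h1
    obtain ⟨n, hn⟩ := exists_eq_pow_val_mul hI h2
    refine ⟨⟨r m, affineAut u (n + m)⟩, ?_⟩
    rintro (k | k)
    · simp only [rootLabel, affineAut_r, r_mul_r, map_mul, hu, hm, pow_val_add hI]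
      ring
    · simp only [rootLabel, affineAut_sr, r_mul_sr, map_mul, hu, hn]
      rw [show n + m + (u : ZMod 4) * k - m = u * k + n by ring, pow_val_add hI]
      ring
  · have h2 : (σ φ) ^ 4 = θ ^ 4 := hσφ.resolve_right fun h => hσne (h1.trans h.symm)
    obtain ⟨m, hm⟩ := exists_eq_pow_val_mul hI h1
    obtain ⟨n, hn⟩ := exists_eq_pow_val_mul hI h2
    refine ⟨⟨sr m, affineAut u (n + m)⟩, ?_⟩
    rintro (k | k)
    · simp only [rootLabel, affineAut_r, sr_mul_r, map_mul, hu, hm, pow_val_add hI]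
      ring
    · simp only [rootLabel, affineAut_sr, sr_mul_sr, map_mul, hu, hn]
      rw [show n + m + (u : ZMod 4) * k - m = u * k + n by ring, pow_val_add hI]
      ring

theorem holomorph_ext {h h' : Holomorph (DihedralGroup 4)}
    (H : ∀ x, h.left * h.right x = h'.left * h'.right x) : h = h' := by
  have h1 : h.left = h'.left := by simpa using H 1
  refine SemidirectProduct.ext h1 (MulEquiv.ext fun x => ?_)
  simpa [h1] using H x

theorem map_swap [Algebra ℚ L] {I θ φ : L} (hI : I ^ 2 = -1) {σ : L ≃ₐ[ℚ] L}
    {h : Holomorph (DihedralGroup 4)}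
    (hσ : ∀ x, σ (rootLabel I θ φ x) = rootLabel I θ φ (h.left * h.right x)) {c : ℤ}
    (hsum : θ ^ 4 + φ ^ 4 = -c) :
    σ (2 * θ ^ 4 + c) = swapSign h * (2 * θ ^ 4 + c) := by
  have h0 := hσ 1
  have e0 : rootLabel I θ φ 1 = θ := rootLabel_one ..
  rw [map_one, mul_one, e0] at h0
  rcases hl : h.left with m | m <;> rw [hl] at h0 <;> simp only [rootLabel] at h0 <;>
    simp only [map_add, map_mul, map_pow, h0, mul_pow, pow_val_pow_four hI, swapSign, hl,
      map_intCast, map_ofNat]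
  · simp
  · push_cast
    linear_combination 2 * hsum

theorem map_shift [Algebra ℚ L] {I θ φ : L} (hI : I ^ 2 = -1) {σ : L ≃ₐ[ℚ] L}
    {h : Holomorph (DihedralGroup 4)}
    (hσ : ∀ x, σ (rootLabel I θ φ x) = rootLabel I θ φ (h.left * h.right x)) :
    σ (θ ^ 2 * φ ^ 2) = shiftSign h * (θ ^ 2 * φ ^ 2) := by
  have h0 := hσ 1
  have h1 := hσ (sr 0)
  have e0 : rootLabel I θ φ 1 = θ := rootLabel_one ..
  have e1 : rootLabel I θ φ (sr 0) = φ := by simp [rootLabel]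
  rw [map_one, mul_one, e0] at h0
  obtain ⟨u, c, hc⟩ := exists_eq_affineAut h.right
  have hsub (m : ZMod 4) : (I ^ m.val) ^ 2 * (I ^ (c - m).val) ^ 2 = (-1) ^ c.val := by
    rw [← mul_pow, ← pow_val_add hI, add_sub_cancel, ← pow_mul, mul_comm, pow_mul, hI]
  rw [hc, e1] at h1
  simp only [affineAut_sr, mul_zero, add_zero] at h1
  rcases hl : h.left with m | m <;> rw [hl] at h0 h1 <;>
    simp only [rootLabel, r_mul_sr, sr_mul_sr] at h0 h1 <;>
    simp only [map_mul, map_pow, h0, h1, shiftSign, hc, affineAut_sr, mul_zero, add_zero] <;>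
    push_cast <;> linear_combination (θ ^ 2 * φ ^ 2) * hsub m

theorem map_inversion [Algebra ℚ L] [CharZero L] {I θ φ : L} (hI : I ^ 2 = -1) (hθ : θ ≠ 0)
    (hφ : φ ≠ 0) {σ : L ≃ₐ[ℚ] L} {h : Holomorph (DihedralGroup 4)}
    (hσ : ∀ x, σ (rootLabel I θ φ x) = rootLabel I θ φ (h.left * h.right x)) :
    σ I = inversionSign h * I := by
  have h0 := hσ 1
  have h1 := hσ (r 1)
  have e0 : rootLabel I θ φ 1 = θ := rootLabel_one ..
  have e1 : rootLabel I θ φ (r 1) = I * θ := by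
    change I ^ 1 * θ = _
    rw [pow_one]
  rw [map_one, mul_one, e0] at h0
  obtain ⟨u, c, hc⟩ := exists_eq_affineAut h.right
  rw [hc, e1, map_mul, h0] at h1
  simp only [affineAut_r, mul_one] at h1
  have hI0 : I ≠ 0 := by rintro rfl; norm_num at hI
  have key : σ I = I ^ (u : ZMod 4).val := by
    rcases hl : h.left with m | m <;> rw [hl] at h1 <;>
      simp only [rootLabel, r_mul_r, sr_mul_r, pow_val_add hI] at h1
    · refine mul_right_cancel₀ (mul_ne_zero (pow_ne_zero m.val hI0) hθ) ?_
      rw [h1]; ring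
    · refine mul_right_cancel₀ (mul_ne_zero (pow_ne_zero m.val hI0) hφ) ?_
      rw [h1]; ring
  have hu : ∀ u : (ZMod 4)ˣ, u = 1 ∨ u = -1 := by decide
  rw [key, inversionSign, hc, affineAut_r]
  rcases hu u with rfl | rfl
  · change I ^ 1 = _
    simp
  · have hne : (r (-1) : DihedralGroup 4) ≠ r 1 := by decide
    change I ^ 3 = _
    simp [hne]
    linear_combination I * hI

end GaloisAction

theorem not_isSquare_intCast_of_squarefree {n : ℤ} (hn : Squarefree n) (h1 : 1 < n) :
    ¬ IsSquare (n : ℚ) := by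
  rw [Rat.isSquare_intCast_iff]
  rintro ⟨z, rfl⟩
  have := hn z dvd_rfl
  rcases Int.isUnit_iff.1 this with rfl | rfl <;> norm_num at h1

/-- If `-1`, `3` and `c² - 12` are independent modulo rational squares, then the Galois group of
`X⁸ + c X⁴ + 3` is the holomorph of `D₄`. -/
theorem nonempty_algEquiv_mulEquiv_holomorph {L : Type*} [Field L] [Algebra ℚ L] (c : ℤ)
    [hL : IsSplittingField ℚ L (X ^ 8 + C (c : ℚ) * X ^ 4 + C 3)] [IsGalois ℚ L]
    [FiniteDimensional ℚ L] (hc : 0 < c ^ 2 - 12)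
    (h3 : ¬ IsSquare (3 : ℚ)) (hD : ¬ IsSquare (((c ^ 2 - 12 : ℤ) : ℚ)))
    (h3D : ¬ IsSquare (((3 * (c ^ 2 - 12) : ℤ) : ℚ))) :
    Nonempty ((L ≃ₐ[ℚ] L) ≃* Holomorph (DihedralGroup 4)) := by
  have : CharZero L := algebraRat.charZero L
  set F : ℚ[X] := X ^ 8 + C (c : ℚ) * X ^ 4 + C 3 with hF
  have hmap : F.map (algebraMap ℚ L) = X ^ 8 + C (c : L) * X ^ 4 + C 3 := by
    simp [hF]
  have hsplit : (X ^ 8 + C (c : L) * X ^ 4 + C 3 : L[X]).Splits := hmap ▸ hL.splits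
  have hFdeg : (X ^ 8 + C (c : L) * X ^ 4 + C 3 : L[X]).degree = 8 := by compute_degree!
  have hF0 : (X ^ 8 + C (c : L) * X ^ 4 + C 3 : L[X]) ≠ 0 := fun h => by
    rw [h, degree_zero] at hFdeg
    exact absurd hFdeg (by decide)
  obtain ⟨θ, hθ⟩ := hsplit.exists_eval_eq_zero (by rw [hFdeg]; norm_num)
  have hroot : θ ^ 8 + c * θ ^ 4 + 3 = 0 := by simpa using hθ
  have hθ0 : θ ≠ 0 := by rintro rfl; norm_num at hroot
  have hfac : (X ^ 8 + C (c : L) * X ^ 4 + C 3 : L[X]) =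
      (X ^ 2 - C (θ ^ 2)) * (X ^ 2 + C (θ ^ 2)) * (X ^ 4 + C (c + θ ^ 4)) := by
    have := congrArg C hroot
    simp only [map_add, map_mul, map_pow, map_zero] at this ⊢
    linear_combination this
  have hdeg2 : (X ^ 2 + C (θ ^ 2) : L[X]).degree = 2 := by compute_degree!
  have hdeg4 : (X ^ 4 + C (c + θ ^ 4) : L[X]).degree = 4 := by compute_degree!
  obtain ⟨η, hη⟩ := (hsplit.of_dvd hF0
    (hfac ▸ (dvd_mul_left _ _).mul_right _ : X ^ 2 + C (θ ^ 2) ∣ _)).exists_eval_eq_zero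
    (by rw [hdeg2]; norm_num)
  obtain ⟨φ, hφ⟩ := (hsplit.of_dvd hF0
    (hfac ▸ dvd_mul_left _ _ : X ^ 4 + C (c + θ ^ 4) ∣ _)).exists_eval_eq_zero
    (by rw [hdeg4]; norm_num)
  have hsum : θ ^ 4 + φ ^ 4 = -c := by
    have : φ ^ 4 + (c + θ ^ 4) = 0 := by simpa using hφ
    linear_combination this
  have hprod : θ ^ 4 * φ ^ 4 = 3 := by linear_combination θ ^ 4 * hsum - hroot
  have hφ0 : φ ≠ 0 := by rintro rfl; norm_num at hprod
  obtain ⟨I, hI⟩ : ∃ I : L, I ^ 2 = -1 := by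
    refine ⟨η / θ, ?_⟩
    have : η ^ 2 + θ ^ 2 = 0 := by simpa using hη
    field_simp
    linear_combination this
  have hsq : (2 * θ ^ 4 + c) ^ 2 = ((c ^ 2 - 12 : ℤ) : L) := by
    push_cast
    linear_combination 4 * hroot
  have hne : θ ^ 4 ≠ φ ^ 4 := by
    intro h
    have : 2 * θ ^ 4 + c = 0 := by linear_combination hsum + h
    rw [this, zero_pow two_ne_zero, eq_comm, Int.cast_eq_zero] at hsq
    exact hc.ne' hsq
  have hrootσ (y : L) (hy : y ^ 8 + c * y ^ 4 + 3 = 0) : y ^ 4 = θ ^ 4 ∨ y ^ 4 = φ ^ 4 := by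
    have : (y ^ 4 - θ ^ 4) * (y ^ 4 - φ ^ 4) = 0 := by
      linear_combination hy - y ^ 4 * hsum + hprod
    simpa [sub_eq_zero] using this
  have hrootφ : φ ^ 8 + c * φ ^ 4 + 3 = 0 := by linear_combination φ ^ 4 * hsum - hprod
  have hex (σ : L ≃ₐ[ℚ] L) : ∃ h : Holomorph (DihedralGroup 4), ∀ x,
      σ (rootLabel I θ φ x) = rootLabel I θ φ (h.left * h.right x) :=
    exists_holomorph_of_algEquiv hI hne σ
      (hrootσ _ (by simpa [map_ofNat] using congrArg σ hroot))
      (hrootσ _ (by simpa [map_ofNat] using congrArg σ hrootφ))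
  have hinj := rootLabel_injective hI hθ0 hφ0 hne
  choose j hj using hex
  let J : (L ≃ₐ[ℚ] L) →* Holomorph (DihedralGroup 4) := MonoidHom.mk' j fun σ τ => by
    refine holomorph_ext fun x => hinj ?_
    rw [← hj, AlgEquiv.mul_apply, hj, hj]
    simp [mul_assoc]
  have hJinj : Function.Injective J := by
    rw [injective_iff_map_eq_one]
    intro σ hσ
    have hσ' : j σ = 1 := hσ
    have hfix (x) : σ (rootLabel I θ φ x) = rootLabel I θ φ x := by simp [hj, hσ']
    have : (σ : L →ₐ[ℚ] L) = AlgHom.id ℚ L := by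
      refine AlgHom.ext_of_adjoin_eq_top hL.adjoin_rootSet fun y hy => ?_
      have hy' : y ^ 8 + c * y ^ 4 + 3 = 0 := by
        simpa [hF] using (mem_rootSet.1 hy).2
      rcases hrootσ y hy' with h | h <;> obtain ⟨k, rfl⟩ := exists_eq_pow_val_mul hI h
      · exact hfix (.r k)
      · exact hfix (.sr k)
    exact AlgEquiv.ext fun y => DFunLike.congr_fun this y
  have hJtop : J.range = ⊤ := by
    refine DihedralGroup.eq_top_of_sign fun a b e h0 => ?_
    by_contra! hall
    have hfixed : ∀ σ : L ≃ₐ[ℚ] L,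
        σ ((2 * θ ^ 4 + c) ^ (a : ℕ) * (θ ^ 2 * φ ^ 2) ^ (b : ℕ) * I ^ (e : ℕ)) =
          (2 * θ ^ 4 + c) ^ (a : ℕ) * (θ ^ 2 * φ ^ 2) ^ (b : ℕ) * I ^ (e : ℕ) := by
      intro σ
      have hs := congrArg (Int.cast : ℤ → L) (hall (j σ) ⟨σ, rfl⟩)
      push_cast at hs
      rw [map_mul, map_mul, map_pow, map_pow, map_pow, map_swap hI (hj σ) hsum,
        map_shift hI (hj σ), map_inversion hI hθ0 hφ0 (hj σ), mul_pow, mul_pow, mul_pow]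
      linear_combination (2 * θ ^ 4 + c) ^ (a : ℕ) * (θ ^ 2 * φ ^ 2) ^ (b : ℕ) * I ^ (e : ℕ) * hs
    obtain ⟨q, hq⟩ := IntermediateField.mem_bot.1 ((IsGalois.mem_bot_iff_fixed _).2 hfixed)
    have hq2 : q ^ 2 = ((c ^ 2 - 12 : ℤ) : ℚ) ^ (a : ℕ) * 3 ^ (b : ℕ) * (-1) ^ (e : ℕ) := by
      apply (algebraMap ℚ L).injective
      have hsq3 : (θ ^ 2 * φ ^ 2) ^ 2 = 3 := by linear_combination hprod
      rw [map_pow, hq, mul_pow, mul_pow, ← pow_mul, ← pow_mul, ← pow_mul, mul_comm _ 2,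
        mul_comm _ 2, mul_comm _ 2, pow_mul, pow_mul, pow_mul, hsq, hsq3, hI]
      simp
    have hcq : (0 : ℚ) < ((c ^ 2 - 12 : ℤ) : ℚ) := by exact_mod_cast hc
    fin_cases a <;> fin_cases b <;> fin_cases e <;>
      simp only [Fin.zero_eta, Fin.mk_one, Fin.isValue, pow_zero, pow_one,
        one_mul, mul_one, not_true_eq_false, and_self] at h0 hq2
    · nlinarith [sq_nonneg q]
    · exact h3 ⟨q, by rw [← hq2, sq]⟩
    · nlinarith [sq_nonneg q]
    · exact hD ⟨q, by rw [← hq2, sq]⟩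
    · nlinarith [sq_nonneg q]
    · refine h3D ⟨q, ?_⟩
      rw [← sq, hq2]
      push_cast
      ring
    · nlinarith [sq_nonneg q]
  exact ⟨MulEquiv.ofBijective J ⟨hJinj, MonoidHom.range_eq_top.1 hJtop⟩⟩

section Monogenic

theorem irreducible_X_sq_add_X_add_one_zmod_two :
    Irreducible (X ^ 2 + X + 1 : (ZMod 2)[X]) := by
  have hdeg : (X ^ 2 + X + 1 : (ZMod 2)[X]).natDegree = 2 := by compute_degree!
  refine Polynomial.irreducible_of_degree_le_three_of_not_isRoot (by simp [hdeg]) fun x => ?_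
  simp only [IsRoot.def, eval_add, eval_pow, eval_X, eval_one]
  revert x
  decide

theorem octic_map_zmod_two {c : ℤ} (hc : Odd c) :
    (X ^ 8 + C c * X ^ 4 + C 3 : ℤ[X]).map (Int.castRingHom (ZMod 2)) = (X ^ 2 + X + 1) ^ 4 := by
  have hc1 : ((c : ℤ) : ZMod 2) = 1 := ZMod.intCast_eq_one_iff_odd.2 hc
  have h2 : (2 : (ZMod 2)[X]) = 0 := CharTwo.two_eq_zero
  simp only [Polynomial.map_add, Polynomial.map_mul, Polynomial.map_pow, map_X, map_C]
  simp only [eq_intCast, hc1, map_one, map_ofNat]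
  linear_combination (1 - (2 * X ^ 7 + 5 * X ^ 6 + 8 * X ^ 5 + 9 * X ^ 4 + 8 * X ^ 3 + 5 * X ^ 2
    + 2 * X)) * h2

theorem octic_monic (c : ℤ) : (X ^ 8 + C c * X ^ 4 + C 3 : ℤ[X]).Monic := by
  monicity!

theorem octic_irreducible {c : ℤ} (hc : Odd c) :
    Irreducible (X ^ 8 + C c * X ^ 4 + C 3 : ℤ[X]) := by
  have hq : (X ^ 2 + X + 1 : ℤ[X]).Monic := by monicity!
  have hker : RingHom.ker (algebraMap ℤ (ZMod 2)) = Ideal.span {2} := by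
    simpa using ZMod.ker_intCastRingHom 2
  have hmod : (X ^ 8 + C c * X ^ 4 + C 3 : ℤ[X]) %ₘ (X ^ 2 + X + 1) = C (c - 1) * X + C 2 := by
    refine (div_modByMonic_unique (X ^ 2 * (X ^ 3 + 1) * (X - 1) + 1 + C c * X * (X - 1)) _ hq
      ⟨?_, ?_⟩).2
    · simp only [map_sub, map_one, map_ofNat]
      ring
    · have h2 : (X ^ 2 + X + 1 : ℤ[X]).degree = 2 := by compute_degree!
      rw [h2]
      exact degree_linear_le.trans_lt (by norm_num)
  refine generalizedEisenstein (K := ZMod 2) (q := X ^ 2 + X + 1) (p := 4) ?_ hq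
    (octic_monic c).isPrimitive ?_ ?_ ?_ ?_
  · simpa using irreducible_X_sq_add_X_add_one_zmod_two
  · have : (X ^ 8 + C c * X ^ 4 + C 3 : ℤ[X]).natDegree = 8 := by compute_degree!
    omega
  · rw [(octic_monic c).leadingCoeff]; simp
  · rw [(octic_monic c).leadingCoeff]
    simpa using octic_map_zmod_two hc
  · rw [hmod, hker]
    intro h
    have h0 := congrArg (coeff · 0) h
    simp only [coeff_map, coeff_add, coeff_C_mul, coeff_X_zero, mul_zero, zero_add, coeff_C_zero,
      coeff_zero, Ideal.Quotient.eq_zero_iff_mem, Ideal.span_singleton_pow,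
      Ideal.mem_span_singleton] at h0
    norm_num at h0

theorem octic_irreducible_rat {c : ℤ} (hc : Odd c) :
    Irreducible ((X ^ 8 + C c * X ^ 4 + C 3 : ℤ[X]).map (Int.castRingHom ℚ)) :=
  (octic_monic c).irreducible_iff_irreducible_map_fraction_map.1 (octic_irreducible hc)

theorem dvd_of_squarefree_of_forall_prime {n m : ℤ} (hn : Squarefree n)
    (h : ∀ q : ℕ, q.Prime → (q : ℤ) ∣ n → (q : ℤ) ∣ m) : n ∣ m := by
  rw [← Int.natAbs_dvd_natAbs,
    ← Nat.prod_primeFactors_of_squarefree (Int.squarefree_natAbs.2 hn)]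
  refine Finset.prod_primes_dvd _ (fun q hq => (Nat.prime_of_mem_primeFactors hq).prime)
    fun q hq => ?_
  have := h q (Nat.prime_of_mem_primeFactors hq)
    (Int.natCast_dvd.2 (Nat.dvd_of_mem_primeFactors hq))
  exact Int.natCast_dvd.1 this

variable {K : Type*} [Field K]

theorem exists_pow_mul_eq_mul {S : Subalgebra ℤ K} {t x : K} (ht : t ∈ S) (hx : IsIntegral ℤ x)
    (htx : t * x ∈ S) : ∃ n : ℕ, ∃ s ∈ S, (t * x) ^ n = t * s := by
  obtain ⟨P, hP, hPx⟩ := hx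
  refine ⟨P.natDegree, -∑ i ∈ Finset.range P.natDegree,
    P.coeff i • ((t * x) ^ i * t ^ (P.natDegree - i - 1)), ?_, ?_⟩
  · exact neg_mem (sum_mem fun i _ => S.smul_mem (mul_mem (pow_mem htx _) (pow_mem ht _)) _)
  · rw [← aeval_def, hP.as_sum] at hPx
    simp only [map_add, map_pow, aeval_X, map_sum, map_mul, aeval_C] at hPx
    rw [mul_pow, eq_neg_of_add_eq_zero_left hPx, mul_neg, mul_neg, Finset.mul_sum, Finset.mul_sum]
    refine congrArg Neg.neg (Finset.sum_congr rfl fun i hi => ?_)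
    have hi' : P.natDegree = i + (P.natDegree - i - 1) + 1 := by
      have := Finset.mem_range.1 hi
      omega
    rw [Algebra.smul_def]
    nth_rewrite 1 [hi']
    ring

theorem exists_aeval_eq {θ a : K} (ha : a ∈ Algebra.adjoin ℤ {θ}) : ∃ A : ℤ[X], aeval θ A = a := by
  rwa [Algebra.adjoin_singleton_eq_range_aeval] at ha

theorem aeval_mem_adjoin (θ : K) (A : ℤ[X]) : aeval θ A ∈ Algebra.adjoin ℤ {θ} := by
  rw [Algebra.adjoin_singleton_eq_range_aeval]
  exact ⟨A, rfl⟩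

/-- Combining integrality with the fact that `f` generates the relations satisfied by `θ`. -/
theorem exists_dvd_pow_sub_mul {θ x : K} {f : ℤ[X]} (hf : ∀ A : ℤ[X], aeval θ A = 0 → f ∣ A)
    (hx : IsIntegral ℤ x) (T : ℤ[X]) (hT : aeval θ T * x ∈ Algebra.adjoin ℤ {θ}) :
    ∃ A B : ℤ[X], ∃ n : ℕ, aeval θ A = aeval θ T * x ∧ f ∣ A ^ n - T * B := by
  obtain ⟨A, hA⟩ := exists_aeval_eq hT
  obtain ⟨n, s, hs, hn⟩ := exists_pow_mul_eq_mul (aeval_mem_adjoin θ T) hx hT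
  obtain ⟨B, rfl⟩ := exists_aeval_eq hs
  exact ⟨A, B, n, hA, hf _ (by simp [hA, hn])⟩

theorem exists_eq_mul_add_C_mul {A G : ℤ[X]} {q : ℕ}
    (h : G.map (Int.castRingHom (ZMod q)) ∣ A.map (Int.castRingHom (ZMod q))) :
    ∃ Q T : ℤ[X], A = G * Q + C (q : ℤ) * T := by
  obtain ⟨Q', hQ'⟩ := h
  obtain ⟨Q, rfl⟩ := Polynomial.map_surjective (Int.castRingHom (ZMod q))
    (ZMod.ringHom_surjective _) Q'
  have : C (q : ℤ) ∣ A - G * Q := by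
    rw [C_dvd_iff_dvd_coeff]
    intro i
    rw [← ZMod.intCast_zmod_eq_zero_iff_dvd, ← eq_intCast (Int.castRingHom (ZMod q)), ← coeff_map]
    simp [hQ']
  obtain ⟨T, hT⟩ := this
  exact ⟨Q, T, by rw [← hT]; ring⟩

variable {θ x : K} {c : ℤ}

theorem mem_adjoin_of_mul_root_mem [CharZero K] (hθ : θ ^ 8 + c * θ ^ 4 + 3 = 0)
    (hf : ∀ A : ℤ[X], aeval θ A = 0 → X ^ 8 + C c * X ^ 4 + C 3 ∣ A)
    (hx : IsIntegral ℤ x) (h : θ * x ∈ Algebra.adjoin ℤ {θ}) : x ∈ Algebra.adjoin ℤ {θ} := by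
  obtain ⟨A, B, n, hA, hdvd⟩ := exists_dvd_pow_sub_mul hf hx X (by simpa using h)
  have h0 : (3 : ℤ) ∣ A.coeff 0 := by
    have := eval_dvd (x := 0) hdvd
    simp only [eval_add, eval_mul, eval_pow, eval_X, eval_C, eval_sub] at this
    rw [coeff_zero_eq_eval_zero]
    exact Int.prime_three.dvd_of_dvd_pow (by simpa using this)
  obtain ⟨t, ht⟩ := h0
  have hθ0 : θ ≠ 0 := by rintro rfl; norm_num at hθ
  have key : x = aeval θ (A.divX - C t * (X ^ 7 + C c * X ^ 3)) := by
    apply mul_left_cancel₀ hθ0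
    have : aeval θ (X * A.divX + C (A.coeff 0)) = θ * x := by
      rw [X_mul_divX_add, hA, aeval_X]
    rw [← this, ht]
    simp [map_ofNat]
    linear_combination (t : K) * hθ
  rw [key]
  exact aeval_mem_adjoin _ _

theorem mem_adjoin_of_two_mul_mem_of_mul_mem (hc : Odd c) (hθ : θ ^ 8 + c * θ ^ 4 + 3 = 0)
    (hv : θ ^ 2 + θ + 1 ≠ 0)
    (hf : ∀ A : ℤ[X], aeval θ A = 0 → X ^ 8 + C c * X ^ 4 + C 3 ∣ A)
    (hx : IsIntegral ℤ x) (h2 : 2 * x ∈ Algebra.adjoin ℤ {θ})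
    (h : (θ ^ 2 + θ + 1) * x ∈ Algebra.adjoin ℤ {θ}) : x ∈ Algebra.adjoin ℤ {θ} := by
  obtain ⟨A, B, n, hA, hdvd⟩ := exists_dvd_pow_sub_mul hf hx (X ^ 2 + X + 1) (by simpa using h)
  have hmod := Polynomial.map_dvd (Int.castRingHom (ZMod 2)) hdvd
  rw [octic_map_zmod_two hc] at hmod
  have hdvd2 : (X ^ 2 + X + 1 : ℤ[X]).map (Int.castRingHom (ZMod 2)) ∣
      A.map (Int.castRingHom (ZMod 2)) := by
    simp only [Polynomial.map_add, Polynomial.map_sub, Polynomial.map_mul, Polynomial.map_pow,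
      Polynomial.map_one, map_X] at hmod ⊢
    refine irreducible_X_sq_add_X_add_one_zmod_two.prime.dvd_of_dvd_pow (n := n) ?_
    rw [← dvd_sub_left (dvd_mul_right _ (B.map (Int.castRingHom (ZMod 2))))]
    exact (dvd_pow_self _ four_ne_zero).trans hmod
  obtain ⟨Q, T, rfl⟩ := exists_eq_mul_add_C_mul hdvd2
  obtain ⟨k, rfl⟩ := hc
  obtain ⟨l, hl⟩ : Even (k ^ 2 - k) := by
    rw [sq, ← mul_sub_one]; exact Int.even_mul_pred_self k
  set H : ℤ[X] := -2 * X ^ 5 - 3 * X ^ 4 - 3 * X ^ 3 - 3 * X ^ 2 - 2 * X + C k * (X ^ 2 - X)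
  set v : K := θ ^ 2 + θ + 1
  set N : K := k * θ + 1 + v * aeval θ H with hN
  have hvN : v ^ 4 = -2 * N := by
    simp [hN, v, H, map_ofNat]
    push_cast at hθ
    linear_combination hθ
  have hNx : N * x = N * aeval θ Q - v ^ 3 * aeval θ T := by
    apply mul_left_cancel₀ hv
    simp [map_ofNat, -eq_intCast] at hA
    linear_combination (-N) * hA + aeval θ T * hvN
  have hl' : (k : K) ^ 2 - k = l + l := by exact_mod_cast congrArg (Int.cast : ℤ → K) hl
  have key : x = (1 - k - k * θ) * (N * aeval θ Q - v ^ 3 * aeval θ T) - l * (2 * x)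
      + (k ^ 2 - (1 - k - k * θ) * aeval θ H) * (v * x) := by
    rw [← hNx, hN]
    simp only [v]
    linear_combination (-x) * hl'
  have hθS : θ ∈ Algebra.adjoin ℤ {θ} := Algebra.self_mem_adjoin_singleton ℤ θ
  have hkS : (k : K) ∈ Algebra.adjoin ℤ {θ} := intCast_mem _ k
  have hlS : (l : K) ∈ Algebra.adjoin ℤ {θ} := intCast_mem _ l
  have hvS : v ∈ Algebra.adjoin ℤ {θ} := add_mem (add_mem (pow_mem hθS 2) hθS) (one_mem _)
  have hHS := aeval_mem_adjoin θ H
  have hE : (1 - k - k * θ : K) ∈ Algebra.adjoin ℤ {θ} :=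
    sub_mem (sub_mem (one_mem _) hkS) (mul_mem hkS hθS)
  have hNS : N ∈ Algebra.adjoin ℤ {θ} :=
    add_mem (add_mem (mul_mem hkS hθS) (one_mem _)) (mul_mem hvS hHS)
  rw [key]
  exact add_mem (sub_mem (mul_mem hE (sub_mem (mul_mem hNS (aeval_mem_adjoin θ Q))
    (mul_mem (pow_mem hvS 3) (aeval_mem_adjoin θ T)))) (mul_mem hlS h2))
    (mul_mem (sub_mem (pow_mem hkS 2) (mul_mem hE hHS)) h)

theorem mem_adjoin_of_two_mul_mem (hc : Odd c) (hθ : θ ^ 8 + c * θ ^ 4 + 3 = 0)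
    (hf : ∀ A : ℤ[X], aeval θ A = 0 → X ^ 8 + C c * X ^ 4 + C 3 ∣ A)
    (hx : IsIntegral ℤ x) (h2 : 2 * x ∈ Algebra.adjoin ℤ {θ}) : x ∈ Algebra.adjoin ℤ {θ} := by
  have hv : θ ^ 2 + θ + 1 ≠ 0 := by
    intro hv
    have hdvd := hf (X ^ 2 + X + 1) (by simpa using hv)
    have h0 : (X ^ 2 + X + 1 : ℤ[X]) ≠ 0 := (show (X ^ 2 + X + 1 : ℤ[X]).Monic by monicity!).ne_zero
    have := natDegree_le_of_dvd hdvd h0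
    have h8 : (X ^ 8 + C c * X ^ 4 + C 3 : ℤ[X]).natDegree = 8 := by compute_degree!
    have h2 : (X ^ 2 + X + 1 : ℤ[X]).natDegree = 2 := by compute_degree!
    omega
  have hθS : θ ∈ Algebra.adjoin ℤ {θ} := Algebra.self_mem_adjoin_singleton ℤ θ
  have hθI : IsIntegral ℤ θ := ⟨_, octic_monic c, by
    rw [← aeval_def]
    simpa [map_ofNat] using hθ⟩
  set v : K := θ ^ 2 + θ + 1
  have hvS : v ∈ Algebra.adjoin ℤ {θ} := add_mem (add_mem (pow_mem hθS 2) hθS) (one_mem _)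
  have hvI : IsIntegral ℤ v := ((hθI.pow 2).add hθI).add isIntegral_one
  have hv4 : ∃ s ∈ Algebra.adjoin ℤ {θ}, v ^ 4 = 2 * s := by
    obtain ⟨k, rfl⟩ := hc
    refine ⟨aeval θ (-(C k * X ^ 4 + 1 - (2 * X ^ 7 + 5 * X ^ 6 + 8 * X ^ 5 + 9 * X ^ 4
      + 8 * X ^ 3 + 5 * X ^ 2 + 2 * X)) : ℤ[X]), aeval_mem_adjoin _ _, ?_⟩
    simp [v, map_ofNat]
    push_cast at hθ
    linear_combination hθ
  obtain ⟨s, hs, hv4⟩ := hv4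
  have step (m : ℕ) (hm : v ^ (m + 1) * x ∈ Algebra.adjoin ℤ {θ}) :
      v ^ m * x ∈ Algebra.adjoin ℤ {θ} := by
    refine mem_adjoin_of_two_mul_mem_of_mul_mem hc hθ hv hf ((hvI.pow m).mul hx) ?_ ?_
    · rw [mul_left_comm]
      exact mul_mem (pow_mem hvS m) h2
    · rwa [← mul_assoc, ← pow_succ']
  have h4 : v ^ 4 * x ∈ Algebra.adjoin ℤ {θ} := by
    rw [hv4, mul_comm 2 s, mul_assoc]
    exact mul_mem hs h2
  simpa using step 0 (step 1 (step 2 (step 3 h4)))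

theorem two_mul_mem_adjoin_of_mul_mem (hc : Odd c) (h3 : ¬ (3 : ℤ) ∣ c)
    (hD : Squarefree (c ^ 2 - 12)) (hθ : θ ^ 8 + c * θ ^ 4 + 3 = 0) (hw : 2 * θ ^ 4 + c ≠ 0)
    (hf : ∀ A : ℤ[X], aeval θ A = 0 → X ^ 8 + C c * X ^ 4 + C 3 ∣ A)
    (hx : IsIntegral ℤ x) (h : (2 * θ ^ 4 + c) * x ∈ Algebra.adjoin ℤ {θ}) :
    2 * x ∈ Algebra.adjoin ℤ {θ} := by
  obtain ⟨A, B, n, hA, hdvd⟩ := exists_dvd_pow_sub_mul hf hx (2 * X ^ 4 + C c)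
    (by simpa [map_ofNat] using h)
  obtain ⟨d, hd⟩ : Odd (c ^ 2 - 12) := (hc.pow).sub_even (by decide)
  -- `d + 1` is an inverse of `2` modulo `c ^ 2 - 12`
  set G : ℤ[X] := X ^ 4 + C ((d + 1) * c) with hG
  have hGm : G.Monic := by rw [hG]; monicity!
  have hrem : C (c ^ 2 - 12) ∣ A %ₘ G := by
    rw [C_dvd_iff_dvd_coeff]
    intro i
    refine dvd_of_squarefree_of_forall_prime hD fun q hq hqD => ?_
    have : Fact q.Prime := ⟨hq⟩
    have hqD' : (c : ZMod q) ^ 2 - 12 = 0 := by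
      exact_mod_cast (ZMod.intCast_zmod_eq_zero_iff_dvd _ q).2 hqD
    have hd' : 2 * (d : ZMod q) + 1 = 0 := by
      rw [hd] at hqD
      exact_mod_cast (ZMod.intCast_zmod_eq_zero_iff_dvd _ q).2 hqD
    have hq2 : (2 : ZMod q) ≠ 0 := by
      intro h
      rw [h] at hd'
      simp at hd'
    have hqc : (c : ZMod q) ≠ 0 := by
      intro h
      have h3q : (3 : ZMod q) = 0 := by
        have : (2 : ZMod q) * (2 * 3) = 0 := by linear_combination (c : ZMod q) * h - hqD'
        simpa [hq2] using this
      have : q ∣ 3 := (ZMod.natCast_eq_zero_iff 3 q).1 (by exact_mod_cast h3q)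
      have hdvd := (ZMod.intCast_zmod_eq_zero_iff_dvd c q).1 h
      rw [(Nat.prime_dvd_prime_iff_eq hq Nat.prime_three).1 this] at hdvd
      exact h3 (by exact_mod_cast hdvd)
    have hGmap : G.map (Int.castRingHom (ZMod q)) = X ^ 4 - C (-((d + 1) * c : ZMod q)) := by
      simp [hG]
    have hsf : Squarefree (G.map (Int.castRingHom (ZMod q))) := by
      rw [hGmap]
      refine (separable_X_pow_sub_C _ ?_ ?_).squarefree
      · have : (2 : ZMod q) * 2 ≠ 0 := mul_ne_zero hq2 hq2
        norm_num at this ⊢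
        exact this
      · refine neg_ne_zero.2 (mul_ne_zero (fun h => ?_) hqc)
        exact one_ne_zero (α := ZMod q) (by linear_combination 2 * h - hd')
    have hdvdA : G.map (Int.castRingHom (ZMod q)) ∣ A.map (Int.castRingHom (ZMod q)) := by
      refine (hsf.isRadical) n _ ?_
      have hCd : 2 * C (d : ZMod q) + 1 = 0 := by
        simpa only [map_add, map_mul, map_ofNat, map_one, map_zero] using congrArg C hd'
      have hCc : C (c : ZMod q) ^ 2 - 12 = 0 := by
        simpa only [map_sub, map_pow, map_ofNat, map_zero] using congrArg C hqD'
      have hmod := Polynomial.map_dvd (Int.castRingHom (ZMod q)) hdvd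
      have hsquare : (X ^ 8 + C c * X ^ 4 + C 3 : ℤ[X]).map (Int.castRingHom (ZMod q)) =
          G.map (Int.castRingHom (ZMod q)) ^ 2 := by
        rw [hGmap]
        simp only [Polynomial.map_add, Polynomial.map_mul, Polynomial.map_pow, map_X, map_C]
        simp only [eq_intCast, map_ofNat, map_neg, map_mul, map_add, map_one]
        linear_combination (-C (c : ZMod q) * X ^ 4 - 3 * (2 * C (d : ZMod q) + 3)) * hCd
          - (C (d : ZMod q) + 1) ^ 2 * hCc
      have htwo : (2 * X ^ 4 + C c : ℤ[X]).map (Int.castRingHom (ZMod q)) =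
          G.map (Int.castRingHom (ZMod q)) * 2 := by
        rw [hGmap]
        simp only [Polynomial.map_add, Polynomial.map_mul, Polynomial.map_pow, map_X, map_C,
          Polynomial.map_ofNat]
        simp only [eq_intCast, map_neg, map_mul, map_add, map_one]
        linear_combination (-C (c : ZMod q)) * hCd
      rw [hsquare, Polynomial.map_sub, Polynomial.map_mul, Polynomial.map_pow, htwo,
        mul_assoc] at hmod
      exact (dvd_sub_left (dvd_mul_right _ _)).1 ((dvd_pow_self _ two_ne_zero).trans hmod)
    have hzero : (A %ₘ G).map (Int.castRingHom (ZMod q)) = 0 := by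
      rw [map_modByMonic _ hGm]
      exact (modByMonic_eq_zero_iff_dvd (hGm.map _)).2 hdvdA
    rw [← ZMod.intCast_zmod_eq_zero_iff_dvd, ← eq_intCast (Int.castRingHom (ZMod q)), ← coeff_map,
      hzero, coeff_zero]
  obtain ⟨T, hT⟩ := hrem
  have hdiv := modByMonic_add_div A G
  rw [hT] at hdiv
  set Q := A /ₘ G
  have hsq : (2 * θ ^ 4 + c) ^ 2 = ((c ^ 2 - 12 : ℤ) : K) := by
    push_cast
    linear_combination 4 * hθ
  have key : 2 * x = aeval θ (Q + (2 * X ^ 4 + C c) * (C c * Q + 2 * T)) := by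
    apply mul_left_cancel₀ hw
    rw [← hdiv] at hA
    have hd2 : ((c : K) ^ 2 - 12) = 2 * d + 1 := by exact_mod_cast congrArg (Int.cast : ℤ → K) hd
    simp only [hG, map_add, map_mul, map_pow, map_one, map_ofNat, aeval_X, map_sub, eq_intCast,
      map_intCast] at hA ⊢
    push_cast at hsq hA
    linear_combination (-2) * hA - (c * aeval θ Q + 2 * aeval θ T) * hsq - c * aeval θ Q * hd2
  rw [key]
  exact aeval_mem_adjoin _ _

theorem aeval_derivative_mul_mem_adjoin [NumberField K] (hgen : Algebra.adjoin ℚ {θ} = ⊤)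
    (hθ : IsIntegral ℤ θ) (hx : IsIntegral ℤ x) :
    aeval θ (derivative (minpoly ℚ θ)) * x ∈ Algebra.adjoin ℤ {θ} := by
  have hmem : x ∈ (Algebra.traceForm ℚ K).dualSubmodule
      (Subalgebra.toSubmodule (Algebra.adjoin ℤ {θ})) := by
    rw [LinearMap.BilinForm.mem_dualSubmodule]
    intro y hy
    have hy' : IsIntegral ℤ y := adjoin_le_integralClosure hθ hy
    have htr : IsIntegral ℤ (Algebra.trace ℚ K (x * y)) := Algebra.isIntegral_trace (hx.mul hy')
    obtain ⟨z, hz⟩ := IsIntegrallyClosed.isIntegral_iff.1 htr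
    rw [Algebra.traceForm_apply, Submodule.mem_one]
    exact ⟨z, hz⟩
  rw [traceForm_dualSubmodule_adjoin ℤ ℚ hgen hθ] at hmem
  obtain ⟨y, hy, rfl⟩ := hmem
  have hne : aeval θ (derivative (minpoly ℚ θ)) ≠ 0 :=
    (Algebra.IsSeparable.isSeparable ℚ θ).aeval_derivative_ne_zero (minpoly.aeval ℚ θ)
  simpa [mul_inv_cancel_left₀ hne] using hy

theorem octic_isMonogenic (hc : Odd c) (h3 : ¬ (3 : ℤ) ∣ c) (hD : Squarefree (c ^ 2 - 12)) :
    IsMonogenic (X ^ 8 + C c * X ^ 4 + C 3) := by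
  refine ⟨octic_monic c, octic_irreducible_rat hc, fun K _ _ θ hroot hgen => ?_⟩
  have hθI : IsIntegral ℤ θ := ⟨_, octic_monic c, by rwa [← aeval_def]⟩
  have hminQ : (X ^ 8 + C c * X ^ 4 + C 3 : ℤ[X]).map (algebraMap ℤ ℚ) = minpoly ℚ θ :=
    minpoly.eq_of_irreducible_of_monic (octic_irreducible_rat hc)
      (by rwa [aeval_map_algebraMap]) ((octic_monic c).map _)
  have hminZ : minpoly ℤ θ = X ^ 8 + C c * X ^ 4 + C 3 := by
    apply map_injective (algebraMap ℤ ℚ) (algebraMap ℤ ℚ).injective_int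
    rw [hminQ, minpoly.isIntegrallyClosed_eq_field_fractions' ℚ hθI]
  have hf (A : ℤ[X]) (hA : aeval θ A = 0) : X ^ 8 + C c * X ^ 4 + C 3 ∣ A :=
    hminZ ▸ minpoly.isIntegrallyClosed_dvd hθI hA
  have hθ : θ ^ 8 + c * θ ^ 4 + 3 = 0 := by simpa [map_ofNat] using hroot
  have hw : 2 * θ ^ 4 + c ≠ 0 := by
    intro h
    have hsq : ((c ^ 2 - 12 : ℤ) : K) = 0 := by
      push_cast
      linear_combination (2 * θ ^ 4 + c) * h - 4 * hθ
    exact hD.ne_zero (Int.cast_eq_zero.1 hsq)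
  refine le_antisymm (adjoin_le_integralClosure hθI) fun x hx => ?_
  have hx : IsIntegral ℤ x := hx
  have hder := aeval_derivative_mul_mem_adjoin hgen hθI hx
  have h2I : IsIntegral ℤ (2 : K) := by
    simpa [map_ofNat] using isIntegral_algebraMap (R := ℤ) (A := K) (x := 2)
  have h4 : (2 * θ ^ 4 + c) * (θ * (θ * (θ * (2 * (2 * x))))) ∈ Algebra.adjoin ℤ {θ} := by
    convert hder using 1
    rw [← hminQ, derivative_map, aeval_map_algebraMap]
    simp [map_ofNat]
    ring
  have hI2 := h2I.mul (h2I.mul hx)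
  have h5 := two_mul_mem_adjoin_of_mul_mem hc h3 hD hθ hw hf
    (hθI.mul (hθI.mul (hθI.mul hI2))) h4
  have two {y : K} (hy : IsIntegral ℤ y) (h : 2 * y ∈ Algebra.adjoin ℤ {θ}) :=
    mem_adjoin_of_two_mul_mem hc hθ hf hy h
  have root {y : K} (hy : IsIntegral ℤ y) (h : θ * y ∈ Algebra.adjoin ℤ {θ}) :=
    mem_adjoin_of_mul_root_mem hθ hf hy h
  exact two hx (two (h2I.mul hx) (root hI2 (root (hθI.mul hI2) (root (hθI.mul (hθI.mul hI2))
    (two (hθI.mul (hθI.mul (hθI.mul hI2))) h5)))))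

end Monogenic

theorem stmt_15 (p : ℕ) (hp : p.Prime) (hp5 : 5 ≤ p)
    (hsf : Squarefree ((p : ℤ) ^ 2 - 12)) :
    IsMonogenic (X ^ 8 + C (p : ℤ) * X ^ 4 + C 3) ∧
      Nonempty ((((X ^ 8 + C (p : ℤ) * X ^ 4 + C 3 : Polynomial ℤ).map
        (Int.castRingHom ℚ)).Gal ≃* Holomorph (DihedralGroup 4))) := by
  have hodd : Odd (p : ℤ) := by exact_mod_cast hp.odd_of_ne_two (by omega)
  have h3 : ¬ (3 : ℤ) ∣ p := by
    intro h
    have := (Nat.prime_dvd_prime_iff_eq Nat.prime_three hp).1 (by exact_mod_cast h)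
    omega
  refine ⟨octic_isMonogenic hodd h3 hsf, ?_⟩
  have hpos : 13 ≤ (p : ℤ) ^ 2 - 12 := by
    have : (5 : ℤ) ≤ p := by exact_mod_cast hp5
    nlinarith
  have h3sf : Squarefree (3 : ℤ) := Int.prime_three.squarefree
  have h3D : Squarefree (3 * ((p : ℤ) ^ 2 - 12)) := by
    refine squarefree_mul_iff.2 ⟨?_, h3sf, hsf⟩
    refine (Int.prime_three.irreducible.isRelPrime_iff_not_dvd).2 fun h => h3 ?_
    refine Int.prime_three.dvd_of_dvd_pow (n := 2) ?_
    exact (dvd_sub_left (by norm_num)).1 h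
  set F := (X ^ 8 + C (p : ℤ) * X ^ 4 + C 3 : Polynomial ℤ).map (Int.castRingHom ℚ) with hF
  have hFeq : F = X ^ 8 + C (((p : ℤ) : ℚ)) * X ^ 4 + C 3 := by
    simp [hF, map_ofNat]
  let : Algebra ℚ F.SplittingField := SplittingField.instAlgebra_1 F
  have hgal : IsGalois ℚ F.SplittingField :=
    IsGalois.of_separable_splitting_field (p := F) (octic_irreducible_rat hodd).separable
  have : IsSplittingField ℚ F.SplittingField (X ^ 8 + C (((p : ℤ) : ℚ)) * X ^ 4 + C 3) :=
    hFeq ▸ IsSplittingField.splittingField F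
  have : FiniteDimensional ℚ F.SplittingField := IsSplittingField.finiteDimensional _ F
  exact nonempty_algEquiv_mulEquiv_holomorph (L := F.SplittingField) (p : ℤ) (by linarith)
    (by exact_mod_cast not_isSquare_intCast_of_squarefree h3sf (by norm_num))
    (not_isSquare_intCast_of_squarefree hsf (by linarith))
    (not_isSquare_intCast_of_squarefree h3D (by linarith))
end

section
/- Let a, b ∈ ℤ with a ≠ 0. The polynomial G(x) = x⁸ + a·x⁶ + b·x⁴ + a·x² + 1 is monogenic with Galois group Gal(G) isomorphic to ℤ/2ℤ × ℤ/4ℤ if and only if a = −1 and b = 1 (i.e., G(x) = x⁸ − x⁶ + x⁴ − x² + 1, the 20th cyclotomic polynomial). -/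
open Polynomial

/-- A root `u` of a biquadratic polynomial `x⁴ + A x² + B` in an abelian extension, whose
discriminant `A² - 4B` is not a square, forces `B` or `B (A² - 4B)` to be a square. -/
theorem isSquare_or_isSquare_mul_of_biquadratic_root {F L : Type*} [Field F] [CharZero F] [Field L]
    [Algebra F L] [FiniteDimensional F L] [IsGalois F L]
    (hcomm : ∀ σ τ : L ≃ₐ[F] L, σ * τ = τ * σ) {A B : F} {u : L}
    (hu : u ^ 4 + algebraMap F L A * u ^ 2 + algebraMap F L B = 0)
    (hD : ¬ IsSquare (A ^ 2 - 4 * B)) :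
    IsSquare B ∨ IsSquare (B * (A ^ 2 - 4 * B)) := by
  have : CharZero L := charZero_of_injective_algebraMap (algebraMap F L).injective
  have isSquare_of_fixed : ∀ (r : F) (x : L), x ^ 2 = algebraMap F L r →
      (∀ τ : L ≃ₐ[F] L, τ x = x) → IsSquare r := by
    intro r x hx hfix
    obtain ⟨y, rfl⟩ := (IsGalois.mem_range_algebraMap_iff_fixed x).2 hfix
    refine ⟨y, (algebraMap F L).injective ?_⟩
    rw [map_mul, ← hx, sq]
  set s : L := 2 * u ^ 2 + algebraMap F L A with hs
  have hs2 : s ^ 2 = algebraMap F L (A ^ 2 - 4 * B) := by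
    simp only [map_sub, map_mul, map_pow, map_ofNat]
    linear_combination 4 * hu
  have map_s : ∀ τ : L ≃ₐ[F] L, τ s = 2 * (τ u) ^ 2 + algebraMap F L A := by
    intro τ
    simp only [hs, map_add, map_mul, map_pow, map_ofNat, AlgEquiv.commutes]
  have s_or : ∀ τ : L ≃ₐ[F] L, τ s = s ∨ τ s = -s := by
    intro τ
    rw [← sq_eq_sq_iff_eq_or_eq_neg, ← map_pow, hs2, AlgEquiv.commutes]
  obtain ⟨σ, hσ⟩ : ∃ σ : L ≃ₐ[F] L, σ s ≠ s := by
    by_contra! h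
    exact hD (isSquare_of_fixed _ s hs2 h)
  have hσs : σ s = -s := (s_or σ).resolve_left hσ
  have two_ne : (2 : L) ≠ 0 := two_ne_zero
  have sq_of_neg : ∀ τ : L ≃ₐ[F] L, τ s = -s → (τ u) ^ 2 = -algebraMap F L A - u ^ 2 := by
    intro τ hτ
    apply mul_left_cancel₀ two_ne
    linear_combination hτ - map_s τ
  have hv2 := sq_of_neg σ hσs
  have hσσ : σ (σ u) = u ∨ σ (σ u) = -u := by
    rw [← sq_eq_sq_iff_eq_or_eq_neg, ← map_pow, hv2, map_sub, map_neg, AlgEquiv.commutes, map_pow,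
      hv2]
    ring
  have hw : (u * σ u) ^ 2 = algebraMap F L B := by
    rw [mul_pow, hv2]
    linear_combination -hu
  have comm_u : ∀ τ : L ≃ₐ[F] L, τ (σ u) = σ (τ u) := fun τ =>
    DFunLike.congr_fun (hcomm τ σ) u
  have fix_of_pos : ∀ τ : L ≃ₐ[F] L, τ s = s → τ (u * σ u) = u * σ u := by
    intro τ hτ
    have h : (τ u) ^ 2 = u ^ 2 := by
      apply mul_left_cancel₀ two_ne
      linear_combination hτ - map_s τ
    rw [map_mul, comm_u]
    rcases sq_eq_sq_iff_eq_or_eq_neg.1 h with h | h <;> simp [h]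
  have map_of_neg : ∀ τ : L ≃ₐ[F] L, τ s = -s → τ (u * σ u) = σ u * σ (σ u) := by
    intro τ hτ
    have h : (τ u) ^ 2 = (σ u) ^ 2 := by rw [sq_of_neg τ hτ, hv2]
    rw [map_mul, comm_u]
    rcases sq_eq_sq_iff_eq_or_eq_neg.1 h with h | h <;> simp [h]
  rcases hσσ with h | h
  · left
    refine isSquare_of_fixed B (u * σ u) hw fun τ => ?_
    rcases s_or τ with hτ | hτ
    · exact fix_of_pos τ hτ
    · rw [map_of_neg τ hτ, h, mul_comm]
  · right
    refine isSquare_of_fixed _ (u * σ u * s) (by rw [mul_pow, hw, hs2, map_mul]) fun τ => ?_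
    rw [map_mul]
    rcases s_or τ with hτ | hτ
    · rw [fix_of_pos τ hτ, hτ]
    · rw [map_of_neg τ hτ, hτ, h]
      ring

/-- If `ℤ[θ]` is integrally closed, then the minimal polynomial of `θ` does not lie in the square
of an ideal `(d, h)` with `d` a non-unit. -/
theorem isUnit_of_minpoly_eq_add {K : Type*} [Field K] [CharZero K] {θ : K} (hint : IsIntegral ℤ θ)
    (hclosure : Algebra.adjoin ℤ {θ} = integralClosure ℤ K) {h q r s : ℤ[X]} {d : ℤ}
    (hhq : (h * q).Monic) (hdeg : (h * q).natDegree < (minpoly ℤ θ).natDegree)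
    (hfd : minpoly ℤ θ = h ^ 2 * q + C d * h * r + C d ^ 2 * s) : IsUnit d := by
  have hmonic := minpoly.monic hint
  obtain ⟨P, hP⟩ : ∃ P : ℤ[X], aeval θ (C d * P) = aeval θ (h * q) := by
    have hrel : aeval θ h ^ 2 * aeval θ q + d * aeval θ h * aeval θ r + (d : K) ^ 2 * aeval θ s
        = 0 := by
      have hθ := minpoly.aeval ℤ θ
      rw [hfd] at hθ
      simpa using hθ
    by_cases hd : d = 0
    · refine ⟨0, ?_⟩
      have : aeval θ h ^ 2 * aeval θ q = 0 := by simpa [hd] using hrel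
      rcases mul_eq_zero.1 this with h0 | h0
      · simp [pow_eq_zero_iff two_ne_zero |>.1 h0]
      · simp [h0]
    have hdK : (d : K) ≠ 0 := by exact_mod_cast hd
    have hmem : ∀ p : ℤ[X], IsIntegral ℤ (aeval θ p) := fun p =>
      adjoin_le_integralClosure hint (aeval_mem_adjoin_singleton ℤ θ)
    set α : K := aeval θ h * aeval θ q / d with hα
    have hα_int : IsIntegral ℤ α := by
      have hα2 : α ^ 2 + aeval θ r * α + aeval θ q * aeval θ s = 0 := by
        rw [hα]
        field_simp
        linear_combination aeval θ q * hrel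
      let R := integralClosure ℤ K
      have hR : IsIntegral R α := by
        refine ⟨X ^ 2 + C (⟨_, hmem r⟩ : R) * X + C (⟨_, (hmem q).mul (hmem s)⟩ : R),
          by monicity!, ?_⟩
        simpa [eval₂_add, eval₂_mul, eval₂_pow] using hα2
      exact isIntegral_trans α hR
    have hmemα : α ∈ Algebra.adjoin ℤ {θ} := by
      rw [hclosure]
      exact hα_int
    rw [Algebra.adjoin_singleton_eq_range_aeval] at hmemα
    obtain ⟨P, hP⟩ := hmemα
    refine ⟨P, ?_⟩
    replace hP : aeval θ P = α := hP
    rw [map_mul, map_mul, hP, hα]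
    simp only [eq_intCast, map_intCast]
    field_simp
  have hdvd : minpoly ℤ θ ∣ C d * P - h * q := by
    rw [← minpoly.isIntegrallyClosed_dvd_iff hint, map_sub, hP, sub_self]
  by_contra hunit
  have hnat : d.natAbs ≠ 1 := fun h => hunit (Int.isUnit_iff_natAbs_eq.2 h)
  have : Nontrivial (ZMod d.natAbs) := ZMod.nontrivial_iff.2 hnat
  let φ := Int.castRingHom (ZMod d.natAbs)
  have hφd : φ d = 0 := by
    simp [φ, ZMod.intCast_zmod_eq_zero_iff_dvd]
  have hdvd' : (minpoly ℤ θ).map φ ∣ (h * q).map φ := by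
    have := Polynomial.map_dvd φ hdvd
    rwa [Polynomial.map_sub, Polynomial.map_mul, map_C, hφd, C_0, zero_mul, zero_sub,
      dvd_neg] at this
  refine (hmonic.map φ).not_dvd_of_natDegree_lt (hhq.map φ).ne_zero ?_ hdvd'
  rwa [hhq.natDegree_map, hmonic.natDegree_map]

theorem exists_numberField_root {f : ℚ[X]} (hirr : Irreducible f) :
    ∃ (K : Type) (_ : Field K) (_ : NumberField K) (θ : K),
      aeval θ f = 0 ∧ Algebra.adjoin ℚ {θ} = ⊤ := by
  have : Fact (Irreducible f) := ⟨hirr⟩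
  have : FiniteDimensional ℚ (AdjoinRoot f) := (AdjoinRoot.powerBasis hirr.ne_zero).finite
  refine ⟨AdjoinRoot f, inferInstance, ⟨⟩, AdjoinRoot.root f, ?_, AdjoinRoot.adjoinRoot_eq_top⟩
  exact (AdjoinRoot.aeval_eq f).trans AdjoinRoot.mk_self

/-- A monogenic polynomial does not lie in the square of an ideal `(d, h)` with `d` a non-unit. -/
theorem IsMonogenic.isUnit_of_eq_add {f h q r s : ℤ[X]} {d : ℤ} (hf : IsMonogenic f)
    (hhq : (h * q).Monic) (hdeg : (h * q).natDegree < f.natDegree)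
    (hfd : f = h ^ 2 * q + C d * h * r + C d ^ 2 * s) : IsUnit d := by
  obtain ⟨hmonic, hirr, hring⟩ := hf
  obtain ⟨K, _, _, θ, hroot, htop⟩ := exists_numberField_root hirr
  have hθ : aeval θ f = 0 := by rwa [← algebraMap_int_eq, aeval_map_algebraMap] at hroot
  have hint : IsIntegral ℤ θ := ⟨f, hmonic, by rwa [← aeval_def]⟩
  have hmin : minpoly ℤ θ = f := by
    apply map_injective (Int.castRingHom ℚ) Int.cast_injective
    rw [minpoly.eq_of_irreducible_of_monic hirr hroot (hmonic.map _),
      minpoly.isIntegrallyClosed_eq_field_fractions' ℚ hint, algebraMap_int_eq]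
  rw [← hmin] at hdeg hfd
  exact isUnit_of_minpoly_eq_add hint (hring K θ hθ htop) hhq hdeg hfd

/-- The even reciprocal octic `x⁸ + a x⁶ + b x⁴ + a x² + 1`. -/
noncomputable abbrev evenReciprocalOctic (a b : ℤ) : ℤ[X] :=
  X ^ 8 + C a * X ^ 6 + C b * X ^ 4 + C a * X ^ 2 + 1

theorem map_evenReciprocalOctic (a b : ℤ) :
    (evenReciprocalOctic a b).map (Int.castRingHom ℚ) =
      X ^ 8 + C (a : ℚ) * X ^ 6 + C (b : ℚ) * X ^ 4 + C (a : ℚ) * X ^ 2 + 1 := by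
  simp only [evenReciprocalOctic, Polynomial.map_add, Polynomial.map_mul, Polynomial.map_pow,
    map_X, Polynomial.map_C, Polynomial.map_one, Int.coe_castRingHom]

theorem natDegree_evenReciprocalOctic (a b : ℤ) : (evenReciprocalOctic a b).natDegree = 8 := by
  unfold evenReciprocalOctic
  compute_degree!

theorem squarefree_of_isMonogenic_add {a b : ℤ} (hG : IsMonogenic (evenReciprocalOctic a b)) :
    Squarefree (b + 2 + 2 * a) := by
  rintro d ⟨k, hk⟩
  have hdeg : (((X ^ 2 - 1) * (X ^ 4 + C (a + 2) * X ^ 2 + C (b + 2 * a + 3)) : ℤ[X])).natDegree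
      = 6 := by compute_degree!
  refine hG.isUnit_of_eq_add (h := X ^ 2 - 1) (q := X ^ 4 + C (a + 2) * X ^ 2 + C (b + 2 * a + 3))
    (r := C (2 * d * k)) (s := C k) ?_ ?_ ?_
  · exact Monic.mul (by monicity!) (by monicity!)
  · rw [hdeg, natDegree_evenReciprocalOctic]
    norm_num
  · have hb : b = d * d * k - 2 - 2 * a := by linear_combination hk
    subst hb
    simp only [evenReciprocalOctic, map_add, map_sub, map_mul, map_ofNat]
    ring

theorem squarefree_of_isMonogenic_sub {a b : ℤ} (hG : IsMonogenic (evenReciprocalOctic a b)) :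
    Squarefree (b + 2 - 2 * a) := by
  rintro d ⟨k, hk⟩
  have hdeg : (((X ^ 2 + 1) * (X ^ 4 + C (a - 2) * X ^ 2 + C (b - 2 * a + 3)) : ℤ[X])).natDegree
      = 6 := by compute_degree!
  refine hG.isUnit_of_eq_add (h := X ^ 2 + 1) (q := X ^ 4 + C (a - 2) * X ^ 2 + C (b - 2 * a + 3))
    (r := C (-2 * d * k)) (s := C k) ?_ ?_ ?_
  · exact Monic.mul (by monicity!) (by monicity!)
  · rw [hdeg, natDegree_evenReciprocalOctic]
    norm_num
  · have hb : b = d * d * k - 2 + 2 * a := by linear_combination hk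
    subst hb
    simp only [evenReciprocalOctic, map_add, map_sub, map_mul, map_neg, map_ofNat]
    ring

theorem not_isSquare_of_irreducible {a b : ℤ}
    (hG : Irreducible ((evenReciprocalOctic a b).map (Int.castRingHom ℚ))) :
    ¬ IsSquare ((a : ℚ) ^ 2 - 4 * b + 8) := by
  rintro ⟨r, hr⟩
  have hfac : (evenReciprocalOctic a b).map (Int.castRingHom ℚ) =
      (X ^ 4 + C ((a + r) / 2) * X ^ 2 + 1) * (X ^ 4 + C ((a - r) / 2) * X ^ 2 + 1) := by
    have h1 : (a : ℚ) = (a + r) / 2 + (a - r) / 2 := by ring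
    have h2 : (b : ℚ) = 2 + (a + r) / 2 * ((a - r) / 2) := by linear_combination -hr / 4
    rw [map_evenReciprocalOctic]
    generalize (a + r) / 2 = c at *
    generalize (a - r) / 2 = e at *
    rw [h1, h2]
    simp only [map_add, map_mul, map_ofNat]
    ring
  rcases hG.isUnit_or_isUnit hfac with h | h
  · have h4 : (X ^ 4 + C ((a + r) / 2) * X ^ 2 + 1 : ℚ[X]).natDegree = 4 := by compute_degree!
    have := natDegree_eq_zero_of_isUnit h
    omega
  · have h4 : (X ^ 4 + C ((a - r) / 2) * X ^ 2 + 1 : ℚ[X]).natDegree = 4 := by compute_degree!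
    have := natDegree_eq_zero_of_isUnit h
    omega

theorem not_irreducible_evenReciprocalOctic_one_one :
    ¬ Irreducible ((evenReciprocalOctic 1 1).map (Int.castRingHom ℚ)) := by
  intro hG
  have hfac : (evenReciprocalOctic 1 1).map (Int.castRingHom ℚ) =
      (X ^ 4 + X ^ 3 + X ^ 2 + X + 1) * (X ^ 4 - X ^ 3 + X ^ 2 - X + 1) := by
    rw [map_evenReciprocalOctic, Int.cast_one, map_one]
    ring
  rcases hG.isUnit_or_isUnit hfac with h | h
  · have h4 : (X ^ 4 + X ^ 3 + X ^ 2 + X + 1 : ℚ[X]).natDegree = 4 := by compute_degree!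
    have := natDegree_eq_zero_of_isUnit h
    omega
  · have h4 : (X ^ 4 - X ^ 3 + X ^ 2 - X + 1 : ℚ[X]).natDegree = 4 := by compute_degree!
    have := natDegree_eq_zero_of_isUnit h
    omega

/-- If `θ` lies in an abelian extension, then both quartic subextensions generated by `θ ± θ⁻¹` are
normal. -/
theorem isSquare_of_root_mem_abelian {L : Type*} [Field L] [Algebra ℚ L] [FiniteDimensional ℚ L]
    [IsGalois ℚ L] (hcomm : ∀ σ τ : L ≃ₐ[ℚ] L, σ * τ = τ * σ) {a b : ℤ} {θ : L}
    (hrel : θ ^ 8 + a * θ ^ 6 + b * θ ^ 4 + a * θ ^ 2 + 1 = 0)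
    (hD : ¬ IsSquare ((a : ℚ) ^ 2 - 4 * b + 8)) :
    (IsSquare (b + 2 - 2 * a) ∨ IsSquare ((b + 2 - 2 * a) * (a ^ 2 - 4 * b + 8))) ∧
    (IsSquare (b + 2 + 2 * a) ∨ IsSquare ((b + 2 + 2 * a) * (a ^ 2 - 4 * b + 8))) := by
  have hθ0 : θ ≠ 0 := by
    rintro rfl
    simp at hrel
  constructor
  · have hdisc : ((a - 4 : ℤ) : ℚ) ^ 2 - 4 * ((b + 2 - 2 * a : ℤ) : ℚ) =
      ((a ^ 2 - 4 * b + 8 : ℤ) : ℚ) := by push_cast; ring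
    have key := isSquare_or_isSquare_mul_of_biquadratic_root hcomm (A := ((a - 4 : ℤ) : ℚ))
      (B := ((b + 2 - 2 * a : ℤ) : ℚ)) (u := θ + θ⁻¹) (by
        rw [map_intCast, map_intCast]
        push_cast
        field_simp
        linear_combination hrel) (by
        rw [hdisc]
        exact_mod_cast hD)
    rw [hdisc] at key
    exact_mod_cast key
  · have hdisc : ((a + 4 : ℤ) : ℚ) ^ 2 - 4 * ((b + 2 + 2 * a : ℤ) : ℚ) =
      ((a ^ 2 - 4 * b + 8 : ℤ) : ℚ) := by push_cast; ring
    have key := isSquare_or_isSquare_mul_of_biquadratic_root hcomm (A := ((a + 4 : ℤ) : ℚ))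
      (B := ((b + 2 + 2 * a : ℤ) : ℚ)) (u := θ - θ⁻¹) (by
        rw [map_intCast, map_intCast]
        push_cast
        field_simp
        linear_combination hrel) (by
        rw [hdisc]
        exact_mod_cast hD)
    rw [hdisc] at key
    exact_mod_cast key

theorem exists_root_mem_abelian.{u} {F : Type u} [Field F] [CharZero F] {f : F[X]} (hf : Irreducible f)
    (hcomm : ∀ σ τ : f.Gal, σ * τ = τ * σ) :
    ∃ (L : Type u) (_ : Field L) (_ : Algebra F L) (_ : FiniteDimensional F L) (_ : IsGalois F L),
      (∀ σ τ : L ≃ₐ[F] L, σ * τ = τ * σ) ∧ ∃ θ : L, aeval θ f = 0 := by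
  refine ⟨f.SplittingField, inferInstance, inferInstance, inferInstance,
    IsGalois.of_separable_splitting_field (p := f) hf.separable, hcomm, ?_⟩
  obtain ⟨θ, hθ⟩ := (SplittingField.splits f).exists_eval_eq_zero
    (by rw [degree_map]; exact (degree_pos_of_irreducible hf).ne')
  exact ⟨θ, by rwa [aeval_def, ← eval_map]⟩

theorem isSquare_of_gal_comm {a b : ℤ}
    (hG : Irreducible ((evenReciprocalOctic a b).map (Int.castRingHom ℚ)))
    (hcomm : ∀ σ τ : ((evenReciprocalOctic a b).map (Int.castRingHom ℚ)).Gal, σ * τ = τ * σ) :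
    (IsSquare (b + 2 - 2 * a) ∨ IsSquare ((b + 2 - 2 * a) * (a ^ 2 - 4 * b + 8))) ∧
    (IsSquare (b + 2 + 2 * a) ∨ IsSquare ((b + 2 + 2 * a) * (a ^ 2 - 4 * b + 8))) := by
  have hD := not_isSquare_of_irreducible hG
  obtain ⟨L, _, _, _, _, hcomm', θ, hθ⟩ := exists_root_mem_abelian hG hcomm
  refine isSquare_of_root_mem_abelian hcomm' (θ := θ) ?_ hD
  rw [map_evenReciprocalOctic] at hθ
  simpa only [map_add, map_mul, map_pow, aeval_X, aeval_C, map_intCast, map_one] using hθ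

theorem Int.eq_one_of_squarefree_of_isSquare {n : ℤ} (hn : Squarefree n) (hsq : IsSquare n) :
    n = 1 := by
  obtain ⟨m, rfl⟩ := hsq
  exact Int.isUnit_mul_self (hn m dvd_rfl)

/-- If `d` is squarefree and `d * n` is a square, then `n = d k²` for some `k`. -/
theorem Int.exists_eq_mul_sq_of_squarefree {d n : ℤ} (hd : Squarefree d) (h : IsSquare (d * n)) :
    ∃ k, n = d * k ^ 2 := by
  obtain ⟨m, hm⟩ := h
  have hdm : d ∣ m := (hd.dvd_pow_iff_dvd two_ne_zero).1 ⟨n, by rw [hm, sq]⟩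
  obtain ⟨k, rfl⟩ := hdm
  exact ⟨k, mul_left_cancel₀ hd.ne_zero (by linear_combination hm)⟩

theorem eq_neg_one_of_squarefree_of_isSquare {a : ℤ} (ha : a ≠ 0) (hsf : Squarefree (1 - 4 * a))
    (hsq : IsSquare ((1 - 4 * a) * ((a + 2) * (a + 6)))) : a = -1 := by
  obtain ⟨k, hk⟩ := Int.exists_eq_mul_sq_of_squarefree hsf hsq
  have h225 : 1 - 4 * a ∣ 15 ^ 2 := ⟨16 * k ^ 2 + 4 * a + 33, by linear_combination 16 * hk⟩
  have h15 : 1 - 4 * a ∣ 15 := (hsf.dvd_pow_iff_dvd two_ne_zero).1 h225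
  have hle := Int.le_of_dvd (by norm_num) h15
  have hge := Int.le_of_dvd (by norm_num) ((neg_dvd).2 h15)
  have h1 : -4 < a := by omega
  have h2 : a ≤ 4 := by omega
  interval_cases a <;> first | rfl | exact absurd rfl ha | (exfalso; revert h15; decide) | nlinarith

theorem Int.eq_of_squarefree_of_isSquare_mul {m n : ℤ} (hm : Squarefree m) (hn : Squarefree n)
    (h : IsSquare (m * n)) : m = n := by
  obtain ⟨k, hk⟩ := Int.exists_eq_mul_sq_of_squarefree hm h
  have hunit : IsUnit k := hn k ⟨m, by rw [hk]; ring⟩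
  have hk2 : k ^ 2 = 1 := by rw [sq, Int.isUnit_mul_self hunit]
  rw [hk, hk2, mul_one]

theorem evenReciprocalOctic_eq_cyclotomic : evenReciprocalOctic (-1) 1 = cyclotomic 20 ℤ := by
  have h10 : cyclotomic 10 ℤ = X ^ 4 - X ^ 3 + X ^ 2 - X + 1 := by
    have h := cyclotomic_expand_eq_cyclotomic_mul Nat.prime_two (n := 5) (by norm_num) ℤ
    have : Fact (Nat.Prime 5) := ⟨by norm_num⟩
    rw [cyclotomic_prime ℤ 5] at h
    have h5 : (∑ i ∈ Finset.range 5, X ^ i : ℤ[X]).Monic := by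
      rw [← cyclotomic_prime ℤ 5]
      exact cyclotomic.monic 5 ℤ
    apply mul_right_cancel₀ h5.ne_zero
    rw [← h]
    simp only [Finset.sum_range_succ, Finset.sum_range_zero, map_add, map_pow, expand_X, map_zero]
    ring
  rw [← cyclotomic_expand_eq_cyclotomic Nat.prime_two (n := 10) (by norm_num) ℤ, h10]
  simp only [evenReciprocalOctic, map_add, map_sub, map_pow, expand_X, map_one, map_neg]
  ring

theorem isMonogenic_cyclotomic (n : ℕ) [NeZero n] : IsMonogenic (cyclotomic n ℤ) := by
  refine ⟨cyclotomic.monic n ℤ, ?_, ?_⟩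
  · rw [map_cyclotomic_int]
    exact cyclotomic.irreducible_rat (NeZero.pos n)
  · intro K _ _ θ hθ htop
    have hprim : IsPrimitiveRoot θ n := by
      rw [← isRoot_cyclotomic_iff, IsRoot.def, ← map_cyclotomic_int, eval_map, ← hθ, aeval_def]
      rfl
    have : IsCyclotomicExtension {n} ℚ K := by
      have := hprim.adjoin_isCyclotomicExtension ℚ
      exact IsCyclotomicExtension.equiv _ _ _
        ((Subalgebra.equivOfEq _ _ htop).trans Subalgebra.topEquiv)
    have := IsCyclotomicExtension.Rat.isIntegralClosure_adjoin_singleton hprim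
    ext x
    rw [mem_integralClosure_iff, this.isIntegral_iff]
    exact ⟨fun hx => ⟨⟨x, hx⟩, rfl⟩, fun ⟨y, hy⟩ => hy ▸ y.2⟩

theorem nonempty_gal_cyclotomic_mulEquiv {F : Type*} [Field F] {n : ℕ} [NeZero n] [NeZero (n : F)]
    (h : Irreducible (cyclotomic n F)) : Nonempty ((cyclotomic n F).Gal ≃* (ZMod n)ˣ) :=
  ⟨galCyclotomicEquivUnitsZMod (L := CyclotomicField n F) h⟩

theorem nonempty_units_zmod_twenty_mulEquiv :
    Nonempty ((ZMod 20)ˣ ≃* Multiplicative (ZMod 2) × Multiplicative (ZMod 4)) := by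
  let g : (ZMod 20)ˣ := ⟨3, 7, by decide, by decide⟩
  let h : (ZMod 20)ˣ := ⟨11, 11, by decide, by decide⟩
  let f : Multiplicative (ZMod 2) × Multiplicative (ZMod 4) →* (ZMod 20)ˣ :=
    { toFun := fun x => h ^ (x.1.toAdd.val) * g ^ (x.2.toAdd.val)
      map_one' := by decide
      map_mul' := by decide }
  have hf : Function.Bijective f := by
    rw [Fintype.bijective_iff_injective_and_card]
    exact ⟨by decide, by decide⟩
  exact ⟨(MulEquiv.ofBijective f hf).symm⟩

theorem stmt_16 (a b : ℤ) (ha : a ≠ 0) :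
    (IsMonogenic (X ^ 8 + C a * X ^ 6 + C b * X ^ 4 + C a * X ^ 2 + 1) ∧
      Nonempty ((((X ^ 8 + C a * X ^ 6 + C b * X ^ 4 + C a * X ^ 2 + 1 : Polynomial ℤ).map
        (Int.castRingHom ℚ)).Gal ≃* Multiplicative (ZMod 2) × Multiplicative (ZMod 4)))) ↔
    (a = -1 ∧ b = 1) := by
  change (IsMonogenic (evenReciprocalOctic a b) ∧
    Nonempty (((evenReciprocalOctic a b).map (Int.castRingHom ℚ)).Gal ≃*
      Multiplicative (ZMod 2) × Multiplicative (ZMod 4))) ↔ _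
  constructor
  · rintro ⟨hG, ⟨e⟩⟩
    have hadd := squarefree_of_isMonogenic_add hG
    have hsub := squarefree_of_isMonogenic_sub hG
    obtain ⟨h2, h1⟩ := isSquare_of_gal_comm hG.2.1 fun σ τ =>
      e.injective (by rw [map_mul, map_mul, mul_comm])
    rcases h2 with h2 | h2
    · have hb2 := Int.eq_one_of_squarefree_of_isSquare hsub h2
      obtain rfl : b = 2 * a - 1 := by linarith
      rcases h1 with h1 | h1
      · have := Int.eq_one_of_squarefree_of_isSquare hadd h1
        omega
      · have ha1 : -a = -1 := by
          refine eq_neg_one_of_squarefree_of_isSquare (neg_ne_zero.2 ha) ?_ ?_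
          · convert hadd using 1
            ring
          · convert h1 using 1
            ring
        obtain rfl : a = 1 := by linarith
        exact absurd hG.2.1 not_irreducible_evenReciprocalOctic_one_one
    · rcases h1 with h1 | h1
      · have hb1 := Int.eq_one_of_squarefree_of_isSquare hadd h1
        obtain rfl : b = -1 - 2 * a := by linarith
        have ha1 : a = -1 := by
          refine eq_neg_one_of_squarefree_of_isSquare ha ?_ ?_
          · convert hsub using 1
            ring
          · convert h2 using 1
            ring
        exact ⟨ha1, by rw [ha1]; norm_num⟩
      · have hW : a ^ 2 - 4 * b + 8 ≠ 0 := by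
          intro h0
          refine not_isSquare_of_irreducible hG.2.1 ⟨0, ?_⟩
          rw [mul_zero]
          exact_mod_cast h0
        exfalso
        have hsq : IsSquare ((b + 2 + 2 * a) * (b + 2 - 2 * a)) := by
          obtain ⟨m, hm⟩ := h1.mul h2
          have hdvd : a ^ 2 - 4 * b + 8 ∣ m := by
            rw [← Int.pow_dvd_pow_iff two_ne_zero]
            exact ⟨(b + 2 + 2 * a) * (b + 2 - 2 * a), by linear_combination -hm⟩
          obtain ⟨c, rfl⟩ := hdvd
          exact ⟨c, mul_left_cancel₀ (pow_ne_zero 2 hW) (by linear_combination hm)⟩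
        have := Int.eq_of_squarefree_of_isSquare_mul hadd hsub hsq
        omega
  · rintro ⟨rfl, rfl⟩
    rw [evenReciprocalOctic_eq_cyclotomic]
    refine ⟨isMonogenic_cyclotomic 20, ?_⟩
    obtain ⟨e⟩ := nonempty_units_zmod_twenty_mulEquiv
    rw [map_cyclotomic_int]
    obtain ⟨e'⟩ := nonempty_gal_cyclotomic_mulEquiv
      (cyclotomic.irreducible_rat (n := 20) (by norm_num))
    exact ⟨e'.trans e⟩
end

section
/- Let a, b ∈ ℤ with a ≠ 0, and suppose the polynomial G(x) = x⁸ + a·x⁶ + b·x⁴ + a·x² + 1 is monogenic. Then the Galois group Gal(G) is not isomorphic to ℤ/2ℤ × ℤ/2ℤ × ℤ/2ℤ, and Gal(G) is not isomorphic to the dihedral group of order 8. -/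
open Polynomial

/-- An irreducible rational polynomial has a root generating some number field. -/
theorem exists_numberField_adjoin_root {g : ℚ[X]} (hirr : Irreducible g) :
    ∃ (K : Type) (_ : Field K) (_ : NumberField K) (θ : K),
      aeval θ g = 0 ∧ Algebra.adjoin ℚ {θ} = (⊤ : Subalgebra ℚ K) := by
  have := Fact.mk hirr
  have : CharZero (AdjoinRoot g) := algebraRat.charZero _
  have : FiniteDimensional ℚ (AdjoinRoot g) := (AdjoinRoot.powerBasis hirr.ne_zero).finite
  have halg : (AdjoinRoot.instAlgebra g : Algebra ℚ (AdjoinRoot g)) = DivisionRing.toRatAlgebra :=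
    Subsingleton.elim _ _
  refine ⟨AdjoinRoot g, inferInstance, { to_finiteDimensional := ?_ }, AdjoinRoot.root g, ?_, ?_⟩
  · exact halg ▸ this
  · have h := AdjoinRoot.aeval_eq (f := g) g
    rw [AdjoinRoot.mk_self] at h
    exact halg ▸ h
  · have h := AdjoinRoot.adjoinRoot_eq_top (f := g)
    exact halg ▸ h

/-- In the ring of integers `ℤ[θ]` of a monogenic polynomial `f`, a monic expression `P(θ)` of
degree less than that of `f` is divisible by `p` in the ring of integers only when `p` is a unit. -/
theorem IsMonogenic.isUnit_of_dvd {f : ℤ[X]} (hf : IsMonogenic f) {P Q R : ℤ[X]} {p : ℤ}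
    (hP : P.Monic) (hdeg : P.natDegree < f.natDegree)
    (h : f ∣ P ^ 2 + C p * Q * P + C (p ^ 2) * R) : IsUnit p := by
  obtain ⟨hmonic, hirr, hmax⟩ := hf
  have hlow (S : ℤ[X]) (hS : f.map (Int.castRingHom ℚ) ∣ S.map (Int.castRingHom ℚ))
      (hSdeg : S.natDegree < f.natDegree) : S = 0 := by
    have h1 : f ∣ S := (map_dvd_map _ Int.cast_injective hmonic).mp hS
    exact eq_zero_of_dvd_of_natDegree_lt h1 hSdeg
  by_cases hp : p = 0
  · subst hp
    have hPf : f ∣ P ^ 2 := by simpa using h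
    refine absurd (hlow P (hirr.prime.dvd_of_dvd_pow (n := 2) ?_) hdeg) hP.ne_zero
    rw [← Polynomial.map_pow]
    exact Polynomial.map_dvd _ hPf
  obtain ⟨K, _, _, θ, hθ', htop⟩ := exists_numberField_adjoin_root hirr
  have haeval (S : ℤ[X]) : aeval θ (S.map (Int.castRingHom ℚ)) = aeval θ S := by
    rw [← algebraMap_int_eq, aeval_map_algebraMap]
  have hθ : aeval θ f = 0 := by rw [← haeval, hθ']
  have hmax' := hmax K θ hθ htop
  have hpK : (p : K) ≠ 0 := by exact_mod_cast hp
  obtain ⟨β, hβ⟩ : ∃ β : K, (p : K) * β = aeval θ P := ⟨aeval θ P / p, by field_simp⟩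
  have hrel : β ^ 2 + aeval θ Q * β + aeval θ R = 0 := by
    obtain ⟨S, hS⟩ := h
    have h1 := congrArg (aeval θ) hS
    simp only [map_add, map_mul, map_pow, hθ, zero_mul, ← hβ, eq_intCast, map_intCast] at h1
    have h2 : (p : K) ^ 2 * (β ^ 2 + aeval θ Q * β + aeval θ R) = 0 := by
      linear_combination h1
    exact (mul_eq_zero.mp h2).resolve_left (pow_ne_zero 2 hpK)
  have hmem (S : ℤ[X]) : aeval θ S ∈ integralClosure ℤ K := by
    rw [← hmax']
    exact aeval_mem_adjoin_singleton ℤ θ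
  have hint : IsIntegral ℤ β := by
    have : IsIntegral (integralClosure ℤ K) β := by
      refine ⟨X ^ 2 + C ⟨_, hmem Q⟩ * X + C ⟨_, hmem R⟩, by monicity!, ?_⟩
      simpa [Subalgebra.algebraMap_def] using hrel
    exact isIntegral_trans β this
  have hβmem : β ∈ Algebra.adjoin ℤ {θ} := by
    rw [hmax']; exact hint
  rw [Algebra.adjoin_singleton_eq_range_aeval] at hβmem
  obtain ⟨S, hS⟩ := hβmem
  replace hS : aeval θ S = β := hS
  have hS' : aeval θ (S %ₘ f) = β := by
    rw [← hS]
    conv_rhs => rw [← modByMonic_add_div S f]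
    simp [hθ]
  have hzero : P - C p * (S %ₘ f) = 0 := by
    refine hlow _ ?_ ?_
    · have hmin : minpoly ℚ θ = f.map (Int.castRingHom ℚ) :=
        (minpoly.eq_of_irreducible_of_monic hirr hθ' (hmonic.map _)).symm
      rw [← hmin]
      refine minpoly.dvd ℚ θ ?_
      rw [haeval]
      simp [hS', hβ]
    · refine lt_of_le_of_lt (natDegree_sub_le _ _) (max_lt hdeg ?_)
      refine lt_of_le_of_lt (natDegree_C_mul_le _ _) (natDegree_modByMonic_lt _ hmonic ?_)
      rintro rfl
      simp at hdeg
  have hlead : P.leadingCoeff = p * (S %ₘ f).coeff P.natDegree := by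
    have := congrArg (fun T => T.coeff P.natDegree) (sub_eq_zero.mp hzero)
    simpa using this
  rw [hP.leadingCoeff] at hlead
  exact IsUnit.of_mul_eq_one _ hlead.symm

theorem natDegree_reciprocal (a b : ℤ) :
    (X ^ 8 + C a * X ^ 6 + C b * X ^ 4 + C a * X ^ 2 + 1 : ℤ[X]).natDegree = 8 := by
  compute_degree!

theorem IsMonogenic.squarefree_eval_one {a b : ℤ}
    (h : IsMonogenic (X ^ 8 + C a * X ^ 6 + C b * X ^ 4 + C a * X ^ 2 + 1)) :
    Squarefree (b + 2 + 2 * a) := by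
  rintro p ⟨k, hk⟩
  have hb : b = p * p * k - 2 - 2 * a := by linarith
  refine h.isUnit_of_dvd (P := (X ^ 2 - 1) * (X ^ 4 + C (a + 2) * X ^ 2 + 1)) (Q := 0)
    (R := C k * X ^ 4 * (X ^ 4 + C (a + 2) * X ^ 2 + 1)) (by monicity!) ?_
    ⟨X ^ 4 + C (a + 2) * X ^ 2 + 1, ?_⟩
  · rw [natDegree_reciprocal]
    exact lt_of_le_of_lt (b := 6) (by compute_degree!) (by norm_num)
  · subst hb
    simp only [map_add, map_sub, map_mul, map_pow, C_ofNat]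
    ring

theorem IsMonogenic.squarefree_eval_I {a b : ℤ}
    (h : IsMonogenic (X ^ 8 + C a * X ^ 6 + C b * X ^ 4 + C a * X ^ 2 + 1)) :
    Squarefree (b + 2 - 2 * a) := by
  rintro p ⟨k, hk⟩
  have hb : b = p * p * k - 2 + 2 * a := by linarith
  refine h.isUnit_of_dvd (P := (X ^ 2 + 1) * (X ^ 4 + C (a - 2) * X ^ 2 + 1)) (Q := 0)
    (R := C k * X ^ 4 * (X ^ 4 + C (a - 2) * X ^ 2 + 1)) (by monicity!) ?_
    ⟨X ^ 4 + C (a - 2) * X ^ 2 + 1, ?_⟩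
  · rw [natDegree_reciprocal]
    exact lt_of_le_of_lt (b := 6) (by compute_degree!) (by norm_num)
  · subst hb
    simp only [map_add, map_sub, map_mul, map_pow, C_ofNat]
    ring

theorem not_isMonogenic_of_eq_one {b : ℤ} (hb : 4 ∣ b - 1) :
    ¬ IsMonogenic (X ^ 8 + C 1 * X ^ 6 + C b * X ^ 4 + C 1 * X ^ 2 + 1) := by
  intro h
  obtain ⟨k, hk⟩ := hb
  obtain rfl : b = 4 * k + 1 := by linarith
  have : IsUnit (2 : ℤ) := by
    refine h.isUnit_of_dvd (P := X ^ 4 + X ^ 3 + X ^ 2 + X + 1) (Q := - (X ^ 3 + X))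
      (R := C k * X ^ 4) (by monicity!) ?_ ⟨1, ?_⟩
    · rw [natDegree_reciprocal]
      exact lt_of_le_of_lt (b := 4) (by compute_degree!) (by norm_num)
    · simp only [map_add, map_mul, map_pow, C_ofNat, map_one]
      ring
  exact absurd this (by decide)

theorem eq_mul_sq_of_isSquare_mul {q v : ℤ} (hq : Squarefree q) (h : IsSquare (q * v)) :
    ∃ m : ℤ, v = q * m ^ 2 := by
  obtain ⟨k, hk⟩ := h
  have hdvd : q ∣ k := (hq.dvd_pow_iff_dvd two_ne_zero).mp ⟨v, by linarith⟩
  obtain ⟨m, rfl⟩ := hdvd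
  exact ⟨m, mul_left_cancel₀ hq.ne_zero (by linarith)⟩

theorem eq_of_isSquare_mul {q v : ℤ} (hq : Squarefree q) (hv : Squarefree v)
    (h : IsSquare (q * v)) : v = q := by
  obtain ⟨m, rfl⟩ := eq_mul_sq_of_isSquare_mul hq h
  have hm : IsUnit m := hv m ⟨q, by ring⟩
  have : m ^ 2 = 1 := by rw [Int.isUnit_iff] at hm; rcases hm with rfl | rfl <;> norm_num
  rw [this, mul_one]

theorem eq_one_of_isSquare {q : ℤ} (hq : Squarefree q) (h : IsSquare q) : q = 1 :=
  eq_of_isSquare_mul squarefree_one hq (by simpa using h)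

theorem not_squarefree_nine : ¬ Squarefree (9 : ℤ) :=
  fun h => absurd (h 3 (by norm_num)) (by decide)

theorem not_squarefree_twentyFive : ¬ Squarefree (25 : ℤ) :=
  fun h => absurd (h 5 (by norm_num)) (by decide)

theorem eq_one_of_isSquare_one_sub {a : ℤ} (h0 : a ≠ 0) (hq : Squarefree (1 - 4 * a))
    (h : IsSquare ((1 - 4 * a) * (-a - 2)) ∨ IsSquare ((1 - 4 * a) * (-a - 6))) : a = 1 := by
  rcases h with h | h <;> obtain ⟨m, hm⟩ := eq_mul_sq_of_isSquare_mul hq h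
  · have hdvd : (1 - 4 * a) ∣ 9 := ⟨1 - 4 * m ^ 2, by linarith⟩
    have h1 := Int.le_of_dvd (by norm_num) hdvd
    have h2 := Int.le_of_dvd (by norm_num) (neg_dvd.mpr hdvd)
    have h3 : -2 ≤ a := by omega
    have h4 : a ≤ 2 := by omega
    interval_cases a <;>
      first | rfl | omega | (norm_num at hdvd; done) | exact absurd hq not_squarefree_nine
  · have hdvd : (1 - 4 * a) ∣ 25 := ⟨1 - 4 * m ^ 2, by linarith⟩
    have h1 := Int.le_of_dvd (by norm_num) hdvd
    have h2 := Int.le_of_dvd (by norm_num) (neg_dvd.mpr hdvd)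
    have h3 : -6 ≤ a := by omega
    have h4 : a ≤ 6 := by omega
    interval_cases a <;>
      first | omega | (norm_num at hdvd; done) | exact absurd hq not_squarefree_twentyFive | nlinarith

theorem eq_one_of_isSquare_one_add {a : ℤ} (h0 : a ≠ 0) (hq : Squarefree (1 + 4 * a))
    (h : IsSquare ((1 + 4 * a) * (2 - a)) ∨ IsSquare ((1 + 4 * a) * (6 - a))) : a = 1 := by
  rcases h with h | h <;> obtain ⟨m, hm⟩ := eq_mul_sq_of_isSquare_mul hq h
  · have hdvd : (1 + 4 * a) ∣ 9 := ⟨1 + 4 * m ^ 2, by linarith⟩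
    have h1 := Int.le_of_dvd (by norm_num) hdvd
    have h2 := Int.le_of_dvd (by norm_num) (neg_dvd.mpr hdvd)
    have h3 : -2 ≤ a := by omega
    have h4 : a ≤ 2 := by omega
    interval_cases a <;>
      first | omega | (norm_num at hdvd; done) | exact absurd hq not_squarefree_nine | nlinarith
  · have hdvd : (1 + 4 * a) ∣ 25 := ⟨1 + 4 * m ^ 2, by linarith⟩
    have h1 := Int.le_of_dvd (by norm_num) hdvd
    have h2 := Int.le_of_dvd (by norm_num) (neg_dvd.mpr hdvd)
    have h3 : -6 ≤ a := by omega
    have h4 : a ≤ 6 := by omega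
    interval_cases a <;>
      first | omega | (norm_num at hdvd; done) | exact absurd hq not_squarefree_twentyFive

/-- Generators of a dihedral group of order 8 adapted to an index-two subgroup of exponent two. -/
theorem exists_dihedral_generators {Γ : Type*} [Group Γ] (e : Γ ≃* DihedralGroup 4)
    (N : Subgroup Γ) (hN : ∀ g ∈ N, g * g = 1) (hmul : ∀ g h, g ∉ N → h ∉ N → g * h ∈ N) :
    ∃ σ τ c : Γ, σ ∉ N ∧ τ ∈ N ∧ c ∈ N ∧ c ≠ 1 ∧ σ * σ = 1 ∧ c * σ = σ * c ∧
      τ * σ = c * σ * τ ∧ ∀ S : Subgroup Γ, σ ∈ S → τ ∈ S → c ∈ S → ∀ g, g ∈ S := by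
  have key (i j : ZMod 4) (hij : i = 0 ∧ j = 1 ∨ i = 1 ∧ j = 0)
      (hi : e.symm (.sr i) ∉ N) (hj : e.symm (.sr j) ∈ N) (hc : e.symm (.r 2) ∈ N) :
      ∃ σ τ c : Γ, σ ∉ N ∧ τ ∈ N ∧ c ∈ N ∧ c ≠ 1 ∧ σ * σ = 1 ∧ c * σ = σ * c ∧
      τ * σ = c * σ * τ ∧ ∀ S : Subgroup Γ, σ ∈ S → τ ∈ S → c ∈ S → ∀ g, g ∈ S := by
    refine ⟨_, _, _, hi, hj, hc, ?_, ?_, ?_, ?_, ?_⟩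
    · rw [Ne, ← map_one e.symm, e.symm.injective.eq_iff]
      decide
    · rw [← map_mul, DihedralGroup.sr_mul_self, map_one]
    · rw [← map_mul, ← map_mul, e.symm.injective.eq_iff]
      rcases hij with ⟨rfl, rfl⟩ | ⟨rfl, rfl⟩ <;> decide
    · rw [← map_mul, ← map_mul, ← map_mul, e.symm.injective.eq_iff]
      rcases hij with ⟨rfl, rfl⟩ | ⟨rfl, rfl⟩ <;> decide
    · intro S hσ hτ hc g
      have hgen : ∀ x : DihedralGroup 4, ∃ k l m : Fin 2,
          x = .r 2 ^ (k : ℕ) * .sr j ^ (l : ℕ) * .sr i ^ (m : ℕ) := by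
        rcases hij with ⟨rfl, rfl⟩ | ⟨rfl, rfl⟩ <;> decide
      obtain ⟨k, l, m, hx⟩ := hgen (e g)
      have hg : g = e.symm (.r 2) ^ (k : ℕ) * e.symm (.sr j) ^ (l : ℕ) *
          e.symm (.sr i) ^ (m : ℕ) := by
        rw [← map_pow, ← map_pow, ← map_pow, ← map_mul, ← map_mul, ← hx, e.symm_apply_apply]
      rw [hg]
      exact S.mul_mem (S.mul_mem (S.pow_mem hc _) (S.pow_mem hτ _)) (S.pow_mem hσ _)
  have hr : e.symm (.r 1) ∉ N := by
    intro h
    have h1 := hN _ h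
    rw [← map_mul, ← map_one e.symm, e.symm.injective.eq_iff] at h1
    exact absurd h1 (by decide)
  have hc : e.symm (.r 2) ∈ N := by
    have h1 := hmul _ _ hr hr
    rwa [← map_mul] at h1
  by_cases h0 : e.symm (.sr 0) ∈ N
  · refine key 1 0 (by simp) (fun h1 => hr ?_) h0 hc
    have h2 := N.mul_mem h0 h1
    rwa [← map_mul] at h2
  · refine key 0 1 (by simp) h0 ?_ hc
    have h2 := hmul _ _ h0 hr
    rwa [← map_mul] at h2

section Galois

variable {K : Type*} [Field K] [Algebra ℚ K]

theorem exists_int_of_fixed [FiniteDimensional ℚ K] [IsGalois ℚ K] {x : K} {w : ℤ}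
    (hx : ∀ g : K ≃ₐ[ℚ] K, g x = x) (hw : x ^ 2 = w) : ∃ n : ℤ, x = n ∧ n ^ 2 = w := by
  obtain ⟨q, rfl⟩ := (IsGalois.mem_range_algebraMap_iff_fixed x).mpr hx
  have hq : q ^ 2 = w := by
    apply (algebraMap ℚ K).injective
    rw [map_pow, hw, map_intCast]
  obtain ⟨k, hk⟩ := Rat.isSquare_intCast_iff.mp ⟨q, by rw [← hq, sq]⟩
  have hqk : q = k ∨ q = -k := by
    rw [← sq_eq_sq_iff_eq_or_eq_neg, hq, hk]
    push_cast
    ring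
  rcases hqk with h | h
  · exact ⟨k, by rw [h, map_intCast], by rw [hk, sq]⟩
  · exact ⟨-k, by rw [h, map_neg, map_intCast, Int.cast_neg], by rw [hk]; ring⟩

variable {a b : ℤ} {z : K}

theorem conj_eq_of_ne (hz : z ^ 2 + a * z + b - 2 = 0) {σ : K ≃ₐ[ℚ] K} (hσ : σ z ≠ z) :
    σ z = -a - z := by
  have h := congrArg σ hz
  simp only [map_add, map_sub, map_mul, map_pow, map_intCast, map_ofNat, map_zero] at h
  have h1 : (σ z - z) * (σ z + a + z) = 0 := by linear_combination h - hz
  have h2 := (mul_eq_zero.mp h1).resolve_left (sub_ne_zero.mpr hσ)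
  linear_combination h2

theorem eq_or_eq_neg_of_fixed {x : K} {i : ℤ} (hx : x ^ 2 = z + i) {g : K ≃ₐ[ℚ] K}
    (hg : g z = z) : g x = x ∨ g x = -x := by
  rw [← sq_eq_sq_iff_eq_or_eq_neg, ← map_pow, hx, map_add, hg, map_intCast]

theorem mul_conj_sq (hz : z ^ 2 + a * z + b - 2 = 0) {x : K} {i : ℤ} (hx : x ^ 2 = z + i)
    {σ : K ≃ₐ[ℚ] K} (hσ : σ z ≠ z) :
    (x * σ x) ^ 2 = ((i ^ 2 - a * i + b - 2 : ℤ) : K) := by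
  rw [mul_pow, ← map_pow, hx, map_add, conj_eq_of_ne hz hσ, map_intCast]
  push_cast
  linear_combination -hz

variable [FiniteDimensional ℚ K] [IsGalois ℚ K]

theorem isSquare_of_comm (hcomm : ∀ g h : K ≃ₐ[ℚ] K, g * h = h * g)
    (hinv : ∀ g : K ≃ₐ[ℚ] K, g * g = 1) (hz : z ^ 2 + a * z + b - 2 = 0)
    {x : K} {i : ℤ} (hx : x ^ 2 = z + i) {σ : K ≃ₐ[ℚ] K} (hσ : σ z ≠ z) :
    IsSquare (i ^ 2 - a * i + b - 2) := by
  have hσσ : σ (σ x) = x := DFunLike.congr_fun (hinv σ) x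
  have hfix {g : K ≃ₐ[ℚ] K} (hg : g z = z) : g (x * σ x) = x * σ x := by
    have hgσ : g (σ x) = σ (g x) := DFunLike.congr_fun (hcomm g σ) x
    rw [map_mul, hgσ]
    rcases eq_or_eq_neg_of_fixed hx hg with h | h <;> simp [h]
  have hall (g : K ≃ₐ[ℚ] K) : g (x * σ x) = x * σ x := by
    by_cases hg : g z = z
    · exact hfix hg
    · have h1 : (g * σ) z = z := by
        rw [AlgEquiv.mul_apply, conj_eq_of_ne hz hσ, map_sub, map_neg, map_intCast,
          conj_eq_of_ne hz hg]
        ring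
      have h2 := hfix h1
      rwa [AlgEquiv.mul_apply, map_mul, hσσ, mul_comm (σ x)] at h2
  obtain ⟨n, -, hn⟩ := exists_int_of_fixed hall (mul_conj_sq hz hx hσ)
  exact ⟨n, by rw [← hn, sq]⟩

/-- If `c` fixes `x` and negates `y`, then the norm of `x` is a square `n ^ 2`, and the norm of `y`
times the square of the trace of `x` is a square. -/
theorem isSquare_of_dihedral {σ τ c : K ≃ₐ[ℚ] K} (hz : z ^ 2 + a * z + b - 2 = 0)
    (hσ : σ z ≠ z) (hτ : τ z = z) (hc1 : c ≠ 1) (hσσ : σ * σ = 1) (hcσ : c * σ = σ * c)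
    (hτσ : τ * σ = c * σ * τ)
    (hgen : ∀ S : Subgroup (K ≃ₐ[ℚ] K), σ ∈ S → τ ∈ S → c ∈ S → ∀ g, g ∈ S)
    {x y : K} {i j : ℤ} (hx : x ^ 2 = z + i) (hy : y ^ 2 = z + j)
    (hext : ∀ g h : K ≃ₐ[ℚ] K, g x = h x → g y = h y → g = h)
    (hcx : c x = x) (hcy : c y = -y) :
    ∃ n : ℤ, n ^ 2 = i ^ 2 - a * i + b - 2 ∧
      IsSquare ((j ^ 2 - a * j + b - 2) * (-a + 2 * i + 2 * n)) := by
  have hfix {w : K} (h1 : σ w = w) (h2 : τ w = w) (h3 : c w = w) (g : K ≃ₐ[ℚ] K) : g w = w :=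
    hgen (MulAction.stabilizer (K ≃ₐ[ℚ] K) w) h1 h2 h3 g
  have hσσ' (w : K) : σ (σ w) = w := DFunLike.congr_fun hσσ w
  have hcσ' (w : K) : c (σ w) = σ (c w) := DFunLike.congr_fun hcσ w
  have hτσ' (w : K) : τ (σ w) = σ (c (τ w)) := by
    rw [← hcσ']; exact DFunLike.congr_fun hτσ w
  have hτx : τ x = -x := by
    refine (eq_or_eq_neg_of_fixed hx hτ).resolve_left fun h => hc1 ?_
    have hcomm : τ * σ = σ * τ := by
      rcases eq_or_eq_neg_of_fixed hy hτ with h' | h'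
      · rw [hext τ 1 h h', one_mul, mul_one]
      · rw [hext τ c (h.trans hcx.symm) (h'.trans hcy.symm), hcσ]
    rwa [hcomm, mul_assoc, right_eq_mul] at hτσ
  have hxfix := hfix (w := x * σ x) (by simp [hσσ', mul_comm]) (by simp [hτσ', hτx, hcx])
    (by simp [hcσ', hcx])
  obtain ⟨n, hn, hn2⟩ := exists_int_of_fixed hxfix (mul_conj_sq hz hx hσ)
  refine ⟨n, hn2, ?_⟩
  have hm : (y * σ y * (x + σ x)) ^ 2 =
      (((j ^ 2 - a * j + b - 2) * (-a + 2 * i + 2 * n) : ℤ) : K) := by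
    have hσx : (σ x) ^ 2 = -a - z + i := by
      rw [← map_pow, hx, map_add, conj_eq_of_ne hz hσ, map_intCast]
    rw [mul_pow, mul_conj_sq hz hy hσ]
    push_cast
    rw [← hn]
    linear_combination ((j : K) ^ 2 - a * j + b - 2) * (hx + hσx)
  have hτy : τ (y * σ y) = -(y * σ y) := by
    rcases eq_or_eq_neg_of_fixed hy hτ with h' | h' <;> simp [hτσ', h', hcy]
  obtain ⟨k, -, hk⟩ := exists_int_of_fixed (hfix (w := y * σ y * (x + σ x))
    (by simp only [map_mul, map_add, hσσ']; ring)
    (by rw [map_mul, hτy, map_add, hτσ', hτx, map_neg, hcx, map_neg]; ring)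
    (by simp [hcσ', hcx, hcy])) hm
  exact ⟨k, by rw [← hk, sq]⟩

theorem isSquare_mul_of_dihedral {σ τ c : K ≃ₐ[ℚ] K} (hz : z ^ 2 + a * z + b - 2 = 0)
    (hσ : σ z ≠ z) (hτ : τ z = z) (hσσ : σ * σ = 1) (hcσ : c * σ = σ * c)
    (hτσ : τ * σ = c * σ * τ)
    (hgen : ∀ S : Subgroup (K ≃ₐ[ℚ] K), σ ∈ S → τ ∈ S → c ∈ S → ∀ g, g ∈ S)
    {x y : K} {i j : ℤ} (hx : x ^ 2 = z + i) (hy : y ^ 2 = z + j)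
    (hcx : c x = -x) (hcy : c y = -y) :
    IsSquare ((i ^ 2 - a * i + b - 2) * (j ^ 2 - a * j + b - 2)) := by
  have hσσ' (w : K) : σ (σ w) = w := DFunLike.congr_fun hσσ w
  have hcσ' (w : K) : c (σ w) = σ (c w) := DFunLike.congr_fun hcσ w
  have hτσ' (w : K) : τ (σ w) = σ (c (τ w)) := by
    rw [← hcσ']; exact DFunLike.congr_fun hτσ w
  have hτ' {w : K} {k : ℤ} (hw : w ^ 2 = z + k) (hcw : c w = -w) :
      τ (w * σ w) = -(w * σ w) := by
    rcases eq_or_eq_neg_of_fixed hw hτ with h' | h' <;> simp [hτσ', h', hcw]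
  obtain ⟨k, -, hk⟩ := exists_int_of_fixed (x := (x * σ x) * (y * σ y))
    (hgen (MulAction.stabilizer (K ≃ₐ[ℚ] K) ((x * σ x) * (y * σ y)))
      (by simp only [MulAction.mem_stabilizer_iff, AlgEquiv.smul_def, map_mul, hσσ']; ring)
      (by rw [MulAction.mem_stabilizer_iff, AlgEquiv.smul_def, map_mul, hτ' hx hcx, hτ' hy hcy]
          ring)
      (by simp [hcσ', hcx, hcy]))
    (w := (i ^ 2 - a * i + b - 2) * (j ^ 2 - a * j + b - 2))
    (by rw [mul_pow, mul_conj_sq hz hx hσ, mul_conj_sq hz hy hσ, Int.cast_mul])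
  exact ⟨k, by rw [← hk, sq]⟩

end Galois

/-- When the Galois group of `x⁸ + a x⁶ + b x⁴ + a x² + 1` has order 8, a root `θ` generates the
splitting field, which is then also generated by `θ + θ⁻¹` and `θ - θ⁻¹`. -/
theorem exists_splittingField_generators (K : Type*) [Field K] [Algebra ℚ K] {a b : ℤ} {p : ℚ[X]}
    [p.IsSplittingField ℚ K] [FiniteDimensional ℚ K] [IsGalois ℚ K]
    (hp : p = X ^ 8 + C (a : ℚ) * X ^ 6 + C (b : ℚ) * X ^ 4 + C (a : ℚ) * X ^ 2 + 1)
    (hirr : Irreducible p) (hcard : Nat.card (K ≃ₐ[ℚ] K) = 8) :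
    ∃ z s t : K,
      z ^ 2 + a * z + b - 2 = 0 ∧ s ^ 2 = z + (2 : ℤ) ∧ t ^ 2 = z + (-2 : ℤ) ∧
      (∀ g h : K ≃ₐ[ℚ] K, g t = h t → g s = h s → g = h) ∧
      ∃ σ : K ≃ₐ[ℚ] K, σ z ≠ z := by
  have hdeg : p.natDegree = 8 := by rw [hp]; compute_degree!
  have hmonic : p.Monic := by rw [hp]; monicity!
  have hrank : Module.finrank ℚ K = 8 := by
    rw [← IsGalois.card_aut_eq_finrank, hcard]
  obtain ⟨θ, hθ⟩ := (IsSplittingField.splits K p).exists_eval_eq_zero (by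
    rw [degree_map]; exact (degree_pos_of_irreducible hirr).ne')
  rw [eval_map_algebraMap] at hθ
  have hmin : minpoly ℚ θ = p := (minpoly.eq_of_irreducible_of_monic hirr hθ hmonic).symm
  have htop : IntermediateField.adjoin ℚ {θ} = ⊤ := by
    rw [Field.primitive_element_iff_minpoly_natDegree_eq, hmin, hdeg, hrank]
  have hroot : θ ^ 8 + a * θ ^ 6 + b * θ ^ 4 + a * θ ^ 2 + 1 = 0 := by
    have h := hθ
    conv at h => lhs; arg 2; rw [hp]
    simpa using h
  have hθ0 : θ ≠ 0 := by
    rintro rfl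
    simp at hroot
  refine ⟨θ ^ 2 + (θ⁻¹) ^ 2, θ + θ⁻¹, θ - θ⁻¹, ?_, ?_, ?_, ?_, ?_⟩
  · field_simp
    linear_combination hroot
  · push_cast
    field_simp
    ring
  · push_cast
    field_simp
    ring
  · intro g h ht hs
    have hgh : g θ = h θ := by
      have : CharZero K := algebraRat.charZero K
      rw [map_sub, map_sub] at ht
      rw [map_add, map_add] at hs
      apply mul_left_cancel₀ (two_ne_zero (α := K))
      linear_combination ht + hs
    have hcoe : (g : K →ₐ[ℚ] K) = h := by
      have htop' : Algebra.adjoin ℚ {θ} = ⊤ := by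
        rw [← IntermediateField.adjoin_simple_toSubalgebra_of_isAlgebraic
          (Algebra.IsAlgebraic.isAlgebraic θ), htop, IntermediateField.top_toSubalgebra]
      refine AlgHom.ext_of_adjoin_eq_top htop' ?_
      rintro _ rfl
      exact hgh
    exact AlgEquiv.coe_toAlgHom_injective hcoe
  · by_contra! hfix
    obtain ⟨q, hq⟩ := (IsGalois.mem_range_algebraMap_iff_fixed _).mpr hfix
    have hzero : aeval θ (X ^ 4 - C q * X ^ 2 + 1 : ℚ[X]) = 0 := by
      simp only [map_add, map_sub, map_mul, map_pow, aeval_X, aeval_C, map_one, hq]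
      field_simp
      ring
    have hle := natDegree_le_of_dvd (minpoly.dvd ℚ θ hzero)
      (Monic.ne_zero (by monicity!))
    have h4 : (X ^ 4 - C q * X ^ 2 + 1 : ℚ[X]).natDegree = 4 := by compute_degree!
    rw [hmin, hdeg, h4] at hle
    omega

theorem map_reciprocal (a b : ℤ) :
    (X ^ 8 + C a * X ^ 6 + C b * X ^ 4 + C a * X ^ 2 + 1 : ℤ[X]).map (Int.castRingHom ℚ) =
      X ^ 8 + C (a : ℚ) * X ^ 6 + C (b : ℚ) * X ^ 4 + C (a : ℚ) * X ^ 2 + 1 := by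
  simp

theorem IsMonogenic.not_gal_elementary (K : Type*) [Field K] [Algebra ℚ K] {a b : ℤ} (ha : a ≠ 0)
    (hmono : IsMonogenic (X ^ 8 + C a * X ^ 6 + C b * X ^ 4 + C a * X ^ 2 + 1))
    [((X ^ 8 + C a * X ^ 6 + C b * X ^ 4 + C a * X ^ 2 + 1 : ℤ[X]).map
      (Int.castRingHom ℚ)).IsSplittingField ℚ K]
    (e : (K ≃ₐ[ℚ] K) ≃*
      Multiplicative (ZMod 2) × Multiplicative (ZMod 2) × Multiplicative (ZMod 2)) :
    False := by
  have := IsSplittingField.finiteDimensional K ((X ^ 8 + C a * X ^ 6 + C b * X ^ 4 + C a * X ^ 2 + 1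
    : ℤ[X]).map (Int.castRingHom ℚ))
  have := IsGalois.of_separable_splitting_field (E := K) hmono.2.1.separable
  have hplus : Squarefree ((-2) ^ 2 - a * (-2) + b - 2) := by
    convert hmono.squarefree_eval_one using 1; ring
  have hminus : Squarefree (2 ^ 2 - a * 2 + b - 2) := by
    convert hmono.squarefree_eval_I using 1; ring
  obtain ⟨z, s, t, hz, hs, ht, -, σ, hσ⟩ := exists_splittingField_generators K
    (map_reciprocal a b) hmono.2.1 (by
      rw [Nat.card_congr e.toEquiv, Nat.card_eq_fintype_card]; rfl)
  have hcomm (g h : K ≃ₐ[ℚ] K) : g * h = h * g := by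
    apply e.injective
    rw [map_mul, map_mul, mul_comm]
  have hinv (g : K ≃ₐ[ℚ] K) : g * g = 1 := by
    apply e.injective
    rw [map_mul, map_one]
    generalize e g = x
    revert x
    decide
  have h1 := eq_one_of_isSquare hplus (isSquare_of_comm hcomm hinv hz ht hσ)
  have h2 := eq_one_of_isSquare hminus (isSquare_of_comm hcomm hinv hz hs hσ)
  omega

theorem IsMonogenic.not_gal_dihedral (K : Type*) [Field K] [Algebra ℚ K] {a b : ℤ} (ha : a ≠ 0)
    (hmono : IsMonogenic (X ^ 8 + C a * X ^ 6 + C b * X ^ 4 + C a * X ^ 2 + 1))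
    [((X ^ 8 + C a * X ^ 6 + C b * X ^ 4 + C a * X ^ 2 + 1 : ℤ[X]).map
      (Int.castRingHom ℚ)).IsSplittingField ℚ K]
    (e : (K ≃ₐ[ℚ] K) ≃* DihedralGroup 4) : False := by
  have := IsSplittingField.finiteDimensional K ((X ^ 8 + C a * X ^ 6 + C b * X ^ 4 + C a * X ^ 2 + 1
    : ℤ[X]).map (Int.castRingHom ℚ))
  have := IsGalois.of_separable_splitting_field (E := K) hmono.2.1.separable
  have hplus : Squarefree ((-2) ^ 2 - a * (-2) + b - 2) := by
    convert hmono.squarefree_eval_one using 1; ring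
  have hminus : Squarefree (2 ^ 2 - a * 2 + b - 2) := by
    convert hmono.squarefree_eval_I using 1; ring
  obtain ⟨z, s, t, hz, hs, ht, hext, -⟩ := exists_splittingField_generators K
    (map_reciprocal a b) hmono.2.1 (by
      rw [Nat.card_congr e.toEquiv, DihedralGroup.nat_card])
  obtain ⟨σ, τ, c, hσ, hτ, hc, hc1, hσσ, hcσ, hτσ, hfull⟩ :=
    exists_dihedral_generators e (MulAction.stabilizer _ z)
    (by
      intro g hg
      refine hext (g * g) 1 ?_ ?_
      · rcases eq_or_eq_neg_of_fixed ht hg with h | h <;> simp [AlgEquiv.mul_apply, h]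
      · rcases eq_or_eq_neg_of_fixed hs hg with h | h <;> simp [AlgEquiv.mul_apply, h])
    (by
      intro g h hg hh
      change g (h z) = z
      rw [conj_eq_of_ne hz hh, map_sub, map_neg, map_intCast, conj_eq_of_ne hz hg]
      ring)
  rcases eq_or_eq_neg_of_fixed ht hc with hct | hct <;>
    rcases eq_or_eq_neg_of_fixed hs hc with hcs | hcs
  · exact hc1 (hext c 1 hct hcs)
  · obtain ⟨n, hn, hsq⟩ := isSquare_of_dihedral hz hσ hτ hc1 hσσ hcσ hτσ hfull ht hs hext hct hcs
    have h1 := eq_one_of_isSquare hplus ⟨n, by rw [← hn, sq]⟩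
    obtain rfl : b = -1 - 2 * a := by linarith
    rw [h1, sq_eq_one_iff] at hn
    have ha1 : a = 1 := by
      refine eq_one_of_isSquare_one_sub ha (by convert hminus using 1; ring) ?_
      rcases hn with rfl | rfl
      · left; convert hsq using 1; ring
      · right; convert hsq using 1; ring
    subst ha1
    exact not_isMonogenic_of_eq_one (by norm_num) hmono
  · obtain ⟨n, hn, hsq⟩ := isSquare_of_dihedral hz hσ hτ hc1 hσσ hcσ hτσ hfull hs ht
      (fun g h h1 h2 => hext g h h2 h1) hcs hct
    have h1 := eq_one_of_isSquare hminus ⟨n, by rw [← hn, sq]⟩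
    obtain rfl : b = 2 * a - 1 := by linarith
    rw [h1, sq_eq_one_iff] at hn
    have ha1 : a = 1 := by
      refine eq_one_of_isSquare_one_add ha (by convert hplus using 1; ring) ?_
      rcases hn with rfl | rfl
      · right; convert hsq using 1; ring
      · left; convert hsq using 1; ring
    subst ha1
    exact not_isMonogenic_of_eq_one (by norm_num) hmono
  · have h1 := eq_of_isSquare_mul hplus hminus
      (isSquare_mul_of_dihedral hz hσ hτ hσσ hcσ hτσ hfull ht hs hct hcs)
    omega

theorem stmt_17 (a b : ℤ) (ha : a ≠ 0)
    (hmono : IsMonogenic (X ^ 8 + C a * X ^ 6 + C b * X ^ 4 + C a * X ^ 2 + 1)) :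
    ¬ Nonempty ((((X ^ 8 + C a * X ^ 6 + C b * X ^ 4 + C a * X ^ 2 + 1 : Polynomial ℤ).map
        (Int.castRingHom ℚ)).Gal ≃*
        Multiplicative (ZMod 2) × Multiplicative (ZMod 2) × Multiplicative (ZMod 2)) ) ∧
    ¬ Nonempty ((((X ^ 8 + C a * X ^ 6 + C b * X ^ 4 + C a * X ^ 2 + 1 : Polynomial ℤ).map
        (Int.castRingHom ℚ)).Gal ≃* DihedralGroup 4)) := by
  refine ⟨?_, ?_⟩
  · rintro ⟨e⟩
    exact @IsMonogenic.not_gal_elementary _ _ _ a b ha hmono (IsSplittingField.splittingField _) e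
  · rintro ⟨e⟩
    exact @IsMonogenic.not_gal_dihedral _ _ _ a b ha hmono (IsSplittingField.splittingField _) e
end

section
/- Let p be a prime such that the integer (16p+13)(4p+1)(4p−3) is squarefree. Then the polynomial G(x) = x⁸ + (4p+3)·x⁶ + (8p+5)·x⁴ + (4p+3)·x² + 1 is monogenic and its Galois group Gal(G) is isomorphic to ℤ/2ℤ × D₄, where D₄ denotes the dihedral group of order 8. -/
open Polynomial

lemma natCast_dvd_of_intCast_mem {A : Type*} [CommRing A] (P : Ideal A) [P.IsPrime] {q : ℕ}
    (hq : q.Prime) (hqP : (q : A) ∈ P) {m : ℤ} (hm : (m : A) ∈ P) : (q : ℤ) ∣ m := by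
  by_contra hndvd
  have hcop : IsCoprime (q : ℤ) m :=
    (Nat.prime_iff_prime_int.1 hq).coprime_iff_not_dvd.2 hndvd
  obtain ⟨a, b, hab⟩ := hcop
  apply ‹P.IsPrime›.ne_top
  rw [Ideal.eq_top_iff_one]
  have h1 : (a : A) * (q : A) + b * m = 1 := by exact_mod_cast congrArg (Int.cast : ℤ → A) hab
  rw [← h1]
  exact P.add_mem (P.mul_mem_left _ hqP) (P.mul_mem_left _ hm)

lemma exists_int_eq_mul_of_intCast_mem {A : Type*} [CommRing A] (P : Ideal A) [P.IsPrime] {q : ℕ}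
    (hq : q.Prime) (hqP : (q : A) ∈ P) {m : ℤ} (hsf : Squarefree m) (hm : (m : A) ∈ P) :
    ∃ c : ℤ, m = q * c ∧ (c : A) ∉ P := by
  obtain ⟨c, rfl⟩ := natCast_dvd_of_intCast_mem P hq hqP hm
  refine ⟨c, rfl, fun hc => ?_⟩
  have hu := hsf q (mul_dvd_mul_left _ (natCast_dvd_of_intCast_mem P hq hqP hc))
  exact (Nat.prime_iff_prime_int.1 hq).not_isUnit hu

/-- The even reciprocal octic `x⁸ + (4n+3)x⁶ + (8n+5)x⁴ + (4n+3)x² + 1`. -/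
noncomputable abbrev octic (n : ℤ) : ℤ[X] :=
  X ^ 8 + C (4 * n + 3) * X ^ 6 + C (8 * n + 5) * X ^ 4 + C (4 * n + 3) * X ^ 2 + 1

lemma exists_dedekind_witness_octic_of_two_mem {A : Type*} [CommRing A] {n : ℤ} {θ : A}
    (hθ : aeval θ (octic n) = 0) (P : Ideal A) [P.IsPrime] (h2 : (2 : A) ∈ P) :
    ∃ s : ℤ[X], aeval θ s ∈ P ∧ aeval θ (derivative s) ∉ P ∧
      ∃ u ∉ P, u * 2 ∈ Ideal.span {aeval θ s} := by
  have hG : θ ^ 8 + (4 * n + 3) * θ ^ 6 + (8 * n + 5) * θ ^ 4 + (4 * n + 3) * θ ^ 2 + 1 = 0 := by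
    simpa [octic, map_ofNat] using hθ
  have h2' : (2 : A ⧸ P) = 0 := by
    have := Ideal.Quotient.eq_zero_iff_mem.2 h2
    rwa [map_ofNat] at this
  set t : A ⧸ P := Ideal.Quotient.mk P θ with ht
  have hGt : t ^ 8 + (4 * n + 3) * t ^ 6 + (8 * n + 5) * t ^ 4 + (4 * n + 3) * t ^ 2 + 1 = 0 := by
    simpa [map_ofNat] using congrArg (Ideal.Quotient.mk P) hG
  have hΦ : t ^ 4 + t ^ 3 + t ^ 2 + t + 1 = 0 := by
    have : (t ^ 4 + t ^ 3 + t ^ 2 + t + 1) ^ 2 = 0 := by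
      linear_combination hGt + h2' * (t ^ 7 - 2 * n * t ^ 6 + 2 * t ^ 5 - 4 * n * t ^ 4
        + 2 * t ^ 3 - 2 * n * t ^ 2 + t)
    exact pow_eq_zero_iff two_ne_zero |>.1 this
  have ht0 : t ≠ 0 := by
    intro h
    rw [h] at hΦ
    simp at hΦ
  have ht1 : t + 1 ≠ 0 := by
    intro h
    apply one_ne_zero (α := A ⧸ P)
    linear_combination hΦ - (t ^ 3 + t) * h
  refine ⟨X ^ 4 + X ^ 3 + X ^ 2 + X + 1, ?_, ?_,
    -θ ^ 7 + 2 * n * θ ^ 6 - 2 * θ ^ 5 + 4 * n * θ ^ 4 - 2 * θ ^ 3 + 2 * n * θ ^ 2 - θ, ?_, ?_⟩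
  · rw [← Ideal.Quotient.eq_zero_iff_mem]
    simpa using hΦ
  · rw [← Ideal.Quotient.eq_zero_iff_mem]
    simp only [derivative_X_pow, derivative_X, derivative_one, map_add, map_mul,
      aeval_X, map_pow, map_one, ← ht]
    simp only [Nat.cast_ofNat, map_ofNat, map_zero]
    intro h
    apply pow_ne_zero 2 ht1
    linear_combination h - h2' * (2 * t ^ 3 + t ^ 2)
  · rw [← Ideal.Quotient.eq_zero_iff_mem]
    simp only [map_add, map_sub, map_neg, map_mul, map_pow, map_ofNat, map_intCast, ← ht]
    intro h
    apply mul_ne_zero ht0 ht1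
    linear_combination - h - (t ^ 3 - t ^ 2) * hΦ + h2' * (n * t ^ 6 - t ^ 5 + 2 * n * t ^ 4
      - t ^ 3 + n * t ^ 2)
  · refine Ideal.mem_span_singleton'.2 ⟨-(θ ^ 4 + θ ^ 3 + θ ^ 2 + θ + 1), ?_⟩
    simp only [map_add, map_pow, aeval_X, map_one]
    linear_combination -hG

lemma exists_dedekind_witness_octic {A : Type*} [CommRing A] {n : ℤ}
    (hsf : Squarefree ((16 * n + 13) * (4 * n + 1) * (4 * n - 3))) {θ : A}
    (hθ : aeval θ (octic n) = 0) (P : Ideal A) [P.IsPrime] (q : ℕ) (hq : q.Prime)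
    (hqP : (q : A) ∈ P) :
    ∃ s : ℤ[X], aeval θ s ∈ P ∧ aeval θ (derivative s) ∉ P ∧
      (aeval θ s = 0 ∨ ∃ u ∉ P, u * q ∈ Ideal.span {aeval θ s}) := by
  rcases hq.eq_two_or_odd' with rfl | hodd
  · obtain ⟨s, hs, hs', hu⟩ :=
      exists_dedekind_witness_octic_of_two_mem hθ P (by simpa using hqP)
    exact ⟨s, hs, hs', Or.inr (by simpa using hu)⟩
  by_cases hd : aeval θ (derivative (octic n)) ∈ P
  swap
  · exact ⟨octic n, hθ ▸ P.zero_mem, hd, Or.inl hθ⟩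
  have hG : θ ^ 8 + (4 * n + 3) * θ ^ 6 + (8 * n + 5) * θ ^ 4 + (4 * n + 3) * θ ^ 2 + 1 = 0 := by
    simpa [octic, map_ofNat] using hθ
  set t : A ⧸ P := Ideal.Quotient.mk P θ with ht
  have hGt : t ^ 8 + (4 * n + 3) * t ^ 6 + (8 * n + 5) * t ^ 4 + (4 * n + 3) * t ^ 2 + 1 = 0 := by
    simpa [map_ofNat] using congrArg (Ideal.Quotient.mk P) hG
  have h2 : (2 : A ⧸ P) ≠ 0 := by
    intro h
    obtain ⟨m, rfl⟩ := hodd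
    have hq0 := Ideal.Quotient.eq_zero_iff_mem.2 hqP
    push_cast at hq0
    simp only [map_add, map_mul, map_ofNat, map_natCast, map_one] at hq0
    apply one_ne_zero (α := A ⧸ P)
    linear_combination hq0 - m * h
  have hdt : 8 * t ^ 7 + (4 * n + 3) * (6 * t ^ 5) + (8 * n + 5) * (4 * t ^ 3)
      + (4 * n + 3) * (2 * t) = 0 := by
    rw [← Ideal.Quotient.eq_zero_iff_mem] at hd
    simpa [octic, derivative_X_pow, map_ofNat] using hd
  have ht0 : t ≠ 0 := by
    intro h
    rw [h] at hGt
    simp at hGt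
  have hfac : 2 * ((2 * t ^ 4 + (4 * n + 3) * t ^ 2 + 2) *
      ((t ^ 2 + 1) * ((t - 1) * (t + 1)))) = 0 := by
    linear_combination t * hdt - 4 * hGt
  have hbD : ∀ h15 : ((16 * n + 13 : ℤ) : A) ∈ P, (((4 * n + 1) * (4 * n - 3) : ℤ) : A) ∉ P := by
    intro h15 hD
    have hu := hsf q (by
      rw [mul_assoc]
      exact mul_dvd_mul (natCast_dvd_of_intCast_mem P hq hqP h15)
        (natCast_dvd_of_intCast_mem P hq hqP hD))
    exact (Nat.prime_iff_prime_int.1 hq).not_isUnit hu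
  rcases mul_eq_zero.1 ((mul_eq_zero.1 hfac).resolve_left h2) with hS | hfac
  · have hDt : (((4 * n + 1) * (4 * n - 3) : ℤ) : A ⧸ P) = 0 := by
      have : (((4 * n + 1) * (4 * n - 3) : ℤ) : A ⧸ P) * t ^ 4 = 0 := by
        push_cast
        linear_combination (2 * t ^ 4 + (4 * n + 3) * t ^ 2 + 2) * hS - 4 * hGt
      exact (mul_eq_zero.1 this).resolve_right (pow_ne_zero 4 ht0)
    have hD : (((4 * n + 1) * (4 * n - 3) : ℤ) : A) ∈ P := by
      rw [← Ideal.Quotient.eq_zero_iff_mem, map_intCast, hDt]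
    obtain ⟨c, hc, hcP⟩ := exists_int_eq_mul_of_intCast_mem P hq hqP
      (hsf.squarefree_of_dvd ⟨16 * n + 13, by ring⟩) hD
    refine ⟨2 * X ^ 4 + C (4 * n + 3) * X ^ 2 + 2, ?_, ?_, Or.inr ⟨c * θ ^ 4, ?_, ?_⟩⟩
    · rw [← Ideal.Quotient.eq_zero_iff_mem]
      simpa [map_ofNat] using hS
    · rw [← Ideal.Quotient.eq_zero_iff_mem]
      have hder : derivative (2 * X ^ 4 + C (4 * n + 3) * X ^ 2 + 2 : ℤ[X]) =
          8 * X ^ 3 + C (4 * n + 3) * (2 * X) := by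
        have : (2 : ℤ[X]) = C 2 := rfl
        simp only [this, derivative_add, derivative_C_mul, derivative_X_pow, derivative_C]
        simp
        ring
      rw [hder]
      simp only [map_add, map_mul, map_pow, aeval_X, aeval_C, map_ofNat, ← ht]
      simp only [algebraMap_int_eq, eq_intCast, map_intCast]
      intro h
      have h4 : 4 * t ^ 2 + (4 * n + 3) = 0 := by
        have : (2 * t) * (4 * t ^ 2 + (4 * n + 3)) = 0 := by linear_combination h
        exact (mul_eq_zero.1 this).resolve_left (mul_ne_zero h2 ht0)
      have hA : ((4 * n + 3) ^ 2 : A ⧸ P) = 16 := by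
        linear_combination (4 * t ^ 2 + (4 * n + 3)) * h4 - 8 * hS
      push_cast at hDt
      have h15 : 2 ^ 4 * (16 * n + 13 : A ⧸ P) = 0 := by
        linear_combination (8 * (4 * n + 3) + 36) * (hA - hDt) - 64 * hA
      refine hbD ?_ hD
      rw [← Ideal.Quotient.eq_zero_iff_mem, map_intCast]
      push_cast
      exact (mul_eq_zero.1 h15).resolve_left (pow_ne_zero 4 h2)
    · rw [← Ideal.Quotient.eq_zero_iff_mem] at hcP ⊢
      rw [map_mul, map_pow]
      exact mul_ne_zero hcP (pow_ne_zero 4 ht0)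
    · refine Ideal.mem_span_singleton'.2 ⟨2 * θ ^ 4 + (4 * n + 3) * θ ^ 2 + 2, ?_⟩
      have hc' := congrArg (Int.cast : ℤ → A) hc
      push_cast at hc'
      simp only [map_add, map_mul, map_pow, aeval_X, map_ofNat, eq_intCast, map_intCast]
      linear_combination 4 * hG + θ ^ 4 * hc'
  have hm1 : t ^ 2 + 1 ≠ 0 := by
    intro h
    apply one_ne_zero (α := A ⧸ P)
    linear_combination hGt - (t ^ 6 + (4 * n + 2) * t ^ 4 + (4 * n + 3) * t ^ 2) * h
  have hfac := (mul_eq_zero.1 hfac).resolve_left hm1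
  have hb : ((16 * n + 13 : ℤ) : A) ∈ P := by
    rw [← Ideal.Quotient.eq_zero_iff_mem, map_intCast]
    push_cast
    linear_combination hGt - ((t ^ 6 + t ^ 4 + t ^ 2 + 1) + (4 * n + 3) * (t ^ 4 + t ^ 2 + 1)
      + (8 * n + 5) * (t ^ 2 + 1) + (4 * n + 3)) * hfac
  obtain ⟨c, hc, hcP⟩ := exists_int_eq_mul_of_intCast_mem P hq hqP
    (hsf.squarefree_of_dvd ⟨(4 * n + 1) * (4 * n - 3), by ring⟩) hb
  have hc' := congrArg (Int.cast : ℤ → A) hc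
  push_cast at hc'
  rcases mul_eq_zero.1 hfac with h | h
  · refine ⟨X - 1, ?_, ?_, Or.inr ⟨c, hcP, ?_⟩⟩
    · rw [← Ideal.Quotient.eq_zero_iff_mem]
      simpa using h
    · simpa using (Ideal.ne_top_iff_one P).1 ‹P.IsPrime›.ne_top
    · refine Ideal.mem_span_singleton'.2 ⟨-(((θ ^ 6 + θ ^ 4 + θ ^ 2 + 1) +
        (4 * n + 3) * (θ ^ 4 + θ ^ 2 + 1) + (8 * n + 5) * (θ ^ 2 + 1) + (4 * n + 3)) * (θ + 1)), ?_⟩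
      simp only [map_sub, aeval_X, map_one]
      linear_combination - hG + hc'
  · refine ⟨X + 1, ?_, ?_, Or.inr ⟨c, hcP, ?_⟩⟩
    · rw [← Ideal.Quotient.eq_zero_iff_mem]
      simpa using h
    · simpa using (Ideal.ne_top_iff_one P).1 ‹P.IsPrime›.ne_top
    · refine Ideal.mem_span_singleton'.2 ⟨-(((θ ^ 6 + θ ^ 4 + θ ^ 2 + 1) +
        (4 * n + 3) * (θ ^ 4 + θ ^ 2 + 1) + (8 * n + 5) * (θ ^ 2 + 1) + (4 * n + 3)) * (θ - 1)), ?_⟩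
      simp only [map_add, aeval_X, map_one]
      linear_combination - hG + hc'

lemma exists_notMem_mul_mem_span_pair {A : Type*} [CommRing A] {θ : A}
    (hθ : Algebra.adjoin ℤ {θ} = ⊤) (P : Ideal A) [P.IsPrime] {q : ℕ} [Fact q.Prime]
    (hq : (q : A) ∈ P) {s : ℤ[X]} (hs : aeval θ s ∈ P) (hs' : aeval θ (derivative s) ∉ P)
    {y : A} (hy : y ∈ P) : ∃ u ∉ P, u * y ∈ Ideal.span {(q : A), aeval θ s} := by
  have hsurj : Function.Surjective (aeval θ : ℤ[X] →ₐ[ℤ] A) := by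
    rw [← AlgHom.range_eq_top, ← Algebra.adjoin_singleton_eq_range_aeval, hθ]
  let π : ℤ[X] →+* (ZMod q)[X] := mapRingHom (Int.castRingHom (ZMod q))
  have hπ : Function.Surjective π := Polynomial.map_surjective _ ZMod.intCast_surjective
  have hker : ∀ a b : ℤ[X], π a = π b → ∃ r, a = b + C (q : ℤ) * r := by
    intro a b hab
    have : C (q : ℤ) ∣ a - b := by
      rw [Polynomial.C_dvd_iff_dvd_coeff]
      intro i
      rw [← ZMod.intCast_zmod_eq_zero_iff_dvd]
      have := congrArg (fun f => coeff f i) hab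
      simpa [π, sub_eq_zero] using this
    obtain ⟨r, hr⟩ := this
    exact ⟨r, by rw [← hr]; ring⟩
  let I : Ideal ℤ[X] := P.comap (aeval θ)
  obtain ⟨γ, hγ⟩ := (IsPrincipalIdealRing.principal (I.map π)).principal
  have hγ' : γ ∈ I.map π := hγ ▸ Submodule.mem_span_singleton_self γ
  obtain ⟨g, hgI, rfl⟩ := (Ideal.mem_map_iff_of_surjective π hπ).1 hγ'
  have hdvd : ∀ f ∈ I, ∃ h r : ℤ[X], f = g * h + C (q : ℤ) * r := by
    intro f hf
    have : π f ∈ I.map π := Ideal.mem_map_of_mem π hf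
    rw [hγ] at this
    obtain ⟨h, hh⟩ := Ideal.mem_span_singleton'.1 this
    obtain ⟨h, rfl⟩ := hπ h
    obtain ⟨r, hr⟩ := hker f (g * h) (by rw [← hh, map_mul, mul_comm])
    exact ⟨h, r, hr⟩
  obtain ⟨Y, rfl⟩ := hsurj y
  obtain ⟨h, r, hsr⟩ := hdvd s hs
  obtain ⟨Z, r₂, hYr⟩ := hdvd Y hy
  have hgP : aeval θ g ∈ P := hgI
  refine ⟨aeval θ h, fun hh => hs' ?_, ?_⟩
  · rw [hsr]
    simp only [derivative_mul, derivative_C, map_add, map_mul, zero_mul, zero_add]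
    refine P.add_mem (P.add_mem (P.mul_mem_left _ hh) (P.mul_mem_right _ hgP))
      (P.mul_mem_right _ ?_)
    simpa using hq
  · rw [Ideal.mem_span_pair]
    refine ⟨aeval θ (h * r₂ - r * Z), aeval θ Z, ?_⟩
    have : aeval θ (C (q : ℤ)) = (q : A) := by simp
    rw [← this, ← map_mul, ← map_mul, ← map_mul, ← map_add]
    congr 1
    linear_combination Z * hsr - h * hYr

lemma isDiscreteValuationRing_localization_of_locally_principal {A : Type*} [CommRing A]
    [IsDomain A] [IsNoetherianRing A] (P : Ideal A) [P.IsPrime] (hP : P ≠ ⊥) {ϖ : A} (hϖ : ϖ ∈ P)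
    (h : ∀ y ∈ P, ∃ u ∉ P, u * y ∈ Ideal.span {ϖ}) :
    IsDiscreteValuationRing (Localization.AtPrime P) := by
  have hf := IsLocalization.AtPrime.not_isField A hP (Localization.AtPrime P)
  have : IsNoetherianRing (Localization.AtPrime P) :=
    IsLocalization.isNoetherianRing P.primeCompl _ inferInstance
  have htfae := (IsDiscreteValuationRing.TFAE _ hf).out 4 0
  refine htfae.1 ⟨algebraMap _ _ ϖ, ?_⟩
  rw [← Localization.AtPrime.map_eq_maximalIdeal]
  apply le_antisymm
  · rw [Ideal.map_le_iff_le_comap]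
    intro y hy
    obtain ⟨u, hu, huy⟩ := h y hy
    obtain ⟨a, ha⟩ := Ideal.mem_span_singleton'.1 huy
    have hunit : IsUnit (algebraMap A (Localization.AtPrime P) u) :=
      IsLocalization.map_units _ (⟨u, hu⟩ : P.primeCompl)
    rw [Ideal.mem_comap, ← Ideal.unit_mul_mem_iff_mem _ hunit, ← map_mul, ← ha, map_mul]
    exact Ideal.mul_mem_left _ _ (Ideal.mem_span_singleton_self _)
  · exact (Ideal.span_singleton_le_iff_mem _).2 (Ideal.mem_map_of_mem _ hϖ)

/-- A form of Dedekind's criterion. -/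
lemma isIntegrallyClosed_of_adjoin_singleton_eq_top {A : Type*} [CommRing A] [IsDomain A]
    [CharZero A] {θ : A} (hint : IsIntegral ℤ θ) (hθ : Algebra.adjoin ℤ {θ} = ⊤)
    (h : ∀ (P : Ideal A) [P.IsPrime] (q : ℕ), q.Prime → (q : A) ∈ P →
      ∃ s : ℤ[X], aeval θ s ∈ P ∧ aeval θ (derivative s) ∉ P ∧
        (aeval θ s = 0 ∨ ∃ u ∉ P, u * q ∈ Ideal.span {aeval θ s})) :
    IsIntegrallyClosed A := by
  have hfin : Module.Finite ℤ A := by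
    have := hint.fg_adjoin_singleton
    rw [hθ] at this
    exact ⟨this⟩
  have : IsNoetherianRing A := IsNoetherianRing.of_finite ℤ A
  suffices IsDedekindDomainDvr A from inferInstance
  refine { is_dvr_at_nonzero_prime := fun P hP _ => ?_ }
  have hcomap : P.comap (algebraMap ℤ A) ≠ ⊥ := by
    obtain ⟨x, hx, hx0⟩ := P.ne_bot_iff.1 hP
    exact Ideal.comap_ne_bot_of_integral_mem hx0 hx (Algebra.IsIntegral.isIntegral x)
  obtain ⟨q, hq, hqP⟩ : ∃ q : ℕ, q.Prime ∧ (q : A) ∈ P := by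
    obtain ⟨n, hn⟩ := (IsPrincipalIdealRing.principal (P.comap (algebraMap ℤ A))).principal
    have hn0 : n ≠ 0 := by
      rintro rfl
      exact hcomap (by rw [hn]; simp)
    have hpr : Prime n := by
      rw [← Ideal.span_singleton_prime hn0]
      have : (P.comap (algebraMap ℤ A)).IsPrime := inferInstance
      rwa [hn] at this
    refine ⟨n.natAbs, Int.prime_iff_natAbs_prime.1 hpr, ?_⟩
    have hmem : n ∈ P.comap (algebraMap ℤ A) := hn ▸ Submodule.mem_span_singleton_self n
    have : (n : A) ∈ P := by simpa using hmem
    rcases Int.natAbs_eq n with h' | h' <;> rw [h'] at this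
    · simpa using this
    · simpa using this
  have : Fact q.Prime := ⟨hq⟩
  obtain ⟨s, hs, hs', hor⟩ := h P q hq hqP
  rcases hor with h0 | ⟨u, hu, hus⟩
  · refine isDiscreteValuationRing_localization_of_locally_principal P hP hqP fun y hy => ?_
    obtain ⟨u, hu, huy⟩ := exists_notMem_mul_mem_span_pair hθ P hqP hs hs' hy
    refine ⟨u, hu, ?_⟩
    rw [h0, Ideal.mem_span_pair] at huy
    obtain ⟨a, b, hab⟩ := huy
    exact Ideal.mem_span_singleton'.2 ⟨a, by rw [← hab]; ring⟩
  · refine isDiscreteValuationRing_localization_of_locally_principal P hP hs fun y hy => ?_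
    obtain ⟨v, hv, hvy⟩ := exists_notMem_mul_mem_span_pair hθ P hqP hs hs' hy
    refine ⟨u * v, fun hm => (‹P.IsPrime›.mem_or_mem hm).elim hu hv, ?_⟩
    rw [Ideal.mem_span_pair] at hvy
    obtain ⟨a, b, hab⟩ := hvy
    obtain ⟨d, hd⟩ := Ideal.mem_span_singleton'.1 hus
    refine Ideal.mem_span_singleton'.2 ⟨a * d + u * b, ?_⟩
    rw [mul_assoc, ← hab]
    linear_combination a * hd

lemma octic_monic_s18 (n : ℤ) : (octic n).Monic := by
  rw [octic]
  monicity!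

lemma octic_natDegree (n : ℤ) : (octic n).natDegree = 8 := by
  rw [octic]
  compute_degree!

lemma irreducible_fifth_cyclotomic_zmod_two :
    Irreducible (X ^ 4 + X ^ 3 + X ^ 2 + X + 1 : (ZMod 2)[X]) := by
  have : Fact (Nat.Prime 5) := ⟨by norm_num⟩
  have hcyc : cyclotomic 5 (ZMod 2) = X ^ 4 + X ^ 3 + X ^ 2 + X + 1 := by
    rw [cyclotomic_prime]
    simp only [Finset.sum_range_succ, Finset.sum_range_zero]
    ring
  have hdeg : (X ^ 4 + X ^ 3 + X ^ 2 + X + 1 : (ZMod 2)[X]).natDegree = 4 := by compute_degree!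
  refine ZMod.irreducible_of_dvd_cyclotomic_of_natDegree (n := 5) (by norm_num) hcyc.symm.dvd ?_
  rw [hdeg, eq_comm, orderOf_eq_iff (by norm_num)]
  decide

lemma octic_modByMonic (n : ℤ) : (octic n).modByMonic (X ^ 4 + X ^ 3 + X ^ 2 + X + 1) =
    C (-8 * n - 4) * X ^ 3 + C (-4 * n - 2) * X ^ 2 + C (-4 * n - 2) * X + C (-8 * n - 4) := by
  refine (div_modByMonic_unique (X ^ 4 - X ^ 3 + C (4 * n + 3) * X ^ 2 - C (4 * n + 3) * X +
    C (8 * n + 5)) _ (by monicity!) ⟨?_, ?_⟩).2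
  · simp only [octic, C_add, C_mul, C_sub, C_neg]
    simp only [map_ofNat]
    ring
  · have h1 : (X ^ 4 + X ^ 3 + X ^ 2 + X + 1 : ℤ[X]).degree = 4 := by compute_degree!
    rw [h1]
    refine lt_of_le_of_lt (b := 3) ?_ (by norm_num)
    compute_degree

lemma octic_irreducible_s18 (n : ℤ) : Irreducible (octic n) := by
  refine generalizedEisenstein (K := ZMod 2) (q := X ^ 4 + X ^ 3 + X ^ 2 + X + 1) (p := 2)
    ?_ (by monicity!) (octic_monic_s18 n).isPrimitive (by rw [octic_natDegree]; norm_num)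
    (by rw [octic_monic_s18 n]; simp) ?_ ?_
  · simpa using irreducible_fifth_cyclotomic_zmod_two
  · have h2 : (2 : (ZMod 2)[X]) = 0 := by
      have : (2 : ZMod 2) = 0 := rfl
      rw [← map_ofNat C, this, C_0]
    rw [octic_monic_s18 n]
    simp [octic]
    linear_combination (-X ^ 7 + 2 * (n : (ZMod 2)[X]) * X ^ 6 - 2 * X ^ 5
      + 4 * (n : (ZMod 2)[X]) * X ^ 4 - 2 * X ^ 3 + 2 * (n : (ZMod 2)[X]) * X ^ 2 - X) * h2
  · rw [octic_modByMonic]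
    intro h
    have hmem : (-4 * n - 2) ∈ RingHom.ker (algebraMap ℤ (ZMod 2)) ^ 2 := by
      rw [← Ideal.Quotient.eq_zero_iff_mem]
      have h1 := congrArg (fun f => coeff f 1) h
      simpa only [coeff_map, coeff_zero, coeff_add, coeff_C_mul, coeff_X_pow, coeff_X_one, coeff_C,
        OfNat.one_ne_ofNat, one_ne_zero, if_false, mul_zero, zero_add, add_zero, mul_one] using h1
    have hker : RingHom.ker (algebraMap ℤ (ZMod 2)) = Ideal.span {(2 : ℤ)} := by
      rw [algebraMap_int_eq, ZMod.ker_intCastRingHom]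
      rfl
    rw [hker, Ideal.span_singleton_pow, Ideal.mem_span_singleton] at hmem
    omega

lemma isFractionRing_adjoin_int {K : Type*} [Field K] [CharZero K] {θ : K}
    (hθ : Algebra.adjoin ℚ {θ} = (⊤ : Subalgebra ℚ K)) :
    IsFractionRing (Algebra.adjoin ℤ {θ}) K := by
  have key : ∀ z : K, ∃ m : ℤ, m ≠ 0 ∧ (m : K) * z ∈ Algebra.adjoin ℤ {θ} := by
    intro z
    have hz : z ∈ Algebra.adjoin ℚ {θ} := hθ ▸ Algebra.mem_top
    induction hz using Algebra.adjoin_induction with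
    | mem x hx =>
      exact ⟨1, one_ne_zero, by simpa using Algebra.subset_adjoin hx⟩
    | algebraMap r =>
      refine ⟨r.den, by exact_mod_cast r.den_nz, ?_⟩
      have : ((r.den : ℤ) : K) * algebraMap ℚ K r = algebraMap ℤ K r.num := by
        rw [eq_ratCast, algebraMap_int_eq, eq_intCast]
        exact_mod_cast congrArg (Rat.cast : ℚ → K) (Rat.den_mul_eq_num r)
      rw [this]
      exact Subalgebra.algebraMap_mem _ _
    | add x y _ _ hx hy =>
      obtain ⟨a, ha, hax⟩ := hx
      obtain ⟨b, hb, hby⟩ := hy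
      refine ⟨a * b, mul_ne_zero ha hb, ?_⟩
      have : ((a * b : ℤ) : K) * (x + y) = b * (a * x) + a * (b * y) := by push_cast; ring
      rw [this]
      exact add_mem (mul_mem (intCast_mem _ b) hax) (mul_mem (intCast_mem _ a) hby)
    | mul x y _ _ hx hy =>
      obtain ⟨a, ha, hax⟩ := hx
      obtain ⟨b, hb, hby⟩ := hy
      refine ⟨a * b, mul_ne_zero ha hb, ?_⟩
      have : ((a * b : ℤ) : K) * (x * y) = (a * x) * (b * y) := by push_cast; ring
      rw [this]
      exact mul_mem hax hby
  refine IsFractionRing.of_field _ K fun z => ?_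
  obtain ⟨m, hm, hmz⟩ := key z
  refine ⟨⟨_, hmz⟩, (m : Algebra.adjoin ℤ {θ}), ?_⟩
  have hm' : (m : K) ≠ 0 := Int.cast_ne_zero.2 hm
  have h1 : algebraMap (Algebra.adjoin ℤ {θ}) K m = (m : K) := by simp
  have h2 : algebraMap (Algebra.adjoin ℤ {θ}) K ⟨_, hmz⟩ = (m : K) * z := rfl
  rw [h1, h2]
  field_simp

theorem isMonogenic_octic {n : ℤ}
    (hsf : Squarefree ((16 * n + 13) * (4 * n + 1) * (4 * n - 3))) : IsMonogenic (octic n) := by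
  refine ⟨octic_monic_s18 n, ?_, fun K _ _ θ hθ htop => ?_⟩
  · exact ((octic_monic_s18 n).irreducible_iff_irreducible_map_fraction_map (K := ℚ)).1
      (octic_irreducible_s18 n)
  have hint : IsIntegral ℤ θ := ⟨octic n, octic_monic_s18 n, by rwa [← aeval_def]⟩
  let θ' : Algebra.adjoin ℤ {θ} := ⟨θ, Algebra.self_mem_adjoin_singleton ℤ θ⟩
  have hθ' : aeval θ' (octic n) = 0 := by
    apply Subtype.val_injective
    exact (aeval_algebraMap_apply K θ' (octic n)).symm.trans hθ
  have hint' : IsIntegral ℤ θ' := ⟨octic n, octic_monic_s18 n, by rwa [← aeval_def]⟩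
  have htop' : Algebra.adjoin ℤ {θ'} = ⊤ := by
    rw [← Algebra.adjoin_adjoin_coe_preimage (R := ℤ) (s := {θ})]
    congr 1
    ext y
    simp [θ', Subtype.ext_iff]
  have : IsIntegrallyClosed (Algebra.adjoin ℤ {θ}) :=
    isIntegrallyClosed_of_adjoin_singleton_eq_top hint' htop'
      fun P _ q hq hqP => exists_dedekind_witness_octic hsf hθ' P q hq hqP
  have := isFractionRing_adjoin_int htop
  refine le_antisymm (Algebra.adjoin_le (Set.singleton_subset_iff.2 hint)) fun x hx => ?_
  have hx' : IsIntegral (Algebra.adjoin ℤ {θ}) x := IsIntegral.tower_top (R := ℤ) hx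
  obtain ⟨y, rfl⟩ := IsIntegrallyClosed.isIntegral_iff.1 hx'
  exact y.2

/-- The action of the dihedral group of order 8 on the vertices of a square. -/
def squareAct : DihedralGroup 4 → ZMod 4 → ZMod 4
  | .r k, i => i + k
  | .sr k, i => -i - k

lemma squareAct_mul (g h : DihedralGroup 4) (i : ZMod 4) :
    squareAct (g * h) i = squareAct g (squareAct h i) := by
  revert g h i; decide

lemma squareAct_injective : Function.Injective squareAct := by
  decide

/-- The character of the dihedral group of order 8 recording the action on the two diagonals of
the square. -/
def diagonalSign : DihedralGroup 4 → ZMod 2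
  | .r k => k.val
  | .sr k => k.val

/-- The character of the dihedral group of order 8 which is trivial on the rotation by a half turn
and on the reflections without fixed vertices. -/
def edgeSign : DihedralGroup 4 → ZMod 2
  | .r k => k.val
  | .sr k => k.val + 1

/-- The abelianization of `ℤ/2ℤ × D₄`. -/
def abelianSigns : Multiplicative (ZMod 2) × DihedralGroup 4 →*
    Multiplicative (ZMod 2 × ZMod 2 × ZMod 2) where
  toFun g := .ofAdd (g.1.toAdd, diagonalSign g.2, edgeSign g.2)
  map_one' := by decide
  map_mul' g h := by
    have h2 : ∀ g h, diagonalSign (g * h) = diagonalSign g + diagonalSign h := by decide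
    have h3 : ∀ g h, edgeSign (g * h) = edgeSign g + edgeSign h := by decide
    simp only [Prod.snd_mul, Prod.fst_mul, h2, h3]
    rfl

lemma subgroup_eq_top_of_abelianSigns (H : Subgroup (Multiplicative (ZMod 2) × DihedralGroup 4))
    (hH : ∀ α β γ : ZMod 2, (α, β, γ) ≠ 0 →
      ∃ h ∈ H, α * h.1.toAdd + β * diagonalSign h.2 + γ * edgeSign h.2 ≠ 0) : H = ⊤ := by
  let W : Submodule (ZMod 2) (ZMod 2 × ZMod 2 × ZMod 2) :=
    AddSubgroup.toZModSubmodule 2 (Subgroup.toAddSubgroup' (H.map abelianSigns))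
  have hmem : ∀ h ∈ H, (h.1.toAdd, diagonalSign h.2, edgeSign h.2) ∈ W :=
    fun h hh => ⟨h, hh, rfl⟩
  have hW : W = ⊤ := by
    by_contra hne
    obtain ⟨f, hf0, hf⟩ := Submodule.exists_le_ker_of_lt_top W (lt_top_iff_ne_top.2 hne)
    have hfx : ∀ x : ZMod 2 × ZMod 2 × ZMod 2,
        f x = f (1, 0, 0) * x.1 + f (0, 1, 0) * x.2.1 + f (0, 0, 1) * x.2.2 := by
      intro x
      have : x = x.1 • (1, 0, 0) + x.2.1 • (0, 1, 0) + x.2.2 • (0, 0, 1) := by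
        ext <;> simp
      conv_lhs => rw [this]
      simp only [map_add, map_smul, smul_eq_mul]
      ring
    obtain ⟨h, hh, hne⟩ := hH (f (1, 0, 0)) (f (0, 1, 0)) (f (0, 0, 1)) (by
      intro h0
      simp only [Prod.mk_eq_zero] at h0
      exact hf0 (LinearMap.ext fun x => by simp [hfx x, h0]))
    exact hne ((hfx _).symm.trans (hf (hmem h hh)))
  have hsurj : ∀ g, ∃ h ∈ H, abelianSigns h = abelianSigns g := by
    intro g
    have : (abelianSigns g).toAdd ∈ W := hW ▸ Submodule.mem_top
    exact this
  have hr : ((1, .r 2) : Multiplicative (ZMod 2) × DihedralGroup 4) ∈ H := by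
    obtain ⟨h, hh, he⟩ := hsurj (1, .r 1)
    have : ∀ h, abelianSigns h = abelianSigns (1, .r 1) → h * h = (1, .r 2) := by decide
    rw [← this h he]
    exact H.mul_mem hh hh
  rw [eq_top_iff]
  intro g _
  obtain ⟨h, hh, he⟩ := hsurj g
  have hker : ∀ k, abelianSigns k = 1 → k = 1 ∨ k = (1, .r 2) := by decide
  have hg : g = h * (h⁻¹ * g) := by group
  rw [hg]
  refine H.mul_mem hh ?_
  rcases hker (h⁻¹ * g) (by rw [map_mul, map_inv, he, inv_mul_cancel]) with h1 | h1 <;> rw [h1]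
  · exact H.one_mem
  · exact hr

lemma not_isSquare_ratCast {m : ℤ} (hm : Squarefree m) (h1 : m ≠ 1) (r : ℚ) : r ^ 2 ≠ m := by
  intro h
  have hsq : IsSquare (m : ℚ) := ⟨r, by rw [← h, sq]⟩
  rw [Rat.isSquare_intCast_iff] at hsq
  obtain ⟨k, rfl⟩ := hsq
  have := hm k dvd_rfl
  rcases Int.isUnit_iff.1 this with rfl | rfl <;> simp at h1

/-- The sign `±1` attached to an element of `ℤ/2ℤ`. -/
def zmodTwoSign (L : Type*) [Ring L] (k : ZMod 2) : L := if k = 0 then 1 else -1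

lemma zmodTwoSign_add {L : Type*} [Ring L] (j k : ZMod 2) :
    zmodTwoSign L (j + k) = zmodTwoSign L j * zmodTwoSign L k := by
  have h : ∀ j : ZMod 2, j = 0 ∨ j = 1 := by decide
  have h11 : (1 : ZMod 2) + 1 = 0 := rfl
  rcases h j with rfl | rfl <;> rcases h k with rfl | rfl <;> simp [zmodTwoSign, h11]

lemma zmodTwoSign_injective {L : Type*} [Ring L] [CharZero L] :
    Function.Injective (zmodTwoSign L) := by
  have h : ∀ j : ZMod 2, j = 0 ∨ j = 1 := by decide
  have hne : (1 : L) ≠ -1 := by norm_num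
  intro j k hjk
  rcases h j with rfl | rfl <;> rcases h k with rfl | rfl <;>
    simp_all [zmodTwoSign, hne.symm]

/-- The vertices of the square `v, w, -v, -w`. -/
def squareVertex {L : Type*} [Neg L] (v w : L) : ZMod 4 → L := ![v, w, -v, -w]

lemma squareVertex_injective {L : Type*} [Field L] [CharZero L] {v w : L}
    (hv : v ≠ 0) (hw : w ≠ 0) (hvw : v ^ 2 ≠ w ^ 2) :
    Function.Injective (squareVertex v w) := by
  have h1 : v ≠ w := by rintro rfl; exact hvw rfl
  have h2 : v ≠ -w := by rintro rfl; exact hvw (by ring)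
  have h3 : v ≠ -v := fun h => hv (self_eq_neg.1 h)
  have h4 : w ≠ -w := fun h => hw (self_eq_neg.1 h)
  have h5 : w ≠ -v := fun h => h2 (by rw [h, neg_neg])
  have h6 : -v ≠ -w := fun h => h1 (neg_injective h)
  intro i j hij
  fin_cases i <;> fin_cases j <;> first | rfl | (exfalso; simp [squareVertex] at hij; grind)

section SquareSymmetries

variable {L : Type*} [Field L] [Algebra ℚ L]

/-- `g` describes the action of `σ` on `c` and on the square `v, w, -v, -w`. -/
def Describes (c v w : L) (σ : L ≃ₐ[ℚ] L) (g : Multiplicative (ZMod 2) × DihedralGroup 4) : Prop :=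
  σ c = zmodTwoSign L g.1.toAdd * c ∧
    ∀ i, σ (squareVertex v w i) = squareVertex v w (squareAct g.2 i)

lemma Describes.mul {c v w : L} {σ τ : L ≃ₐ[ℚ] L} {g h : Multiplicative (ZMod 2) × DihedralGroup 4}
    (hg : Describes c v w σ g) (hh : Describes c v w τ h) : Describes c v w (σ * τ) (g * h) := by
  have hsgn : ∀ k, σ (zmodTwoSign L k) = zmodTwoSign L k := by
    intro k
    unfold zmodTwoSign
    split_ifs <;> simp
  constructor
  · rw [AlgEquiv.mul_apply, hh.1, map_mul, hsgn, hg.1, Prod.fst_mul, toAdd_mul, zmodTwoSign_add]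
    ring
  · intro i
    rw [AlgEquiv.mul_apply, hh.2, hg.2, Prod.snd_mul, squareAct_mul]

lemma Describes.unique [CharZero L] {c v w : L} (hc : c ≠ 0) (hv : v ≠ 0) (hw : w ≠ 0)
    (hvw : v ^ 2 ≠ w ^ 2) {σ : L ≃ₐ[ℚ] L} {g h : Multiplicative (ZMod 2) × DihedralGroup 4}
    (hg : Describes c v w σ g) (hh : Describes c v w σ h) : g = h := by
  refine Prod.ext ?_ ?_
  · have := hg.1.symm.trans hh.1
    exact Multiplicative.toAdd.injective (zmodTwoSign_injective (mul_right_cancel₀ hc this))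
  · refine squareAct_injective (funext fun i => ?_)
    exact squareVertex_injective hv hw hvw ((hg.2 i).symm.trans (hh.2 i))

lemma exists_describes {c v w : L} {d e b : ℚ} (hc : c ^ 2 = algebraMap ℚ L d)
    (hsum : v ^ 2 + w ^ 2 = algebraMap ℚ L e) (hprod : (v * w) ^ 2 = algebraMap ℚ L b)
    (hv : v ≠ 0) (hw : w ≠ 0) (σ : L ≃ₐ[ℚ] L) : ∃ g, Describes c v w σ g := by
  have h1 : ∃ k : ZMod 2, σ c = zmodTwoSign L k * c := by
    have : (σ c) ^ 2 = c ^ 2 := by rw [← map_pow, hc, AlgEquiv.commutes]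
    rcases sq_eq_sq_iff_eq_or_eq_neg.1 this with h | h
    · exact ⟨0, by simp [zmodTwoSign, h]⟩
    · exact ⟨1, by simp [zmodTwoSign, h]⟩
  obtain ⟨k, hk⟩ := h1
  have hsum' : σ v ^ 2 + σ w ^ 2 = v ^ 2 + w ^ 2 := by
    rw [← map_pow, ← map_pow, ← map_add, hsum, AlgEquiv.commutes]
  have hprod' : (σ v * σ w) ^ 2 = (v * w) ^ 2 := by
    rw [← map_mul, ← map_pow, hprod, AlgEquiv.commutes]
  have hcases : (σ v = v ∨ σ v = -v) ∨ (σ v = w ∨ σ v = -w) := by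
    rw [← sq_eq_sq_iff_eq_or_eq_neg, ← sq_eq_sq_iff_eq_or_eq_neg, ← sub_eq_zero,
      ← sub_eq_zero (b := w ^ 2), ← mul_eq_zero]
    linear_combination (σ v) ^ 2 * hsum' - hprod'
  have hw' : (σ v * σ w = v * w) ∨ (σ v * σ w = -(v * w)) := sq_eq_sq_iff_eq_or_eq_neg.1 hprod'
  have hσ : ∃ g : DihedralGroup 4, σ v = squareVertex v w (squareAct g 0) ∧
      σ w = squareVertex v w (squareAct g 1) := by
    have hswap : ∀ s : L, v * s = v * w → s = w := fun s h => mul_left_cancel₀ hv h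
    have hswap' : ∀ s : L, w * s = w * v → s = v := fun s h => mul_left_cancel₀ hw h
    rcases hcases with (h | h) | (h | h) <;> rw [h] at hw' <;> rcases hw' with h' | h'
    · exact ⟨.r 0, h, hswap _ h'⟩
    · exact ⟨.sr 0, h, neg_eq_iff_eq_neg.1 (hswap (-σ w) (by linear_combination -h'))⟩
    · exact ⟨.r 2, h, neg_eq_iff_eq_neg.1 (hswap (-σ w) (by linear_combination h'))⟩
    · exact ⟨.sr 2, h, hswap _ (by linear_combination -h')⟩
    · exact ⟨.sr 3, h, hswap' _ (by linear_combination h')⟩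
    · exact ⟨.r 1, h, neg_eq_iff_eq_neg.1 (hswap' (-σ w) (by linear_combination -h'))⟩
    · exact ⟨.sr 1, h, neg_eq_iff_eq_neg.1 (hswap' (-σ w) (by linear_combination h'))⟩
    · exact ⟨.r 3, h, hswap' _ (by linear_combination -h')⟩
  obtain ⟨g, hg0, hg1⟩ := hσ
  have hadd : ∀ i, squareVertex v w (i + 2) = -squareVertex v w i := by
    intro i
    fin_cases i
    · rfl
    · rfl
    · exact (neg_neg v).symm
    · exact (neg_neg w).symm
  have hact : ∀ g i, squareAct g (i + 2) = squareAct g i + 2 := by decide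
  refine ⟨(.ofAdd k, g), hk, fun i => ?_⟩
  have h01 : i = 0 ∨ i = 1 ∨ i = 0 + 2 ∨ i = 1 + 2 := by revert i; decide
  rcases h01 with rfl | rfl | rfl | rfl
  · exact hg0
  · exact hg1
  · rw [hadd, map_neg, hact, hadd, ← hg0]; rfl
  · rw [hadd, map_neg, hact, hadd, ← hg1]; rfl

/-- The images of two adjacent vertices of the square, together with the two characters. -/
lemma squareAct_cases (g : DihedralGroup 4) :
    (squareAct g 0, squareAct g 1, diagonalSign g, edgeSign g) ∈
      [(0, 1, 0, 0), (1, 2, 1, 1), (2, 3, 0, 0), (3, 0, 1, 1),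
        (0, 3, 0, 1), (3, 2, 1, 0), (2, 1, 0, 1), (1, 0, 1, 0)] := by
  revert g; decide

lemma Describes.apply_diagonal_and_edge {c v w : L} {σ : L ≃ₐ[ℚ] L}
    {g : Multiplicative (ZMod 2) × DihedralGroup 4} (hg : Describes c v w σ g) :
    σ (v ^ 2 - w ^ 2) = zmodTwoSign L (diagonalSign g.2) * (v ^ 2 - w ^ 2) ∧
      σ (v * w) = zmodTwoSign L (edgeSign g.2) * (v * w) := by
  have h0 : σ v = squareVertex v w (squareAct g.2 0) := hg.2 0
  have h1 : σ w = squareVertex v w (squareAct g.2 1) := hg.2 1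
  have e0 : squareVertex v w 0 = v := rfl
  have e1 : squareVertex v w 1 = w := rfl
  have e2 : squareVertex v w 2 = -v := rfl
  have e3 : squareVertex v w 3 = -w := rfl
  have s0 : zmodTwoSign L 0 = 1 := by simp [zmodTwoSign]
  have s1 : zmodTwoSign L 1 = -1 := by simp [zmodTwoSign]
  rw [map_sub, map_mul, map_pow, map_pow, h0, h1]
  have hcases := squareAct_cases g.2
  simp only [List.mem_cons, Prod.mk.injEq, List.not_mem_nil, or_false] at hcases
  rcases hcases with h | h | h | h | h | h | h | h <;> obtain ⟨ha, hb, hc, hd⟩ := h <;>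
    rw [ha, hb, hc, hd] <;> simp only [e0, e1, e2, e3, s0, s1] <;> constructor <;> ring

/-- The Galois group of a field generated by the square roots of the conjugates of a quadratic
irrationality, together with one more independent square root. -/
theorem nonempty_mulEquiv_of_squares [FiniteDimensional ℚ L] [IsGalois ℚ L] {c v w : L} {d e b : ℚ}
    (hc : c ^ 2 = algebraMap ℚ L d) (hsum : v ^ 2 + w ^ 2 = algebraMap ℚ L e)
    (hprod : (v * w) ^ 2 = algebraMap ℚ L b)
    (hnsq : ∀ α β γ : ZMod 2, (α, β, γ) ≠ 0 →
      ∀ r : ℚ, r ^ 2 ≠ d ^ α.val * (e ^ 2 - 4 * b) ^ β.val * b ^ γ.val)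
    (hgen : ∀ σ : L ≃ₐ[ℚ] L, σ c = c → σ v = v → σ w = w → σ = 1) :
    Nonempty ((L ≃ₐ[ℚ] L) ≃* Multiplicative (ZMod 2) × DihedralGroup 4) := by
  have : CharZero L := algebraRat.charZero L
  have hd0 : d ≠ 0 := by
    rintro rfl
    exact hnsq 1 0 0 (by decide) 0 (by simp [ZMod.val_one])
  have hb0 : b ≠ 0 := by
    rintro rfl
    exact hnsq 0 0 1 (by decide) 0 (by simp [ZMod.val_one])
  have hD0 : e ^ 2 - 4 * b ≠ 0 := by
    intro h
    exact hnsq 0 1 0 (by decide) 0 (by simp [ZMod.val_one, h])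
  have hdisc : (v ^ 2 - w ^ 2) ^ 2 = algebraMap ℚ L (e ^ 2 - 4 * b) := by
    rw [map_sub, map_mul, map_pow, map_ofNat, ← hsum, ← hprod]
    ring
  have hinj : Function.Injective (algebraMap ℚ L) := (algebraMap ℚ L).injective
  have hc0 : c ≠ 0 := by
    rintro rfl
    exact hd0 (hinj (by rw [← hc, map_zero]; ring))
  have hvw0 : v * w ≠ 0 := by
    intro h
    exact hb0 (hinj (by rw [← hprod, h, map_zero]; ring))
  have hv0 := left_ne_zero_of_mul hvw0
  have hw0 := right_ne_zero_of_mul hvw0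
  have hne : v ^ 2 ≠ w ^ 2 := by
    intro h
    exact hD0 (hinj (by rw [← hdisc, h, map_zero]; ring))
  choose φ hφ using exists_describes (c := c) hc hsum hprod hv0 hw0
  let Φ : (L ≃ₐ[ℚ] L) →* Multiplicative (ZMod 2) × DihedralGroup 4 :=
    MonoidHom.mk' φ fun σ τ => (hφ (σ * τ)).unique hc0 hv0 hw0 hne ((hφ σ).mul (hφ τ))
  have hΦinj : Function.Injective Φ := by
    rw [injective_iff_map_eq_one]
    intro σ hσ
    have hone : Describes c v w σ 1 := by
      have := hφ σ
      rwa [show φ σ = 1 from hσ] at this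
    refine hgen σ (hone.1.trans ?_) (hone.2 0) (hone.2 1)
    simp [zmodTwoSign]
  have hΦsurj : Φ.range = ⊤ := by
    refine subgroup_eq_top_of_abelianSigns _ fun α β γ hne0 => ?_
    by_contra! hall
    have hfix : c ^ α.val * (v ^ 2 - w ^ 2) ^ β.val * (v * w) ^ γ.val ∈
        Set.range (algebraMap ℚ L) := by
      rw [IsGalois.mem_range_algebraMap_iff_fixed]
      intro σ
      have hz := hall (φ σ) ⟨σ, rfl⟩
      have hpow : ∀ α k : ZMod 2, zmodTwoSign L k ^ α.val = zmodTwoSign L (α * k) := by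
        have h01 : ∀ j : ZMod 2, j = 0 ∨ j = 1 := by decide
        intro α k
        rcases h01 α with rfl | rfl
        · simp [zmodTwoSign]
        · simp [ZMod.val_one]
      rw [map_mul, map_mul, map_pow, map_pow, map_pow, (hφ σ).1, (hφ σ).apply_diagonal_and_edge.1,
        (hφ σ).apply_diagonal_and_edge.2, mul_pow, mul_pow (zmodTwoSign _ _) (v ^ 2 - w ^ 2),
        mul_pow (zmodTwoSign _ _) (v * w), hpow, hpow, hpow]
      have h1 : zmodTwoSign L (α * (φ σ).1.toAdd) * zmodTwoSign L (β * diagonalSign (φ σ).2) *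
          zmodTwoSign L (γ * edgeSign (φ σ).2) = 1 := by
        rw [← zmodTwoSign_add, ← zmodTwoSign_add, hz]
        simp [zmodTwoSign]
      linear_combination (c ^ α.val * (v ^ 2 - w ^ 2) ^ β.val * (v * w) ^ γ.val) * h1
    obtain ⟨r, hr⟩ := hfix
    refine hnsq α β γ hne0 r (hinj ?_)
    rw [map_pow, hr, map_mul, map_mul, map_pow, map_pow, map_pow, ← hc, ← hdisc, ← hprod,
      mul_pow, mul_pow, pow_right_comm c, pow_right_comm (v ^ 2 - w ^ 2), pow_right_comm (v * w)]
  exact ⟨MulEquiv.ofBijective Φ ⟨hΦinj, MonoidHom.range_eq_top.1 hΦsurj⟩⟩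

end SquareSymmetries

lemma octic_aeval_eq_zero_iff {L : Type*} [Field L] [CharZero L] {n : ℤ} {z : L} :
    aeval z (octic n) = 0 ↔
      z ^ 8 + (4 * n + 3) * z ^ 6 + (8 * n + 5) * z ^ 4 + (4 * n + 3) * z ^ 2 + 1 = 0 := by
  simp [octic, map_ofNat]

lemma exists_roots_of_octic_splits {L : Type*} [Field L] [CharZero L] {n : ℤ}
    (hs : ((octic n).map (Int.castRingHom L)).Splits) :
    ∃ x y : L, x ≠ 0 ∧ y ≠ 0 ∧ (x + x⁻¹) * (y + y⁻¹) = 1 ∧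
      (x + x⁻¹) ^ 2 + (y + y⁻¹) ^ 2 = 1 - 4 * n := by
  have hmonic : ((octic n).map (Int.castRingHom L)).Monic := (octic_monic_s18 n).map _
  have hdeg : ((octic n).map (Int.castRingHom L)).natDegree = 8 := by
    rw [(octic_monic_s18 n).natDegree_map, octic_natDegree]
  obtain ⟨x, hx⟩ := hs.exists_eval_eq_zero (degree_ne_of_natDegree_ne (by rw [hdeg]; norm_num))
  have hx' : x ^ 8 + (4 * n + 3) * x ^ 6 + (8 * n + 5) * x ^ 4 + (4 * n + 3) * x ^ 2 + 1 = 0 := by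
    rw [eval_map, eval₂_eq_eval_map] at hx
    exact octic_aeval_eq_zero_iff.1 (by rwa [aeval_def, eval₂_eq_eval_map])
  have hx0 : x ≠ 0 := by
    rintro rfl
    norm_num at hx'
  obtain ⟨s, hs'⟩ : ∃ s, s = x ^ 2 + x⁻¹ ^ 2 := ⟨_, rfl⟩
  have hquad : s * (-(4 * n + 3) - s) = 8 * n + 3 := by
    refine mul_left_cancel₀ (pow_ne_zero 4 hx0) ?_
    rw [hs']
    field_simp
    linear_combination -hx'
  have hdvd : X ^ 4 - C (-(4 * n + 3) - s) * X ^ 2 + 1 ∣ (octic n).map (Int.castRingHom L) := by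
    refine ⟨X ^ 4 - C s * X ^ 2 + 1, ?_⟩
    have h1 : (C s * (-(4 * C (n : L) + 3) - C s) : L[X]) = 8 * C (n : L) + 3 := by
      have := congrArg C hquad
      simpa only [C_mul, C_sub, C_neg, C_add, C_ofNat] using this
    simp only [octic, Polynomial.map_add, Polynomial.map_mul, Polynomial.map_pow, map_X, map_C,
      Polynomial.map_one]
    simp only [eq_intCast, Int.cast_add, Int.cast_mul, Int.cast_ofNat, C_mul, C_sub, C_neg, C_add,
      C_ofNat]
    linear_combination -X ^ 4 * h1
  have hsplit := hs.of_dvd hmonic.ne_zero hdvd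
  obtain ⟨y, hy⟩ := hsplit.exists_eval_eq_zero (degree_ne_of_natDegree_ne (by
    have : (X ^ 4 - C (-(4 * n + 3) - s) * X ^ 2 + 1 : L[X]).natDegree = 4 := by compute_degree!
    rw [this]
    norm_num))
  simp only [eval_add, eval_sub, eval_mul, eval_pow, eval_X, eval_C, eval_one] at hy
  have hy0 : y ≠ 0 := by
    rintro rfl
    norm_num at hy
  have hsy : -(4 * n + 3) - s = y ^ 2 + y⁻¹ ^ 2 := by
    refine mul_left_cancel₀ (pow_ne_zero 2 hy0) ?_
    field_simp
    linear_combination -hy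
  have hux : (x + x⁻¹) ^ 2 = s + 2 := by
    rw [hs']
    field_simp
    ring
  have huy : (y + y⁻¹) ^ 2 = -(4 * n + 3) - s + 2 := by
    rw [hsy]
    field_simp
    ring
  have hprod : ((x + x⁻¹) * (y + y⁻¹)) ^ 2 = 1 := by
    rw [mul_pow, hux, huy]
    linear_combination hquad
  rcases sq_eq_one_iff.1 hprod with h | h
  · exact ⟨x, y, hx0, hy0, h, by rw [hux, huy]; ring⟩
  · refine ⟨x, -y, hx0, neg_ne_zero.2 hy0, ?_, ?_⟩
    · rw [inv_neg]
      linear_combination -h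
    · rw [inv_neg, hux]
      linear_combination huy

/-- The roots of the octic are `±x^{±1}` and `±y^{±1}`. -/
lemma octic_root_cases {L : Type*} [Field L] [CharZero L] {n : ℤ} {x y z : L}
    (hx : x ≠ 0) (hy : y ≠ 0) (h1 : (x + x⁻¹) * (y + y⁻¹) = 1)
    (h2 : (x + x⁻¹) ^ 2 + (y + y⁻¹) ^ 2 = 1 - 4 * n) (hz : aeval z (octic n) = 0) :
    ((z = x ∨ z = -x) ∨ (z = x⁻¹ ∨ z = -x⁻¹)) ∨ ((z = y ∨ z = -y) ∨ (z = y⁻¹ ∨ z = -y⁻¹)) := by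
  rw [octic_aeval_eq_zero_iff] at hz
  simp only [← sq_eq_sq_iff_eq_or_eq_neg]
  have hxx : x * x⁻¹ = 1 := mul_inv_cancel₀ hx
  have hyy : y * y⁻¹ = 1 := mul_inv_cancel₀ hy
  have key : (z ^ 2 - x ^ 2) * (z ^ 2 - x⁻¹ ^ 2) * ((z ^ 2 - y ^ 2) * (z ^ 2 - y⁻¹ ^ 2)) = 0 := by
    have ex : (z ^ 2 - x ^ 2) * (z ^ 2 - x⁻¹ ^ 2) =
        z ^ 4 - ((x + x⁻¹) ^ 2 - 2) * z ^ 2 + 1 := by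
      linear_combination (2 * z ^ 2 + x * x⁻¹ + 1) * hxx
    have ey : (z ^ 2 - y ^ 2) * (z ^ 2 - y⁻¹ ^ 2) =
        z ^ 4 - ((y + y⁻¹) ^ 2 - 2) * z ^ 2 + 1 := by
      linear_combination (2 * z ^ 2 + y * y⁻¹ + 1) * hyy
    rw [ex, ey]
    linear_combination hz + ((x + x⁻¹) * (y + y⁻¹) + 1) * z ^ 4 * h1 -
      (z ^ 6 + 2 * z ^ 4 + z ^ 2) * h2
  simpa only [mul_eq_zero, sub_eq_zero] using key

/-- The automorphism group of a splitting field of the octic. -/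
theorem nonempty_mulEquiv_of_isSplittingField_octic {L : Type*} [Field L] [Algebra ℚ L] {n : ℤ}
    [IsSplittingField ℚ L ((octic n).map (Int.castRingHom ℚ))] (hn : 1 < n)
    (hsf : Squarefree ((16 * n + 13) * (4 * n + 1) * (4 * n - 3))) :
    Nonempty ((L ≃ₐ[ℚ] L) ≃* Multiplicative (ZMod 2) × DihedralGroup 4) := by
  have : CharZero L := algebraRat.charZero L
  have hroots := IsSplittingField.adjoin_rootSet L ((octic n).map (Int.castRingHom ℚ))
  have hs := IsSplittingField.splits L ((octic n).map (Int.castRingHom ℚ))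
  have hirr : Irreducible ((octic n).map (Int.castRingHom ℚ)) := (isMonogenic_octic hsf).2.1
  have : FiniteDimensional ℚ L :=
    IsSplittingField.finiteDimensional L ((octic n).map (Int.castRingHom ℚ))
  have : IsGalois ℚ L := IsGalois.of_separable_splitting_field hirr.separable
  rw [Polynomial.map_map, RingHom.ext_int ((algebraMap ℚ L).comp _) (Int.castRingHom L)] at hs
  obtain ⟨x, y, hx, hy, h1, h2⟩ := exists_roots_of_octic_splits hs
  have hxx : x * x⁻¹ = 1 := mul_inv_cancel₀ hx
  have hyy : y * y⁻¹ = 1 := mul_inv_cancel₀ hy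
  have hc : ((x + x⁻¹) + (y + y⁻¹)) ^ 2 = algebraMap ℚ L (3 - 4 * n) := by
    simp only [map_sub, map_mul, map_ofNat, map_intCast]
    linear_combination h2 + 2 * h1
  refine nonempty_mulEquiv_of_squares (c := (x + x⁻¹) + (y + y⁻¹))
    (v := x - x⁻¹) (w := y - y⁻¹) (d := 3 - 4 * n) (e := -(4 * n + 7)) (b := 16 * n + 13)
    hc ?_ ?_ ?_ ?_
  · simp only [map_neg, map_add, map_mul, map_ofNat, map_intCast]
    linear_combination h2 - 4 * hxx - 4 * hyy
  · simp only [map_add, map_mul, map_ofNat, map_intCast]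
    have ex : (x - x⁻¹) ^ 2 = (x + x⁻¹) ^ 2 - 4 := by linear_combination -4 * hxx
    have ey : (y - y⁻¹) ^ 2 = (y + y⁻¹) ^ 2 - 4 := by linear_combination -4 * hyy
    rw [mul_pow, ex, ey]
    linear_combination ((x + x⁻¹) * (y + y⁻¹) + 1) * h1 - 4 * h2
  · have hD : ((-(4 * n + 7)) ^ 2 - 4 * (16 * n + 13) : ℚ) = ((4 * n + 1) * (4 * n - 3) : ℤ) := by
      push_cast
      ring
    have hB : (16 * n + 13 : ℚ) = (16 * n + 13 : ℤ) := by push_cast; ring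
    have hBpos : (0 : ℚ) < (16 * n + 13 : ℤ) := by
      exact_mod_cast (by linarith : (0 : ℤ) < 16 * n + 13)
    have hDpos : (0 : ℚ) < ((4 * n + 1) * (4 * n - 3) : ℤ) := by
      exact_mod_cast (by nlinarith : (0 : ℤ) < (4 * n + 1) * (4 * n - 3))
    have hdneg : (3 - 4 * n : ℚ) < 0 := by
      exact_mod_cast (by linarith : (3 - 4 * n : ℤ) < 0)
    intro α β γ hne r
    rw [hD, hB]
    have h01 : ∀ j : ZMod 2, j = 0 ∨ j = 1 := by decide
    rcases h01 α with rfl | rfl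
    · rw [ZMod.val_zero, pow_zero, one_mul, ← Int.cast_pow, ← Int.cast_pow, ← Int.cast_mul]
      rcases h01 β with rfl | rfl <;> rcases h01 γ with rfl | rfl
      · exact absurd rfl hne
      all_goals
        simp only [ZMod.val_zero, ZMod.val_one, pow_zero, pow_one, one_mul, mul_one]
        refine not_isSquare_ratCast (hsf.squarefree_of_dvd ?_) ?_ r
      · exact ⟨(4 * n + 1) * (4 * n - 3), by ring⟩
      · linarith
      · exact ⟨16 * n + 13, by ring⟩
      · nlinarith
      · exact ⟨1, by ring⟩
      · exact (one_lt_mul_of_lt_of_le (by nlinarith) (by linarith)).ne'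
    · rw [ZMod.val_one, pow_one]
      refine fun h => absurd (sq_nonneg r) (not_le.2 (h ▸ ?_))
      exact mul_neg_of_neg_of_pos (mul_neg_of_neg_of_pos hdneg (pow_pos hDpos _)) (pow_pos hBpos _)
  · intro σ hσc hσv hσw
    have hc0 : (x + x⁻¹) + (y + y⁻¹) ≠ 0 := by
      intro h0
      rw [h0, zero_pow two_ne_zero, eq_comm, map_eq_zero] at hc
      have : (3 - 4 * n : ℤ) = 0 := by exact_mod_cast hc
      omega
    have hdiff : ((x + x⁻¹) + (y + y⁻¹)) * ((x + x⁻¹) - (y + y⁻¹)) =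
        (x - x⁻¹) ^ 2 - (y - y⁻¹) ^ 2 := by
      linear_combination 4 * hxx - 4 * hyy
    have hσd : σ ((x + x⁻¹) - (y + y⁻¹)) = (x + x⁻¹) - (y + y⁻¹) := by
      refine mul_left_cancel₀ hc0 ?_
      conv_lhs => rw [← hσc]
      rw [← map_mul, hdiff, map_sub, map_pow, map_pow, hσv, hσw]
    have hσx : σ x = x := by
      refine mul_left_cancel₀ (by norm_num : (4 : L) ≠ 0) ?_
      simp only [map_add, map_sub] at hσc hσv hσd
      linear_combination hσc + hσd + 2 * hσv
    have hσy : σ y = y := by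
      refine mul_left_cancel₀ (by norm_num : (4 : L) ≠ 0) ?_
      simp only [map_add, map_sub] at hσc hσw hσd
      linear_combination hσc - hσd + 2 * hσw
    refine AlgEquiv.coe_toAlgHom_injective (AlgHom.ext_of_adjoin_eq_top hroots fun z hz => ?_)
    have hz' : aeval z (octic n) = 0 := by
      have := (mem_rootSet.1 hz).2
      rwa [← algebraMap_int_eq, aeval_map_algebraMap] at this
    change σ z = z
    rcases octic_root_cases hx hy h1 h2 hz' with
      ((rfl | rfl) | (rfl | rfl)) | ((rfl | rfl) | (rfl | rfl)) <;>
      simp only [map_neg, map_inv₀, hσx, hσy]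

theorem stmt_18 (p : ℕ) (hp : p.Prime)
    (hsf : Squarefree ((16 * (p : ℤ) + 13) * (4 * (p : ℤ) + 1) * (4 * (p : ℤ) - 3))) :
    IsMonogenic (X ^ 8 + C (4 * (p : ℤ) + 3) * X ^ 6 + C (8 * (p : ℤ) + 5) * X ^ 4 +
        C (4 * (p : ℤ) + 3) * X ^ 2 + 1) ∧
      Nonempty ((((X ^ 8 + C (4 * (p : ℤ) + 3) * X ^ 6 + C (8 * (p : ℤ) + 5) * X ^ 4 +
        C (4 * (p : ℤ) + 3) * X ^ 2 + 1 : Polynomial ℤ).map (Int.castRingHom ℚ)).Gal ≃*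
        Multiplicative (ZMod 2) × DihedralGroup 4)) := by
  have hn : (1 : ℤ) < p := by exact_mod_cast hp.one_lt
  exact ⟨isMonogenic_octic hsf, @nonempty_mulEquiv_of_isSplittingField_octic
    _ _ _ _ (IsSplittingField.splittingField ((octic p).map (Int.castRingHom ℚ))) hn hsf⟩
end
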